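/- arXiv:1801.02519 — 3 statements merged into one kernel-verified Lean document; each statement's English description precedes it below -/
import Mathlib

section
/- If every maximal prime-power factor of a positive integer v is a prime power congruent to 1 (mod 6) and different from 13, then there exists a finite additive group G of order v and a G-regular Fano Kaleidoscope FK(v). -/
section KaleidoscopeDefs

variable {G V : Type*}

/-- The multiset of differences `x - y` over ordered pairs of distinct elements of `B`. -/
def diffMultiset [AddGroup G] [DecidableEq G] (B : Finset G) : Multiset G :=
  ((B ×ˢ B).filter fun p => p.1 ≠ p.2).val.map fun p => p.1 - p.2

/-- A `(G, k, lam)`-difference family, given as a multiset of blocks. -/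
def IsDiffFamily [AddGroup G] [DecidableEq G] (k lam : ℕ) (𝓕 : Multiset (Finset G)) : Prop :=
  (∀ B ∈ 𝓕, B.card = k) ∧ ∀ g : G, g ≠ 0 → (𝓕.bind diffMultiset).count g = lam

/-- The `j`-th line `{b_j, b_{j+1}, b_{j+3}}` (indices mod 7) of an ordered 7-tuple. -/
def fanoLine [DecidableEq G] (B : Fin 7 → G) (j : Fin 7) : Finset G :=
  {B j, B (j + 1), B (j + 3)}

/-- A Fano Kaleidoscopic difference family: a family of ordered 7-tuples of distinct
elements such that for each `j` the family of `j`-th lines is a `(G,3,1)`-DF. -/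
def IsFKDF [AddGroup G] [DecidableEq G] (𝓕 : Multiset (Fin 7 → G)) : Prop :=
  (∀ B ∈ 𝓕, Function.Injective B) ∧
    ∀ j : Fin 7, IsDiffFamily 3 1 (𝓕.map fun B => fanoLine B j)

/-- The `i`-th line of an ordered 9-tuple `(binf, b_0, …, b_7)`:
`{b_i, b_{i+1}, b_{i+3}}` (indices mod 8) for `0 ≤ i ≤ 7`, and
`{binf, b_{i-8}, b_{i-4}}` for `8 ≤ i ≤ 11`. -/
def hesseLine [DecidableEq G] (binf : G) (b : Fin 8 → G) (i : Fin 12) : Finset G :=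
  if h : (i : ℕ) < 8 then
    {b ⟨i, h⟩, b (⟨i, h⟩ + 1), b (⟨i, h⟩ + 3)}
  else
    {binf, b ⟨(i : ℕ) - 8, by have := i.isLt; omega⟩,
      b (⟨(i : ℕ) - 8, by have := i.isLt; omega⟩ + 4)}

/-- A Hesse Kaleidoscopic difference family: a family of ordered 9-tuples of distinct
elements such that for each `i` the family of `i`-th lines is a `(G,3,1)`-DF. -/
def IsHKDF [AddGroup G] [DecidableEq G] (𝓕 : Multiset (G × (Fin 8 → G))) : Prop :=
  (∀ B ∈ 𝓕, Function.Injective B.2 ∧ ∀ k, B.1 ≠ B.2 k) ∧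
    ∀ i : Fin 12, IsDiffFamily 3 1 (𝓕.map fun B => hesseLine B.1 B.2 i)

/-- The point set of a colored plane given by its (colored) lines. -/
def linesPts [DecidableEq V] {n : ℕ} (L : Fin n → Finset V) : Finset V :=
  Finset.univ.biUnion L

/-- `L` describes a Fano plane with points in `V`, where `L i` is the line colored `c_i`:
7 points, seven 3-element lines, and any two distinct points on exactly one line. -/
def IsColoredFano [DecidableEq V] (L : Fin 7 → Finset V) : Prop :=
  (linesPts L).card = 7 ∧ (∀ i, (L i).card = 3) ∧
    ∀ x y : V, x ∈ linesPts L → y ∈ linesPts L → x ≠ y →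
      ∃! i : Fin 7, x ∈ L i ∧ y ∈ L i

/-- A Fano Kaleidoscope on the point set `V`: a multiset of line-colored Fano planes such
that for all distinct `x y` and every color `i` exactly one plane has `x, y` on its
`c_i`-colored line. -/
def IsFanoKaleidoscope [DecidableEq V] (K : Multiset (Fin 7 → Finset V)) : Prop :=
  (∀ L ∈ K, IsColoredFano L) ∧
    ∀ x y : V, x ≠ y → ∀ i : Fin 7,
      Multiset.countP (fun L => x ∈ L i ∧ y ∈ L i) K = 1

/-- A `G`-regular Fano Kaleidoscope: a Fano Kaleidoscope with point set `G` invariant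
(with colors) under all translations. -/
def IsRegularFK (G : Type*) [AddGroup G] [DecidableEq G]
    (K : Multiset (Fin 7 → Finset G)) : Prop :=
  IsFanoKaleidoscope K ∧ ∀ g : G, K.map (fun L => fun i => (L i).image (· + g)) = K

/-- `L` describes a Hesse plane (an `AG(2,3)`) with points in `V`, where `L i` is the line
colored `c_i`. -/
def IsColoredHesse [DecidableEq V] (L : Fin 12 → Finset V) : Prop :=
  (linesPts L).card = 9 ∧ (∀ i, (L i).card = 3) ∧
    ∀ x y : V, x ∈ linesPts L → y ∈ linesPts L → x ≠ y →
      ∃! i : Fin 12, x ∈ L i ∧ y ∈ L i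

/-- A Hesse Kaleidoscope on the point set `V`. -/
def IsHesseKaleidoscope [DecidableEq V] (K : Multiset (Fin 12 → Finset V)) : Prop :=
  (∀ L ∈ K, IsColoredHesse L) ∧
    ∀ x y : V, x ≠ y → ∀ i : Fin 12,
      Multiset.countP (fun L => x ∈ L i ∧ y ∈ L i) K = 1

/-- A `G`-regular Hesse Kaleidoscope. -/
def IsRegularHK (G : Type*) [AddGroup G] [DecidableEq G]
    (K : Multiset (Fin 12 → Finset G)) : Prop :=
  IsHesseKaleidoscope K ∧ ∀ g : G, K.map (fun L => fun i => (L i).image (· + g)) = K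

/-- An `(H, k, 1)`-difference matrix: a `k × |H|` matrix with entries in `H` such that the
difference of any two distinct rows contains each element of `H` exactly once. -/
def IsDiffMatrix (H : Type*) [AddGroup H] [Fintype H] (k : ℕ)
    (M : Fin k → Fin (Fintype.card H) → H) : Prop :=
  ∀ r s : Fin k, r ≠ s → Function.Bijective fun c => M r c - M s c

/-- A 2-`(v, k, lam)` design (block multiset) on the point set `V`. -/
def Is2Design [DecidableEq V] (k lam : ℕ) (𝓑 : Multiset (Finset V)) : Prop :=
  (∀ b ∈ 𝓑, b.card = k) ∧
    ∀ x y : V, x ≠ y → Multiset.countP (fun b => x ∈ b ∧ y ∈ b) 𝓑 = lam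

/-- A pairwise balanced design with block sizes in `K` on the point set `V`. -/
def IsPBD [DecidableEq V] (K : Set ℕ) (𝓑 : Multiset (Finset V)) : Prop :=
  (∀ b ∈ 𝓑, b.card ∈ K) ∧
    ∀ x y : V, x ≠ y → Multiset.countP (fun b => x ∈ b ∧ y ∈ b) 𝓑 = 1

/-- Existence of a Fano Kaleidoscope of order `v`. -/
def ExistsFK (v : ℕ) : Prop :=
  ∃ K : Multiset (Fin 7 → Finset (Fin v)), IsFanoKaleidoscope K

end KaleidoscopeDefs


/-! ### Part I: indexed families of base planes -/

/-- Offsets of the three points of a Fano line. -/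
def fkOffs : Fin 3 → Fin 7 := ![0, 1, 3]

/-- Indexed form of a Fano Kaleidoscopic difference family. -/
def FKFam {ι G : Type} [AddCommGroup G] (B : ι → Fin 7 → G) : Prop :=
  (∀ i, Function.Injective (B i)) ∧
    ∀ j : Fin 7, ∀ g : G, g ≠ 0 →
      ∃! t : ι × Fin 3 × Fin 3,
        B t.1 (j + fkOffs t.2.1) - B t.1 (j + fkOffs t.2.2) = g

/-- There is an abelian group of order `v` with a Fano Kaleidoscopic difference family. -/
def FKGood (v : ℕ) : Prop :=
  ∃ (G : Type) (_ : AddCommGroup G) (_ : Fintype G) (_ : DecidableEq G)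
    (ι : Type) (_ : Fintype ι) (B : ι → Fin 7 → G), Fintype.card G = v ∧ FKFam B

lemma fkOffs_inj : ∀ j : Fin 7, ∀ k l : Fin 3, j + fkOffs k = j + fkOffs l → k = l := by
  decide

lemma mem_fanoLine {G : Type} [DecidableEq G] (B : Fin 7 → G) (j : Fin 7) (x : G) :
    x ∈ fanoLine B j ↔ ∃ k : Fin 3, x = B (j + fkOffs k) := by
  simp [fanoLine, fkOffs, Fin.exists_fin_succ]

lemma fano_unique : ∀ a b : Fin 7, a ≠ b →
    ∃! i : Fin 7, (∃ k : Fin 3, a = i + fkOffs k) ∧ (∃ k : Fin 3, b = i + fkOffs k) := by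
  unfold ExistsUnique
  decide

lemma fano_cover : ∀ a : Fin 7, ∃ i : Fin 7, ∃ k : Fin 3, a = i + fkOffs k := by
  decide

/-- The translate by `g` of the colored plane of the ordered 7-tuple `b`. -/
def fkPlane {G : Type} [AddCommGroup G] [DecidableEq G] (b : Fin 7 → G) (g : G) :
    Fin 7 → Finset G :=
  fun i => (fanoLine b i).image (· + g)

lemma mem_fkPlane {G : Type} [AddCommGroup G] [DecidableEq G] (b : Fin 7 → G) (g : G)
    (i : Fin 7) (x : G) :
    x ∈ fkPlane b g i ↔ ∃ k : Fin 3, x = b (i + fkOffs k) + g := by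
  unfold fkPlane
  rw [Finset.mem_image]
  constructor
  · rintro ⟨y, hy, rfl⟩
    obtain ⟨k, rfl⟩ := (mem_fanoLine _ _ _).1 hy
    exact ⟨k, rfl⟩
  · rintro ⟨k, rfl⟩
    exact ⟨_, (mem_fanoLine _ _ _).2 ⟨k, rfl⟩, rfl⟩

lemma fkPlane_colored {G : Type} [AddCommGroup G] [DecidableEq G] (b : Fin 7 → G)
    (hb : Function.Injective b) (g : G) : IsColoredFano (fkPlane b g) := by
  have hinj : Function.Injective (fun k => b k + g) := fun k l h => hb (add_right_cancel h)
  have hpts : linesPts (fkPlane b g) = Finset.univ.image (fun k => b k + g) := by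
    ext x
    simp only [linesPts, Finset.mem_biUnion, Finset.mem_univ, true_and, mem_fkPlane,
      Finset.mem_image]
    constructor
    · rintro ⟨i, k, rfl⟩
      exact ⟨_, rfl⟩
    · rintro ⟨a, rfl⟩
      obtain ⟨i, k, rfl⟩ := fano_cover a
      exact ⟨i, k, rfl⟩
  refine ⟨?_, ?_, ?_⟩
  · rw [hpts, Finset.card_image_of_injective _ hinj]; rfl
  · intro i
    have : fkPlane b g i = Finset.univ.image (fun k : Fin 3 => b (i + fkOffs k) + g) := by
      ext x
      rw [mem_fkPlane]
      simp [eq_comm]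
    rw [this, Finset.card_image_of_injective]
    · rfl
    · intro k l h
      exact fkOffs_inj i k l (hinj h)
  · intro x y hx hy hxy
    rw [hpts, Finset.mem_image] at hx hy
    obtain ⟨a, -, rfl⟩ := hx
    obtain ⟨c, -, rfl⟩ := hy
    have hac : a ≠ c := fun h => hxy (by rw [h])
    obtain ⟨i, hi, hu⟩ := fano_unique a c hac
    have key : ∀ j, (b a + g ∈ fkPlane b g j ∧ b c + g ∈ fkPlane b g j) ↔
        ((∃ k : Fin 3, a = j + fkOffs k) ∧ (∃ k : Fin 3, c = j + fkOffs k)) := by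
      intro j
      rw [mem_fkPlane, mem_fkPlane]
      simp only [add_left_inj, hb.eq_iff]
    refine ⟨i, (key i).2 hi, fun j hj => hu j ((key j).1 hj)⟩

lemma FKFam.regular {ι G : Type} [AddCommGroup G] [Fintype G] [DecidableEq G] [Fintype ι]
    {B : ι → Fin 7 → G} (hB : FKFam B) :
    ∃ K : Multiset (Fin 7 → Finset G), IsRegularFK G K := by
  refine ⟨(Finset.univ : Finset (ι × G)).val.map (fun t => fkPlane (B t.1) t.2), ⟨?_, ?_⟩, ?_⟩
  · intro L hL
    rw [Multiset.mem_map] at hL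
    obtain ⟨t, -, rfl⟩ := hL
    exact fkPlane_colored _ (hB.1 _) _
  · intro x y hxy j
    rw [Multiset.countP_map, ← Finset.filter_val, Finset.card_val, Finset.card_eq_one]
    obtain ⟨⟨i, k, l⟩, h1, h2⟩ := hB.2 j (x - y) (sub_ne_zero.2 hxy)
    simp only at h1
    refine ⟨(i, x - B i (j + fkOffs k)), ?_⟩
    ext ⟨i', g'⟩
    simp only [Finset.mem_filter, Finset.mem_univ, true_and, Finset.mem_singleton, mem_fkPlane]
    constructor
    · rintro ⟨⟨k', hk⟩, ⟨l', hl⟩⟩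
      have := h2 (i', k', l') (by simp only [hk, hl]; abel)
      simp only [Prod.mk.injEq] at this
      obtain ⟨rfl, rfl, rfl⟩ := this
      rw [Prod.mk.injEq]
      exact ⟨rfl, by rw [hk]; abel⟩
    · intro h
      rw [Prod.mk.injEq] at h
      obtain ⟨rfl, rfl⟩ := h
      refine ⟨⟨k, by abel⟩, ⟨l, ?_⟩⟩
      have : y = x - (x - y) := by abel
      rw [this, ← h1]; abel
  · intro g
    rw [Multiset.map_map]
    have he : (fun t : ι × G => fkPlane (B t.1) t.2) ∘
        ((Equiv.refl ι).prodCongr (Equiv.addRight g)) =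
        ((fun L : Fin 7 → Finset G => fun i => (L i).image (· + g)) ∘
          fun t : ι × G => fkPlane (B t.1) t.2) := by
      funext t i
      simp only [Function.comp, fkPlane, Finset.image_image]
      congr 1
      funext z
      simp [add_assoc]
    rw [← he, ← Multiset.map_map]
    congr 1
    exact Multiset.map_univ_val_equiv _

lemma FKGood.one : FKGood 1 := by
  refine ⟨Unit, inferInstance, inferInstance, inferInstance, Empty, inferInstance,
    fun e => e.elim, rfl, fun i => i.elim, fun j g hg => (hg rfl).elim⟩

lemma FKFam.prod {ι G : Type} [AddCommGroup G] {B : ι → Fin 7 → G} (hB : FKFam B)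
    {κ H : Type} [Field H] {B' : κ → Fin 7 → H} (hB' : FKFam B')
    (r : Fin 7 → H) (hr : Function.Injective r) :
    FKFam (ι := (ι × H) ⊕ κ) (G := G × H)
      (Sum.elim (fun t k => (B t.1 k, r k * t.2)) (fun i k => (0, B' i k))) := by
  refine ⟨?_, ?_⟩
  · rintro (⟨i, c⟩ | i) k l h
    · simp only [Sum.elim_inl, Prod.mk.injEq] at h
      exact hB.1 i h.1
    · simp only [Sum.elim_inr, Prod.mk.injEq] at h
      exact hB'.1 i h.2
  · rintro j ⟨g, h⟩ hgh
    by_cases hg : g = 0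
    · subst hg
      have hh : h ≠ 0 := fun h0 => hgh (by rw [h0]; rfl)
      obtain ⟨⟨i, k, l⟩, h1, h2⟩ := hB'.2 j h hh
      refine ⟨(Sum.inr i, k, l), ?_, ?_⟩
      · simpa using h1
      · rintro ⟨(⟨i', c⟩ | i'), k', l'⟩ ht
        · exfalso
          simp only [Sum.elim_inl, Prod.mk_sub_mk, Prod.mk.injEq] at ht
          have := hB.1 i' (sub_eq_zero.1 ht.1)
          rw [this] at ht
          exact hh (by rw [← ht.2, sub_self])
        · simp only [Sum.elim_inr, Prod.mk_sub_mk, Prod.mk.injEq] at ht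
          have := h2 (i', k', l') ht.2
          simp only [Prod.mk.injEq] at this
          obtain ⟨rfl, rfl, rfl⟩ := this
          rfl
    · obtain ⟨⟨i, k, l⟩, h1, h2⟩ := hB.2 j g hg
      simp only at h1
      have hkl : r (j + fkOffs k) - r (j + fkOffs l) ≠ 0 := by
        intro h0
        have := hr (sub_eq_zero.1 h0)
        rw [this, sub_self] at h1
        exact hg h1.symm
      refine ⟨(Sum.inl (i, h / (r (j + fkOffs k) - r (j + fkOffs l))), k, l), ?_, ?_⟩
      · simp only [Sum.elim_inl, Prod.mk_sub_mk, Prod.mk.injEq, h1, true_and]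
        rw [← sub_mul]
        field_simp
      · rintro ⟨(⟨i', c⟩ | i'), k', l'⟩ ht
        · simp only [Sum.elim_inl, Prod.mk_sub_mk, Prod.mk.injEq] at ht
          have := h2 (i', k', l') ht.1
          simp only [Prod.mk.injEq] at this
          obtain ⟨rfl, rfl, rfl⟩ := this
          have : c = h / (r (j + fkOffs k') - r (j + fkOffs l')) := by
            rw [eq_div_iff hkl, ← ht.2]; ring
          rw [this]
        · exfalso
          simp only [Sum.elim_inr, Prod.mk_sub_mk, Prod.mk.injEq, sub_self] at ht
          exact hg ht.1.symm

/-! ### Part II: rainbow Fano planes in a field -/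

/-- Three points whose differences lie in the three distinct cosets of the cubes. -/
def FKRain {K : Type} [Field K] [Fintype K] (x y z : K) : Prop :=
  (x ≠ y ∧ y ≠ z ∧ x ≠ z) ∧
    (x - y) ^ ((Fintype.card K - 1) / 3) ≠ (y - z) ^ ((Fintype.card K - 1) / 3) ∧
    (y - z) ^ ((Fintype.card K - 1) / 3) ≠ (x - z) ^ ((Fintype.card K - 1) / 3) ∧
    (x - y) ^ ((Fintype.card K - 1) / 3) ≠ (x - z) ^ ((Fintype.card K - 1) / 3)

/-- There is a field of order `q ≡ 1 (mod 6)` with a rainbow Fano plane. -/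
def FKField (q : ℕ) : Prop :=
  ∃ (K : Type) (_ : Field K) (_ : Fintype K) (_ : DecidableEq K), Fintype.card K = q ∧
    q % 6 = 1 ∧ ∃ b : Fin 7 → K, ∀ j, FKRain (b j) (b (j + 1)) (b (j + 3))

lemma cube_root_cases {K : Type} [Field K] {a b c g : K} (ha : a ^ 3 = 1) (hb : b ^ 3 = 1)
    (hc : c ^ 3 = 1) (hg : g ^ 3 = 1) (hab : a ≠ b) (hbc : b ≠ c) (hac : a ≠ c) :
    g = a ∨ g = b ∨ g = c := by
  have h1 : a ^ 2 + a * b + b ^ 2 = 0 := by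
    apply mul_left_cancel₀ (sub_ne_zero.2 hab)
    linear_combination ha - hb
  have h2 : a ^ 2 + a * c + c ^ 2 = 0 := by
    apply mul_left_cancel₀ (sub_ne_zero.2 hac)
    linear_combination ha - hc
  have h3 : a + b + c = 0 := by
    apply mul_left_cancel₀ (sub_ne_zero.2 hbc)
    linear_combination h1 - h2
  have h4 : (g - a) * ((g - b) * (g - c)) = 0 := by
    have hc' : c = -a - b := by linear_combination h3
    subst hc'
    linear_combination hg - ha + (a-g) * h1
  rcases mul_eq_zero.1 h4 with h | h
  · exact Or.inl (sub_eq_zero.1 h)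
  rcases mul_eq_zero.1 h with h | h
  · exact Or.inr (Or.inl (sub_eq_zero.1 h))
  · exact Or.inr (Or.inr (sub_eq_zero.1 h))

lemma rain_unique {K : Type} [Field K] (e : ℕ) (he : Even e) (x : Fin 3 → K)
    (h01 : (x 0 - x 1) ^ e ≠ (x 1 - x 2) ^ e) (h12 : (x 1 - x 2) ^ e ≠ (x 0 - x 2) ^ e)
    (h02 : (x 0 - x 1) ^ e ≠ (x 0 - x 2) ^ e) (k l k' l' : Fin 3) (hkl : k ≠ l) (hkl' : k' ≠ l')
    (h : (x k - x l) ^ e = (x k' - x l') ^ e) : (k = k' ∧ l = l') ∨ (k = l' ∧ l = k') := by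
  have e1 : (x 1 - x 0) ^ e = (x 0 - x 1) ^ e := by rw [← neg_sub, he.neg_pow]
  have e2 : (x 2 - x 1) ^ e = (x 1 - x 2) ^ e := by rw [← neg_sub, he.neg_pow]
  have e3 : (x 2 - x 0) ^ e = (x 0 - x 2) ^ e := by rw [← neg_sub, he.neg_pow]
  have h01' := h01.symm
  have h12' := h12.symm
  have h02' := h02.symm
  fin_cases k <;> fin_cases l <;> fin_cases k' <;> fin_cases l' <;>
    simp [e1, e2, e3] at h hkl hkl' ⊢ <;> contradiction

lemma fanoLine_pair : ∀ a b : Fin 7, a ≠ b → ∃ j : Fin 7, ∃ k l : Fin 3, k ≠ l ∧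
    a = j + fkOffs k ∧ b = j + fkOffs l := by decide

lemma rain_inj {K : Type} [Field K] [Fintype K] {b : Fin 7 → K}
    (hb : ∀ j, FKRain (b j) (b (j + 1)) (b (j + 3))) : Function.Injective b := by
  intro p q h
  by_contra hne
  obtain ⟨j, k, l, hkl, rfl, rfl⟩ := fanoLine_pair p q hne
  obtain ⟨⟨h1, h2, h3⟩, -⟩ := hb j
  have h1' := h1.symm
  have h2' := h2.symm
  have h3' := h3.symm
  fin_cases k <;> fin_cases l <;> simp [fkOffs] at h hkl <;> contradiction

lemma FKFam.of_rain {K : Type} [Field K] [Fintype K] [DecidableEq K]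
    (hq : Fintype.card K % 6 = 1) {b : Fin 7 → K}
    (hb : ∀ j, FKRain (b j) (b (j + 1)) (b (j + 3))) :
    ∃ T : Set K, FKFam (fun (s : T) k => (s : K) * b k) := by
  set e := (Fintype.card K - 1) / 3 with he
  have hcard : 0 < Fintype.card K := Fintype.card_pos
  have heven : Even e := by rw [Nat.even_iff]; omega
  have he3 : e * 3 = Fintype.card K - 1 := by omega
  have hκ3 : ∀ x : K, x ≠ 0 → (x ^ e) ^ 3 = 1 := by
    intro x hx
    rw [← pow_mul, he3]
    exact FiniteField.pow_card_sub_one_eq_one x hx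
  have h2 : (2 : K) ≠ 0 := by
    intro h2
    have h4 : ringChar K = 2 := by
      have : ringChar K ∣ 2 := by rw [← ringChar.spec]; exact_mod_cast h2
      rcases (Nat.dvd_prime Nat.prime_two).1 this with h | h
      · exact (CharP.ringChar_ne_one h).elim
      · exact h
    have := FiniteField.even_card_iff_char_two.1 h4
    omega
  have hneg : ∀ x : K, x ≠ 0 → x ≠ -x := by
    intro x hx h
    have : 2 * x = 0 := by linear_combination h
    rcases mul_eq_zero.1 this with h | h
    · exact h2 h
    · exact hx h
  let E := Fintype.equivFin K
  refine ⟨{u | u ^ e = 1 ∧ E u < E (-u)}, ?_, ?_⟩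
  · rintro ⟨s, hs, hs'⟩ k l h
    have hs0 : s ≠ 0 := by
      rintro rfl
      simp at hs'
    exact rain_inj hb (mul_left_cancel₀ hs0 h)
  · intro j g hg
    obtain ⟨⟨n1, n2, n3⟩, h01, h12, h02⟩ := hb j
    rw [← he] at h01 h12 h02
    have U := rain_unique e heven (fun k => b (j + fkOffs k))
      (by simpa [fkOffs] using h01) (by simpa [fkOffs] using h12) (by simpa [fkOffs] using h02)
    have hinj := rain_inj hb
    have hne : ∀ k l : Fin 3, k ≠ l → b (j + fkOffs k) - b (j + fkOffs l) ≠ 0 :=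
      fun k l hkl h0 => hkl (fkOffs_inj j k l (hinj (sub_eq_zero.1 h0)))
    have hex : ∃ k l : Fin 3, k ≠ l ∧ g ^ e = (b (j + fkOffs k) - b (j + fkOffs l)) ^ e := by
      rcases cube_root_cases (hκ3 _ (sub_ne_zero.2 n1)) (hκ3 _ (sub_ne_zero.2 n2))
        (hκ3 _ (sub_ne_zero.2 n3)) (hκ3 g hg) h01 h12 h02 with h | h | h
      · exact ⟨0, 1, by decide, by simpa [fkOffs] using h⟩
      · exact ⟨1, 2, by decide, by simpa [fkOffs] using h⟩
      · exact ⟨0, 2, by decide, by simpa [fkOffs] using h⟩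
    obtain ⟨k, l, hkl, hgk⟩ := hex
    have hex2 : ∃ k l : Fin 3, ∃ u : K, k ≠ l ∧ u ^ e = 1 ∧ E u < E (-u) ∧
        u * (b (j + fkOffs k) - b (j + fkOffs l)) = g := by
      have hd := hne k l hkl
      set d := b (j + fkOffs k) - b (j + fkOffs l) with hdd
      have hu : (g / d) ^ e = 1 := by
        rw [div_pow, hgk, div_self (pow_ne_zero _ hd)]
      have hu0 : g / d ≠ 0 := div_ne_zero hg hd
      rcases lt_or_gt_of_ne (E.injective.ne (hneg _ hu0)) with h | h
      · exact ⟨k, l, g / d, hkl, hu, h, by rw [← hdd]; field_simp⟩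
      · refine ⟨l, k, -(g / d), hkl.symm, by rw [heven.neg_pow, hu], by simpa using h, ?_⟩
        have : b (j + fkOffs l) - b (j + fkOffs k) = -d := by rw [hdd]; ring
        rw [this]; field_simp
    obtain ⟨k, l, u, hkl, hu, huE, hug⟩ := hex2
    refine ⟨(⟨u, hu, huE⟩, k, l), ?_, ?_⟩
    · simp only
      rw [← mul_sub, hug]
    · rintro ⟨⟨u', hu', huE'⟩, k', l'⟩ h'
      simp only at h'
      rw [← mul_sub] at h'
      have hkl' : k' ≠ l' := by
        rintro rfl
        rw [sub_self, mul_zero] at h'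
        exact hg h'.symm
      have hpow : (b (j + fkOffs k) - b (j + fkOffs l)) ^ e =
          (b (j + fkOffs k') - b (j + fkOffs l')) ^ e := by
        have h3 : g ^ e = (b (j + fkOffs k) - b (j + fkOffs l)) ^ e := by
          rw [← hug, mul_pow, hu, one_mul]
        have h4 : g ^ e = (b (j + fkOffs k') - b (j + fkOffs l')) ^ e := by
          rw [← h', mul_pow, hu', one_mul]
        rw [← h3, h4]
      rcases U k l k' l' hkl hkl' hpow with ⟨rfl, rfl⟩ | ⟨rfl, rfl⟩
      · have : u' = u := mul_right_cancel₀ (hne k l hkl) (h'.trans hug.symm)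
        subst this
        rfl
      · exfalso
        have : u' = -u := by
          apply mul_right_cancel₀ (hne k l hkl)
          linear_combination -h' + hug
        subst this
        rw [neg_neg] at huE'
        exact lt_asymm huE huE'

lemma FKGood.mul_field {v q : ℕ} (hv : FKGood v) (hq : FKField q) : FKGood (v * q) := by
  classical
  obtain ⟨G, _, _, _, ι, _, B, hG, hB⟩ := hv
  obtain ⟨K, _, _, _, hK, hq6, b, hb⟩ := hq
  obtain ⟨T, hT⟩ := FKFam.of_rain (by rw [hK]; exact hq6) hb
  refine ⟨G × K, inferInstance, inferInstance, inferInstance, (ι × K) ⊕ T, inferInstance, _, ?_,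
    hB.prod hT b (rain_inj hb)⟩
  rw [Fintype.card_prod, hG, hK]

/-! ### Part III: large fields -/

/-- The properties of a cubic character used below. -/
structure CubChar {K : Type} [Field K] [Fintype K] (c : K → ℂ) : Prop where
  zero : c 0 = 0
  mul : ∀ x y, c (x * y) = c x * c y
  cube : ∀ x, x ≠ 0 → c x ^ 3 = 1
  neg : ∀ x, c (-x) = c x
  sum : ∑ x, c x = 0
  sum_sq : ∑ x, c x ^ 2 = 0

section CubChar

variable {K : Type} [Field K] [Fintype K] {c : K → ℂ}

lemma CubChar.norm_one (h : CubChar c) {x : K} (hx : x ≠ 0) : ‖c x‖ = 1 :=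
  Complex.norm_eq_one_of_pow_eq_one (h.cube x hx) (by norm_num)

lemma CubChar.norm_le (h : CubChar c) (x : K) : ‖c x‖ ≤ 1 := by
  by_cases hx : x = 0
  · rw [hx, h.zero]; simp
  · rw [h.norm_one hx]

lemma CubChar.conj (h : CubChar c) (x : K) : (starRingEnd ℂ) (c x) = c x ^ 2 := by
  by_cases hx : x = 0
  · rw [hx, h.zero]; simp
  · have h1 := h.norm_one hx
    have h2 := h.cube x hx
    have h3 : c x * (starRingEnd ℂ) (c x) = 1 := by
      rw [Complex.mul_conj, Complex.normSq_eq_norm_sq, h1]; norm_num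
    have h4 : c x ≠ 0 := by
      intro h0; rw [h0] at h1; simp at h1
    apply mul_left_cancel₀ h4
    rw [h3, ← h2]; ring

lemma CubChar.one (h : CubChar c) : c 1 = 1 := by
  have h1 := h.mul 1 1
  have h2 := h.cube 1 one_ne_zero
  rw [mul_one] at h1
  have : c 1 ≠ 0 := by
    intro h0; rw [h0] at h2; norm_num at h2
  exact mul_left_cancel₀ this (by rw [← h1, mul_one])

lemma CubChar.sq (h : CubChar c) : CubChar (fun x => c x ^ 2) where
  zero := by rw [h.zero]; norm_num
  mul x y := by rw [h.mul]; ring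
  cube x hx := by rw [← pow_mul, mul_comm, pow_mul, h.cube x hx, one_pow]
  neg x := by rw [h.neg]
  sum := h.sum_sq
  sum_sq := by
    rw [← h.sum]
    refine Finset.sum_congr rfl fun x _ => ?_
    by_cases hx : x = 0
    · rw [hx, h.zero]; norm_num
    · linear_combination c x * h.cube x hx

lemma CubChar.corr_aux [DecidableEq K] (h : CubChar c) (t : K) (ht : t ≠ 0) :
    ∑ x, c x * c (x + t) ^ 2 = -1 := by
  have hS : ∀ t : K, t ≠ 0 → ∑ x, c x * c (x + t) ^ 2 = ∑ x, c x * c (x + 1) ^ 2 := by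
    intro t ht
    rw [← Equiv.sum_comp (Equiv.mulLeft₀ t ht) (fun x => c x * c (x + t) ^ 2)]
    refine Finset.sum_congr rfl fun x _ => ?_
    have : t * x + t = t * (x + 1) := by ring
    rw [show (Equiv.mulLeft₀ t ht) x = t * x from rfl, this, h.mul, h.mul]
    linear_combination c x * c (x + 1) ^ 2 * h.cube t ht
  have h0 : ∑ x, c x * c (x + 0) ^ 2 = (Fintype.card K : ℂ) - 1 := by
    have : ∀ x : K, c x * c (x + 0) ^ 2 = 1 - if x = 0 then 1 else 0 := by
      intro x
      by_cases hx : x = 0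
      · simp [hx, h.zero]
      · have := h.cube x hx
        simp only [add_zero, hx, if_false]
        rw [← this]; ring
    rw [Finset.sum_congr rfl fun x _ => this x, Finset.sum_sub_distrib]
    simp
  have htot : ∑ t, ∑ x, c x * c (x + t) ^ 2 = 0 := by
    rw [Finset.sum_comm]
    apply Finset.sum_eq_zero
    intro x _
    rw [← Finset.mul_sum]
    have := Equiv.sum_comp (Equiv.addLeft x) (fun t => c t ^ 2)
    simp only [Equiv.coe_addLeft] at this
    rw [this, h.sum_sq, mul_zero]
  rw [← Finset.add_sum_erase _ _ (Finset.mem_univ (0 : K)), h0,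
    Finset.sum_congr rfl (fun t ht => hS t (Finset.ne_of_mem_erase ht)), Finset.sum_const,
    Finset.card_erase_of_mem (Finset.mem_univ _), Finset.card_univ] at htot
  rw [hS t ht]
  have hq : 1 < Fintype.card K := Fintype.one_lt_card
  have hq' : ((Fintype.card K : ℂ) - 1) ≠ 0 := by
    rw [sub_ne_zero]; exact_mod_cast hq.ne'
  apply mul_left_cancel₀ hq'
  rw [nsmul_eq_mul, Nat.cast_sub hq.le] at htot
  push_cast at htot
  linear_combination htot

lemma CubChar.corr [DecidableEq K] (h : CubChar c) (y y' : K) :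
    ∑ x, c (x - y) * c (x - y') ^ 2 = (if y = y' then (Fintype.card K : ℂ) else 0) - 1 := by
  have e := Equiv.sum_comp (Equiv.addRight y) (fun x => c (x - y) * c (x - y') ^ 2)
  rw [← e]
  simp only [Equiv.coe_addRight, add_sub_cancel_right]
  by_cases hy : y = y'
  · subst hy
    have : ∀ x : K, c x * c (x + y - y) ^ 2 = 1 - if x = 0 then 1 else 0 := by
      intro x
      by_cases hx : x = 0
      · simp [hx, h.zero]
      · have := h.cube x hx
        simp only [add_sub_cancel_right, hx, if_false]
        rw [← this]; ring
    rw [Finset.sum_congr rfl fun x _ => this x, Finset.sum_sub_distrib]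
    simp
  · have := h.corr_aux (y - y') (sub_ne_zero.2 hy)
    simp only [hy, if_false, zero_sub]
    rw [← this]
    refine Finset.sum_congr rfl fun x _ => ?_
    rw [add_sub_assoc]

lemma CubChar.l2 [DecidableEq K] (h : CubChar c) (g : K → ℂ) :
    ∑ x, ‖∑ y, g y * c (x - y)‖ ^ 2 ≤ Fintype.card K * ∑ y, ‖g y‖ ^ 2 := by
  have key : ((∑ x, ‖∑ y, g y * c (x - y)‖ ^ 2 : ℝ) : ℂ) =
      ((Fintype.card K * ∑ y, ‖g y‖ ^ 2 - ‖∑ y, g y‖ ^ 2 : ℝ) : ℂ) := by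
    have hn : ∀ z : ℂ, ((‖z‖ : ℂ)) ^ 2 = z * (starRingEnd ℂ) z := by
      intro z; rw [Complex.mul_conj, Complex.normSq_eq_norm_sq]; push_cast; rfl
    push_cast
    simp only [hn, map_sum, map_mul, h.conj, Finset.sum_mul_sum]
    rw [Finset.sum_comm]
    have : ∀ y : K, ∑ x, ∑ y', g y * c (x - y) * ((starRingEnd ℂ) (g y') * c (x - y') ^ 2) =
        Fintype.card K * (g y * (starRingEnd ℂ) (g y)) -
          ∑ y', g y * (starRingEnd ℂ) (g y') := by
      intro y
      rw [Finset.sum_comm]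
      have h2 : ∀ y' : K,
          ∑ x, g y * c (x - y) * ((starRingEnd ℂ) (g y') * c (x - y') ^ 2) =
          (if y = y' then (Fintype.card K : ℂ) * (g y * (starRingEnd ℂ) (g y')) else 0) -
            g y * (starRingEnd ℂ) (g y') := by
        intro y'
        have h3 : ∀ x, g y * c (x - y) * ((starRingEnd ℂ) (g y') * c (x - y') ^ 2) =
            g y * (starRingEnd ℂ) (g y') * (c (x - y) * c (x - y') ^ 2) := fun x => by ring
        rw [Finset.sum_congr rfl fun x _ => h3 x, ← Finset.mul_sum, h.corr]
        split_ifs <;> ring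
      rw [Finset.sum_congr rfl fun y' _ => h2 y', Finset.sum_sub_distrib]
      simp
    rw [Finset.sum_congr rfl fun y _ => this y, Finset.sum_sub_distrib, ← Finset.mul_sum]
  have key' := Complex.ofReal_injective key
  rw [key']
  have := sq_nonneg ‖∑ y, g y‖
  linarith

lemma CubChar.bil [DecidableEq K] (h : CubChar c) (f g : K → ℂ) :
    ‖∑ x, ∑ y, f x * g y * c (x - y)‖ ≤
      √(Fintype.card K) * (√(∑ x, ‖f x‖ ^ 2) * √(∑ y, ‖g y‖ ^ 2)) := by
  calc ‖∑ x, ∑ y, f x * g y * c (x - y)‖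
      ≤ ∑ x, ‖f x‖ * ‖∑ y, g y * c (x - y)‖ := by
        refine (norm_sum_le _ _).trans (Finset.sum_le_sum fun x _ => ?_)
        rw [← norm_mul, Finset.mul_sum]
        simp only [mul_assoc]
        exact le_rfl
    _ ≤ √(∑ x, ‖f x‖ ^ 2) * √(∑ x, ‖∑ y, g y * c (x - y)‖ ^ 2) :=
        Real.sum_mul_le_sqrt_mul_sqrt _ _ _
    _ ≤ √(∑ x, ‖f x‖ ^ 2) * √(Fintype.card K * ∑ y, ‖g y‖ ^ 2) := by
        gcongr
        exact h.l2 g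
    _ = _ := by
        rw [Real.sqrt_mul (by positivity)]; ring

lemma CubChar.path [DecidableEq K] {c' : K → ℂ} (h : CubChar c) (h' : CubChar c') (k : ℕ)
    (A B D : Finset K) (hA : A.card = k) (hD : D.card = k) :
    ‖∑ b ∈ B, (∑ a ∈ A, c (b - a)) * ∑ d ∈ D, c' (b - d)‖ ≤ Fintype.card K * k := by
  have hl : ∀ (A : Finset K) (c : K → ℂ), CubChar c → A.card = k →
      ∑ b, ‖∑ a ∈ A, c (b - a)‖ ^ 2 ≤ Fintype.card K * k := by
    intro A c h hA
    have := h.l2 (fun y => if y ∈ A then 1 else 0)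
    simp only [ite_mul, one_mul, zero_mul, Finset.sum_ite_mem, Finset.univ_inter] at this
    refine this.trans (le_of_eq ?_)
    congr 1
    have h2 : ∀ y : K, ‖(if y ∈ A then (1 : ℂ) else 0)‖ ^ 2 = if y ∈ A then (1 : ℝ) else 0 := by
      intro y; split_ifs <;> simp
    rw [Finset.sum_congr rfl fun y _ => h2 y]
    simp [hA]
  calc ‖∑ b ∈ B, (∑ a ∈ A, c (b - a)) * ∑ d ∈ D, c' (b - d)‖
      ≤ ∑ b ∈ B, ‖∑ a ∈ A, c (b - a)‖ * ‖∑ d ∈ D, c' (b - d)‖ := by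
        refine (norm_sum_le _ _).trans (Finset.sum_le_sum fun x _ => ?_)
        rw [norm_mul]
    _ ≤ ∑ b, ‖∑ a ∈ A, c (b - a)‖ * ‖∑ d ∈ D, c' (b - d)‖ :=
        Finset.sum_le_sum_of_subset_of_nonneg (Finset.subset_univ _) fun _ _ _ => by positivity
    _ ≤ √(∑ b, ‖∑ a ∈ A, c (b - a)‖ ^ 2) * √(∑ b, ‖∑ d ∈ D, c' (b - d)‖ ^ 2) :=
        Real.sum_mul_le_sqrt_mul_sqrt _ _ _
    _ ≤ √(Fintype.card K * k) * √(Fintype.card K * k) := by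
        gcongr
        · exact hl A c h hA
        · exact hl D c' h' hD
    _ = _ := Real.mul_self_sqrt (by positivity)

lemma CubChar.tri [DecidableEq K] (h : CubChar c) (k : ℕ)
    (W X Y : Finset K) (hW : W.card = k) (hX : X.card = k) (hY : Y.card = k) :
    ‖∑ w ∈ W, ∑ u ∈ X, ∑ v ∈ Y, c (w - u) * c (u - v) * c (w - v)‖ ≤
      √(Fintype.card K) * k ^ 2 := by
  have hin : ∀ w ∈ W, ‖∑ u ∈ X, ∑ v ∈ Y, c (w - u) * c (u - v) * c (w - v)‖ ≤
      √(Fintype.card K) * k := by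
    intro w _
    have hb := h.bil (fun u => if u ∈ X then c (w - u) else 0)
      (fun v => if v ∈ Y then c (w - v) else 0)
    have e1 : ∑ u, ∑ v, (if u ∈ X then c (w - u) else 0) * (if v ∈ Y then c (w - v) else 0) *
        c (u - v) = ∑ u ∈ X, ∑ v ∈ Y, c (w - u) * c (u - v) * c (w - v) := by
      rw [← Finset.sum_subset (Finset.subset_univ X)]
      · refine Finset.sum_congr rfl fun u hu => ?_
        rw [← Finset.sum_subset (Finset.subset_univ Y)]
        · refine Finset.sum_congr rfl fun v hv => ?_
          rw [if_pos hu, if_pos hv]; ring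
        · intro v _ hv
          rw [if_neg hv]; ring
      · intro u _ hu
        apply Finset.sum_eq_zero
        intro v _
        rw [if_neg hu]; ring
    have e2 : ∀ (X : Finset K), X.card = k →
        ∑ u, ‖(if u ∈ X then c (w - u) else 0)‖ ^ 2 ≤ (k : ℝ) := by
      intro X hX
      have : ∀ u : K, ‖(if u ∈ X then c (w - u) else 0)‖ ^ 2 ≤ if u ∈ X then (1 : ℝ) else 0 := by
        intro u
        split_ifs
        · have := h.norm_le (w - u)
          exact pow_le_one₀ (norm_nonneg _) this
        · simp
      refine (Finset.sum_le_sum fun u _ => this u).trans ?_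
      simp [hX]
    rw [e1] at hb
    refine hb.trans ?_
    have : √(k : ℝ) * √k = k := Real.mul_self_sqrt (by positivity)
    rw [← this]
    gcongr
    · exact e2 X hX
    · exact e2 Y hY
  refine (norm_sum_le _ _).trans ((Finset.sum_le_sum hin).trans (le_of_eq ?_))
  rw [Finset.sum_const, hW, nsmul_eq_mul]; ring

end CubChar

/-- Rainbow triples with respect to a cubic character. -/
def CRain {K : Type} [Field K] (c : K → ℂ) (x y z : K) : Prop :=
  (x ≠ y ∧ y ≠ z ∧ x ≠ z) ∧ c (x - y) ≠ c (y - z) ∧ c (y - z) ≠ c (x - z) ∧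
    c (x - y) ≠ c (x - z)

open Classical in
/-- Indicator function of rainbow triples. -/
noncomputable def rInd {K : Type} [Field K] (c : K → ℂ) (x y z : K) : ℝ :=
  if CRain c x y z then 1 else 0

section Rainbow

variable {K : Type} [Field K] [Fintype K] {c : K → ℂ}

lemma CubChar.sub_comm (h : CubChar c) (x y : K) : c (x - y) = c (y - x) := by
  rw [← neg_sub, h.neg]

/-- The Fourier expansion of the rainbow indicator. -/
noncomputable def rPoly (a b d : ℂ) : ℂ :=
  2 + 2 * (a * b * d) + 2 * (a ^ 2 * b ^ 2 * d ^ 2) -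
    (a * b ^ 2 + a ^ 2 * b + a * d ^ 2 + a ^ 2 * d + b * d ^ 2 + b ^ 2 * d)

lemma rPoly_eq {a b d : ℂ} (ha : a ^ 3 = 1) (hb : b ^ 3 = 1) (hd : d ^ 3 = 1) :
    (a ≠ b ∧ b ≠ d ∧ a ≠ d → rPoly a b d = 9) ∧
    (¬ (a ≠ b ∧ b ≠ d ∧ a ≠ d) → rPoly a b d = 0) := by
  constructor
  · rintro ⟨hab, hbd, had⟩
    have h1 : a ^ 2 + a * b + b ^ 2 = 0 := by
      apply mul_left_cancel₀ (sub_ne_zero.2 hab)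
      linear_combination ha - hb
    have h2 : a ^ 2 + a * d + d ^ 2 = 0 := by
      apply mul_left_cancel₀ (sub_ne_zero.2 had)
      linear_combination ha - hd
    have h3 : a + b + d = 0 := by
      apply mul_left_cancel₀ (sub_ne_zero.2 hbd)
      linear_combination h1 - h2
    have h4 : a * b * d = 1 := by
      have hd' : d = -a - b := by linear_combination h3
      subst hd'
      linear_combination ha - a * h1
    have h5 : a * b + b * d + a * d = 0 := by
      linear_combination (a + b) * h3 - h1
    unfold rPoly
    linear_combination (2 + 2 * a * b * d + 2 + 3) * h4 - (a + b + d) * h5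
  · intro hn
    have h3 : a = b ∨ b = d ∨ a = d := by tauto
    unfold rPoly
    rcases h3 with rfl | rfl | rfl
    · linear_combination (-2 + 2 * a * d ^ 2) * ha
    · linear_combination (-2 + 2 * b * a ^ 2) * hb
    · linear_combination (-2 + 2 * a * b ^ 2) * ha

lemma rInd_poly [DecidableEq K] (h : CubChar c) (x y z : K) :
    rPoly (c (x - y)) (c (y - z)) (c (x - z)) =
      9 * (rInd c x y z : ℂ) + if x = y ∧ y = z then 2 else 0 := by
  by_cases hxy : x = y
  · subst hxy
    have h0 : rInd c x x z = 0 := by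
      unfold rInd; rw [if_neg]; rintro ⟨⟨h, -⟩, -⟩; exact h rfl
    rw [h0, sub_self, h.zero]
    by_cases hxz : x = z
    · subst hxz
      simp [h.zero, rPoly]
    · have := h.cube _ (sub_ne_zero.2 hxz)
      simp only [hxz, and_false, if_false, rPoly]
      push_cast
      linear_combination -2 * this
  by_cases hyz : y = z
  · subst hyz
    have h0 : rInd c x y y = 0 := by
      unfold rInd; rw [if_neg]; rintro ⟨⟨-, h, -⟩, -⟩; exact h rfl
    rw [h0, sub_self, h.zero]
    have := h.cube _ (sub_ne_zero.2 hxy)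
    simp only [hxy, false_and, if_false, rPoly]
    push_cast
    linear_combination -2 * this
  by_cases hxz : x = z
  · subst hxz
    have h0 : rInd c x y x = 0 := by
      unfold rInd; rw [if_neg]; rintro ⟨⟨-, -, h⟩, -⟩; exact h rfl
    rw [h0, sub_self, h.zero, h.sub_comm y x]
    have := h.cube _ (sub_ne_zero.2 hxy)
    simp only [hxy, false_and, if_false, rPoly]
    push_cast
    linear_combination -2 * this
  have hp := rPoly_eq (h.cube _ (sub_ne_zero.2 hxy)) (h.cube _ (sub_ne_zero.2 hyz))
    (h.cube _ (sub_ne_zero.2 hxz))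
  rw [if_neg (fun hh => hxy hh.1)]
  unfold rInd
  split_ifs with hr
  · rw [hp.1 ⟨hr.2.1, hr.2.2.1, hr.2.2.2⟩]; push_cast; ring
  · rw [hp.2 (fun hh => hr ⟨⟨hxy, hyz, hxz⟩, hh⟩)]; push_cast; ring

/-- Three sets of size `k` without a rainbow transversal must be small. -/
lemma CubChar.no_rain [DecidableEq K] (h : CubChar c) (k : ℕ)
    (W X Y : Finset K) (hW : W.card = k) (hX : X.card = k) (hY : Y.card = k)
    (hno : ∀ w ∈ W, ∀ u ∈ X, ∀ v ∈ Y, ¬ CRain c w u v) :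
    2 * (k : ℝ) ^ 3 ≤ 4 * (√(Fintype.card K) * k ^ 2) + 6 * (Fintype.card K * k) + 2 * k := by
  have h2 := h.sq
  have t1 := h.tri k W X Y hW hX hY
  have t2 := h2.tri k W X Y hW hX hY
  have p1 := h.path h2 k W X Y hW hY
  have p2 := h2.path h k W X Y hW hY
  have p3 := h.path h2 k X W Y hX hY
  have p4 := h2.path h k X W Y hX hY
  have p5 := h.path h2 k X Y W hX hW
  have p6 := h2.path h k X Y W hX hW
  have d1 : ‖∑ w ∈ W, ∑ u ∈ X, ∑ v ∈ Y, (if w = u ∧ u = v then (2 : ℂ) else 0)‖ ≤ 2 * k := by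
    have : ∀ w ∈ W, ‖∑ u ∈ X, ∑ v ∈ Y, (if w = u ∧ u = v then (2 : ℂ) else 0)‖ ≤ 2 := by
      intro w _
      have : ∀ u ∈ X, ∑ v ∈ Y, (if w = u ∧ u = v then (2 : ℂ) else 0) =
          if w = u then (if u ∈ Y then 2 else 0) else 0 := by
        intro u _
        by_cases hwu : w = u <;> simp [hwu]
      rw [Finset.sum_congr rfl this, Finset.sum_ite_eq]
      split_ifs <;> simp
    refine (norm_sum_le _ _).trans ((Finset.sum_le_sum this).trans (le_of_eq ?_))
    rw [Finset.sum_const, hW, nsmul_eq_mul]; ring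
  set D := ∑ w ∈ W, ∑ u ∈ X, ∑ v ∈ Y, (if w = u ∧ u = v then (2 : ℂ) else 0) with hD
  have hsum : ∑ w ∈ W, ∑ u ∈ X, ∑ v ∈ Y, rPoly (c (w - u)) (c (u - v)) (c (w - v)) = D := by
    refine Finset.sum_congr rfl fun w hw => Finset.sum_congr rfl fun u hu =>
      Finset.sum_congr rfl fun v hv => ?_
    rw [rInd_poly h]
    have : rInd c w u v = 0 := by unfold rInd; rw [if_neg (hno w hw u hu v hv)]
    rw [this]; simp
  set T1 := ∑ w ∈ W, ∑ u ∈ X, ∑ v ∈ Y, c (w - u) * c (u - v) * c (w - v) with hT1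
  set T2 := ∑ w ∈ W, ∑ u ∈ X, ∑ v ∈ Y, c (w - u) ^ 2 * c (u - v) ^ 2 * c (w - v) ^ 2 with hT2
  -- path sums as triple sums
  have q1 : ∀ f g : K → ℂ, (∀ x y, f (x - y) = f (y - x)) →
      ∑ w ∈ W, ∑ u ∈ X, ∑ v ∈ Y, f (w - u) * g (u - v) =
      ∑ b ∈ X, (∑ a ∈ W, f (b - a)) * ∑ d ∈ Y, g (b - d) := by
    intro f g hf
    rw [Finset.sum_comm]
    refine Finset.sum_congr rfl fun u _ => ?_
    rw [Finset.sum_mul_sum]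
    refine Finset.sum_congr rfl fun w _ => Finset.sum_congr rfl fun v _ => ?_
    rw [hf]
  have q2 : ∀ f g : K → ℂ,
      ∑ w ∈ W, ∑ u ∈ X, ∑ v ∈ Y, f (w - u) * g (w - v) =
      ∑ b ∈ W, (∑ a ∈ X, f (b - a)) * ∑ d ∈ Y, g (b - d) := by
    intro f g
    refine Finset.sum_congr rfl fun u _ => ?_
    rw [Finset.sum_mul_sum]
  have q3 : ∀ f g : K → ℂ, (∀ x y, f (x - y) = f (y - x)) → (∀ x y, g (x - y) = g (y - x)) →
      ∑ w ∈ W, ∑ u ∈ X, ∑ v ∈ Y, f (u - v) * g (w - v) =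
      ∑ b ∈ Y, (∑ a ∈ X, f (b - a)) * ∑ d ∈ W, g (b - d) := by
    intro f g hf hg
    have : ∀ b ∈ Y, (∑ a ∈ X, f (b - a)) * ∑ d ∈ W, g (b - d) =
        ∑ w ∈ W, ∑ u ∈ X, f (u - b) * g (w - b) := by
      intro b _
      rw [Finset.sum_mul_sum, Finset.sum_comm]
      refine Finset.sum_congr rfl fun w _ => Finset.sum_congr rfl fun v _ => ?_
      rw [hf, hg]
    rw [Finset.sum_congr rfl this]
    symm
    rw [Finset.sum_comm]
    refine Finset.sum_congr rfl fun w _ => ?_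
    rw [Finset.sum_comm]
  have s1 := h.sub_comm
  have s2 := h2.sub_comm
  rw [← q1 c (fun x => c x ^ 2) s1] at p1
  rw [← q1 (fun x => c x ^ 2) c s2] at p2
  rw [← q2 c (fun x => c x ^ 2)] at p3
  rw [← q2 (fun x => c x ^ 2) c] at p4
  rw [← q3 c (fun x => c x ^ 2) s1 s2] at p5
  rw [← q3 (fun x => c x ^ 2) c s2 s1] at p6
  have hexp : 2 * (k : ℂ) ^ 3 = D - 2 * T1 - 2 * T2 +
      (∑ w ∈ W, ∑ u ∈ X, ∑ v ∈ Y, c (w - u) * c (u - v) ^ 2) +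
      (∑ w ∈ W, ∑ u ∈ X, ∑ v ∈ Y, c (w - u) ^ 2 * c (u - v)) +
      (∑ w ∈ W, ∑ u ∈ X, ∑ v ∈ Y, c (w - u) * c (w - v) ^ 2) +
      (∑ w ∈ W, ∑ u ∈ X, ∑ v ∈ Y, c (w - u) ^ 2 * c (w - v)) +
      (∑ w ∈ W, ∑ u ∈ X, ∑ v ∈ Y, c (u - v) * c (w - v) ^ 2) +
      (∑ w ∈ W, ∑ u ∈ X, ∑ v ∈ Y, c (u - v) ^ 2 * c (w - v)) := by
    rw [← hsum, hT1, hT2]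
    simp only [rPoly, Finset.sum_sub_distrib, Finset.sum_add_distrib, Finset.sum_const,
      ← Finset.mul_sum, hW, hX, hY, nsmul_eq_mul]
    ring
  have hn : 2 * (k : ℝ) ^ 3 = ‖2 * (k : ℂ) ^ 3‖ := by
    simp
  rw [hn, hexp]
  have tb : ∀ a b : ℂ, ‖a - 2 * b‖ ≤ ‖a‖ + 2 * ‖b‖ := by
    intro a b
    refine (norm_sub_le _ _).trans ?_
    simp
  have b1 := tb (D - 2 * T1) T2
  have b2 := tb D T1
  refine (norm_add_le _ _).trans ?_
  refine (add_le_add_left (norm_add_le _ _) _).trans ?_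
  refine (add_le_add_left (add_le_add_left (norm_add_le _ _) _) _).trans ?_
  refine (add_le_add_left (add_le_add_left (add_le_add_left (norm_add_le _ _) _) _) _).trans ?_
  refine (add_le_add_left (add_le_add_left (add_le_add_left (add_le_add_left
    (norm_add_le _ _) _) _) _) _).trans ?_
  refine (add_le_add_left (add_le_add_left (add_le_add_left (add_le_add_left (add_le_add_left
    (norm_add_le _ _) _) _) _) _) _).trans ?_
  linarith

lemma CubChar.jac [DecidableEq K] (h : CubChar c) :
    ‖∑ x, c x * c (x - 1)‖ ≤ √(Fintype.card K) := by
  have hb := h.bil c c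
  have hn : ∑ x, ‖c x‖ ^ 2 = (Fintype.card K : ℝ) - 1 := by
    have : ∀ x : K, ‖c x‖ ^ 2 = 1 - if x = 0 then (1 : ℝ) else 0 := by
      intro x
      by_cases hx : x = 0
      · simp [hx, h.zero]
      · simp [hx, h.norm_one hx]
    rw [Finset.sum_congr rfl fun x _ => this x, Finset.sum_sub_distrib]
    simp
  have hq : 1 < Fintype.card K := Fintype.one_lt_card
  have hq1 : (0 : ℝ) < (Fintype.card K : ℝ) - 1 := by
    have : (1 : ℝ) < Fintype.card K := by exact_mod_cast hq
    linarith
  have he : ∑ x, ∑ y, c x * c y * c (x - y) =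
      ((Fintype.card K : ℝ) - 1 : ℝ) * ∑ x, c x * c (x - 1) := by
    rw [Finset.sum_comm, ← Finset.add_sum_erase _ _ (Finset.mem_univ (0 : K))]
    have h0 : ∑ x, c x * c 0 * c (x - 0) = 0 := by
      apply Finset.sum_eq_zero; intro x _; rw [h.zero]; ring
    have h1 : ∀ y ∈ Finset.univ.erase (0 : K), ∑ x, c x * c y * c (x - y) =
        ∑ x, c x * c (x - 1) := by
      intro y hy
      have hy0 := Finset.ne_of_mem_erase hy
      rw [← Equiv.sum_comp (Equiv.mulLeft₀ y hy0) (fun x => c x * c y * c (x - y))]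
      refine Finset.sum_congr rfl fun x _ => ?_
      have : y * x - y = y * (x - 1) := by ring
      rw [show (Equiv.mulLeft₀ y hy0) x = y * x from rfl, this, h.mul, h.mul]
      linear_combination c x * c (x - 1) * h.cube y hy0
    rw [h0, Finset.sum_congr rfl h1, Finset.sum_const,
      Finset.card_erase_of_mem (Finset.mem_univ _), Finset.card_univ, nsmul_eq_mul,
      Nat.cast_sub hq.le]
    push_cast; ring
  rw [he, hn, Real.mul_self_sqrt hq1.le, norm_mul, Complex.norm_of_nonneg hq1.le] at hb
  refine le_of_mul_le_mul_left ?_ hq1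
  linarith

/-- The number of points completing a given edge to a rainbow triangle. -/
noncomputable def rDeg {K : Type} [Field K] [Fintype K] (c : K → ℂ) : ℝ := ∑ x, rInd c x 0 1

lemma CubChar.deg [DecidableEq K] (h : CubChar c) :
    |9 * rDeg c - (2 * Fintype.card K + 2)| ≤ 4 * √(Fintype.card K) := by
  have j1 := h.jac
  have j2 := h.sq.jac
  have hs := Finset.sum_congr (rfl : (Finset.univ : Finset K) = Finset.univ)
    (fun x _ => rInd_poly h x 0 1)
  have hc1 : c (0 - 1) = 1 := by rw [h.sub_comm, sub_zero, h.one]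
  have hm1 : ∑ x, c (x - 1) = 0 := by
    have := Equiv.sum_comp (Equiv.subRight (1 : K)) c
    rw [← h.sum, ← this]; rfl
  have hm2 : ∑ x, c (x - 1) ^ 2 = 0 := by
    have := Equiv.sum_comp (Equiv.subRight (1 : K)) (fun x => c x ^ 2)
    rw [← h.sum_sq, ← this]; rfl
  have k1 : ∑ x, c x * c (x - 1) ^ 2 = -1 := by
    have := h.corr 0 1
    simpa using this
  have k2 : ∑ x, c x ^ 2 * c (x - 1) = -1 := by
    have := h.corr 1 0
    simp only [sub_zero, one_ne_zero, if_false, zero_sub] at this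
    rw [← this]
    exact Finset.sum_congr rfl fun x _ => mul_comm _ _
  have hz : ∀ x : K, (if x = 0 ∧ (0 : K) = 1 then (2 : ℂ) else 0) = 0 := by
    intro x; simp
  simp only [hc1, sub_zero, hz, add_zero, rPoly, one_pow, mul_one, one_mul,
    Finset.sum_sub_distrib, Finset.sum_add_distrib, ← Finset.mul_sum, h.sum, h.sum_sq, hm1, hm2,
    k1, k2, Finset.sum_const, Finset.card_univ, nsmul_eq_mul] at hs
  have he : ((9 * rDeg c - (2 * Fintype.card K + 2) : ℝ) : ℂ) =
      2 * (∑ x, c x * c (x - 1)) + 2 * ∑ x, c x ^ 2 * c (x - 1) ^ 2 := by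
    unfold rDeg
    push_cast
    linear_combination -hs
  rw [← Real.norm_eq_abs, ← Complex.norm_real, he]
  refine (norm_add_le _ _).trans ?_
  rw [norm_mul, norm_mul]
  simp only [Complex.norm_ofNat]
  linarith

end Rainbow

section Moments

variable {K : Type} [Field K] [Fintype K] {c : K → ℂ}

lemma CRain.rot (h : CubChar c) {x y z : K} (hr : CRain c x y z) : CRain c y z x := by
  obtain ⟨⟨h1, h2, h3⟩, h4, h5, h6⟩ := hr
  refine ⟨⟨h2, h3.symm, h1.symm⟩, ?_, ?_, ?_⟩
  · rwa [h.sub_comm z x]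
  · rw [h.sub_comm z x, h.sub_comm y x]; exact h6.symm
  · rw [h.sub_comm y x]; exact h4.symm

lemma CRain.affine (h : CubChar c) {s : K} (hs : s ≠ 0) (t : K) {x y z : K} :
    CRain c (s * x + t) (s * y + t) (s * z + t) ↔ CRain c x y z := by
  have hd : ∀ a b : K, s * a + t - (s * b + t) = s * (a - b) := fun a b => by ring
  have hcs : c s ≠ 0 := by
    intro h0
    have := h.cube s hs
    rw [h0] at this; norm_num at this
  have hi : ∀ a b : K, s * a + t = s * b + t ↔ a = b := by
    intro a b
    rw [add_left_inj, mul_right_inj' hs]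
  unfold CRain
  simp only [hd, h.mul, ne_eq, mul_right_inj' hcs, hi]

lemma rInd_affine (h : CubChar c) {s : K} (hs : s ≠ 0) (t x y z : K) :
    rInd c (s * x + t) (s * y + t) (s * z + t) = rInd c x y z := by
  unfold rInd
  have := CRain.affine h hs t (x := x) (y := y) (z := z)
  split_ifs <;> tauto

lemma rInd_rot (h : CubChar c) (x y z : K) : rInd c x y z = rInd c y z x := by
  unfold rInd
  have : CRain c x y z ↔ CRain c y z x := ⟨fun a => a.rot h, fun a => (a.rot h).rot h⟩
  split_ifs <;> tauto

lemma rInd_self_right (x y : K) : rInd c x y y = 0 := by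
  unfold rInd; rw [if_neg]; rintro ⟨⟨-, h, -⟩, -⟩; exact h rfl

lemma rInd_sq (x y z : K) : rInd c x y z * rInd c x y z = rInd c x y z := by
  unfold rInd; split_ifs <;> simp

/-- The affine permutation `x ↦ s x + t`. -/
def affPerm {K : Type} [Field K] (s : K) (hs : s ≠ 0) (t : K) : K ≃ K :=
  (Equiv.mulLeft₀ s hs).trans (Equiv.addRight t)

lemma affPerm_apply (s : K) (hs : s ≠ 0) (t x : K) : affPerm s hs t x = s * x + t := rfl

lemma rDeg_eq [DecidableEq K] (h : CubChar c) (a b : K) :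
    ∑ x, rInd c x a b = if a = b then 0 else rDeg c := by
  split_ifs with hab
  · subst hab
    exact Finset.sum_eq_zero fun x _ => rInd_self_right x a
  · have hs : b - a ≠ 0 := sub_ne_zero.2 (Ne.symm hab)
    rw [← Equiv.sum_comp (affPerm (b - a) hs a)]
    unfold rDeg
    refine Finset.sum_congr rfl fun x _ => ?_
    rw [affPerm_apply, ← rInd_affine h hs a x 0 1]
    congr 1 <;> ring

/-- Number of edges forming rainbow triangles with both `w` and `w'`. -/
noncomputable def rPair {K : Type} [Field K] [Fintype K] (c : K → ℂ) (w w' : K) : ℝ :=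
  ∑ a, ∑ b, rInd c w a b * rInd c w' a b

lemma rTot [DecidableEq K] (h : CubChar c) (w : K) :
    ∑ a, ∑ b, rInd c w a b = ((Fintype.card K : ℝ) - 1) * rDeg c := by
  have h1 : ∀ a : K, ∑ b, rInd c w a b = if w = a then 0 else rDeg c := by
    intro a
    rw [← rDeg_eq h w a]
    refine Finset.sum_congr rfl fun b _ => ?_
    rw [rInd_rot h b w a]
  rw [Finset.sum_congr rfl fun a _ => h1 a]
  have h2 : ∀ a : K, (if w = a then 0 else rDeg c) = rDeg c - if w = a then rDeg c else 0 := by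
    intro a; split_ifs <;> ring
  rw [Finset.sum_congr rfl fun a _ => h2 a, Finset.sum_sub_distrib]
  simp; ring

lemma rPair_self [DecidableEq K] (h : CubChar c) (w : K) :
    rPair c w w = ((Fintype.card K : ℝ) - 1) * rDeg c := by
  rw [← rTot h w]
  unfold rPair
  simp only [rInd_sq]

lemma rPair_affine (h : CubChar c) {s : K} (hs : s ≠ 0) (t w w' : K) :
    rPair c (s * w + t) (s * w' + t) = rPair c w w' := by
  unfold rPair
  rw [← Equiv.sum_comp (affPerm s hs t)]
  refine Finset.sum_congr rfl fun a _ => ?_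
  rw [← Equiv.sum_comp (affPerm s hs t)]
  refine Finset.sum_congr rfl fun b _ => ?_
  simp only [affPerm_apply, rInd_affine h hs t]

lemma rPair_ne [DecidableEq K] (h : CubChar c) {w w' : K} (hw : w ≠ w') :
    rPair c w w' = rDeg c * (rDeg c - 1) := by
  have hc : ∀ w w' : K, w ≠ w' → rPair c w w' = rPair c 0 1 := by
    intro w w' hw
    rw [← rPair_affine h (sub_ne_zero.2 hw.symm) w 0 1]
    congr 1 <;> ring
  have hq : 1 < Fintype.card K := Fintype.one_lt_card
  have hq1 : (0 : ℝ) < (Fintype.card K : ℝ) - 1 := by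
    have : (1 : ℝ) < Fintype.card K := by exact_mod_cast hq
    linarith
  have hsum : ∑ w', rPair c 0 w' = ((Fintype.card K : ℝ) - 1) * rDeg c * rDeg c := by
    unfold rPair
    rw [Finset.sum_comm]
    rw [← rTot h 0, Finset.sum_mul]
    refine Finset.sum_congr rfl fun a _ => ?_
    rw [Finset.sum_comm, Finset.sum_mul]
    refine Finset.sum_congr rfl fun b _ => ?_
    rw [← Finset.mul_sum, rDeg_eq h]
    split_ifs with hab
    · subst hab; rw [rInd_self_right]; ring
    · rfl
  rw [← Finset.add_sum_erase _ _ (Finset.mem_univ (0 : K)), rPair_self h,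
    Finset.sum_congr rfl (fun t ht => hc 0 t (Finset.ne_of_mem_erase ht).symm), Finset.sum_const,
    Finset.card_erase_of_mem (Finset.mem_univ _), Finset.card_univ, nsmul_eq_mul,
    Nat.cast_sub hq.le] at hsum
  rw [hc w w' hw]
  apply mul_left_cancel₀ hq1.ne'
  push_cast at hsum
  linear_combination hsum

/-- Number of common rainbow completions of the edges `ab` and `de`. -/
noncomputable def rCap {K : Type} [Field K] [Fintype K] (c : K → ℂ) (a b d e : K) : ℝ :=
  ∑ w, rInd c w a b * rInd c w d e

lemma rCap_sum [DecidableEq K] (h : CubChar c) :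
    ∑ a, ∑ b, ∑ d, ∑ e, rCap c a b d e =
      Fintype.card K * (((Fintype.card K : ℝ) - 1) * rDeg c) ^ 2 := by
  have : ∑ a, ∑ b, ∑ d, ∑ e, rCap c a b d e =
      ∑ w, (∑ a, ∑ b, rInd c w a b) * ∑ d, ∑ e, rInd c w d e := by
    unfold rCap
    simp only [Finset.sum_mul, Finset.mul_sum]
    symm
    rw [Finset.sum_comm]
    refine Finset.sum_congr rfl fun a _ => ?_
    rw [Finset.sum_comm]
    refine Finset.sum_congr rfl fun b _ => ?_
    rw [Finset.sum_comm]
    refine Finset.sum_congr rfl fun d _ => ?_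
    rw [Finset.sum_comm]
    try exact Finset.sum_congr rfl fun e _ => Finset.sum_congr rfl fun w _ => mul_comm _ _
  rw [this]
  simp only [rTot h]
  rw [Finset.sum_const, Finset.card_univ, nsmul_eq_mul]; ring

lemma rCap_sum_sq [DecidableEq K] (h : CubChar c) :
    ∑ a, ∑ b, ∑ d, ∑ e, rCap c a b d e ^ 2 =
      Fintype.card K * ((((Fintype.card K : ℝ) - 1) * rDeg c) ^ 2 +
        ((Fintype.card K : ℝ) - 1) * (rDeg c * (rDeg c - 1)) ^ 2) := by
  have h1 : ∑ a, ∑ b, ∑ d, ∑ e, rCap c a b d e ^ 2 = ∑ w, ∑ w', rPair c w w' ^ 2 := by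
    have e1 : ∀ a b d e : K, rCap c a b d e ^ 2 =
        ∑ w, ∑ w', (rInd c w a b * rInd c w' a b) * (rInd c w d e * rInd c w' d e) := by
      intro a b d e
      unfold rCap
      rw [sq, Finset.sum_mul_sum]
      refine Finset.sum_congr rfl fun w _ => Finset.sum_congr rfl fun w' _ => ?_
      ring
    have e2 : ∀ w w' : K, rPair c w w' ^ 2 = ∑ a, ∑ b, ∑ d, ∑ e,
        (rInd c w a b * rInd c w' a b) * (rInd c w d e * rInd c w' d e) := by
      intro w w'
      unfold rPair
      simp only [sq, Finset.sum_mul, Finset.mul_sum]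
      refine Finset.sum_congr rfl fun a _ => Finset.sum_congr rfl fun b _ =>
        Finset.sum_congr rfl fun d _ => Finset.sum_congr rfl fun e _ => ?_
      ring
    simp only [e1, e2]
    symm
    have e3 : ∀ F : K → K → K → ℝ, ∑ w, ∑ w', ∑ a, F w w' a = ∑ a, ∑ w, ∑ w', F w w' a := by
      intro F
      rw [Finset.sum_comm]
      rw [Finset.sum_congr rfl fun w' _ => Finset.sum_comm]
      rw [Finset.sum_comm]
      refine Finset.sum_congr rfl fun a _ => ?_
      rw [Finset.sum_comm]
    rw [e3]
    refine Finset.sum_congr rfl fun a _ => ?_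
    rw [e3]
    refine Finset.sum_congr rfl fun b _ => ?_
    rw [e3]
    refine Finset.sum_congr rfl fun d _ => ?_
    rw [e3]
  rw [h1]
  have h2 : ∀ w : K, ∑ w', rPair c w w' ^ 2 = (((Fintype.card K : ℝ) - 1) * rDeg c) ^ 2 +
        ((Fintype.card K : ℝ) - 1) * (rDeg c * (rDeg c - 1)) ^ 2 := by
    intro w
    have hq : 1 < Fintype.card K := Fintype.one_lt_card
    rw [← Finset.add_sum_erase _ _ (Finset.mem_univ w), rPair_self h,
      Finset.sum_congr rfl (fun t ht => by rw [rPair_ne h (Finset.ne_of_mem_erase ht).symm]),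
      Finset.sum_const, Finset.card_erase_of_mem (Finset.mem_univ _), Finset.card_univ,
      nsmul_eq_mul, Nat.cast_sub hq.le]
    push_cast; ring
  simp only [h2]
  rw [Finset.sum_const, Finset.card_univ, nsmul_eq_mul]

lemma rCap_var [DecidableEq K] (h : CubChar c) (μ : ℝ) :
    ∑ a, ∑ b, ∑ d, ∑ e, (rCap c a b d e - μ) ^ 2 =
      Fintype.card K * ((((Fintype.card K : ℝ) - 1) * rDeg c) ^ 2 +
        ((Fintype.card K : ℝ) - 1) * (rDeg c * (rDeg c - 1)) ^ 2) -
      2 * μ * (Fintype.card K * (((Fintype.card K : ℝ) - 1) * rDeg c) ^ 2) +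
      μ ^ 2 * (Fintype.card K : ℝ) ^ 4 := by
  rw [← rCap_sum_sq h, ← rCap_sum h]
  have : ∀ a b d e : K, (rCap c a b d e - μ) ^ 2 =
      rCap c a b d e ^ 2 - 2 * μ * rCap c a b d e + μ ^ 2 := fun a b d e => by ring
  simp only [this, Finset.sum_add_distrib, Finset.sum_sub_distrib, ← Finset.mul_sum,
    Finset.sum_const, Finset.card_univ, nsmul_eq_mul]
  ring

lemma exists_quad [DecidableEq K] (h : CubChar c) (μ V : ℝ)
    (hV : ∑ a, ∑ b, ∑ d, ∑ e, (rCap c a b d e - μ) ^ 2 ≤ (Fintype.card K : ℝ) ^ 4 * V) :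
    ∃ a b d e : K, (rCap c a b d e - μ) ^ 2 ≤ 3 * V ∧ (rCap c a d b e - μ) ^ 2 ≤ 3 * V ∧
      (rCap c a e b d - μ) ^ 2 ≤ 3 * V := by
  set Q : K → K → K → K → ℝ := fun a b d e => (rCap c a b d e - μ) ^ 2 with hQ
  have s2 : ∑ a, ∑ b, ∑ d, ∑ e, Q a d b e = ∑ a, ∑ b, ∑ d, ∑ e, Q a b d e := by
    refine Finset.sum_congr rfl fun a _ => ?_
    rw [Finset.sum_comm]
  have s3 : ∑ a, ∑ b, ∑ d, ∑ e, Q a e b d = ∑ a, ∑ b, ∑ d, ∑ e, Q a b d e := by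
    refine Finset.sum_congr rfl fun a _ => ?_
    rw [Finset.sum_congr rfl fun b _ => Finset.sum_comm]
    rw [Finset.sum_comm]
  have htot : ∑ t : K × K × K × K, (Q t.1 t.2.1 t.2.2.1 t.2.2.2 + Q t.1 t.2.2.1 t.2.1 t.2.2.2 +
      Q t.1 t.2.2.2 t.2.1 t.2.2.1) ≤ ∑ t : K × K × K × K, 3 * V := by
    simp only [Fintype.sum_prod_type, Finset.sum_add_distrib]
    rw [s2, s3]
    simp only [Finset.sum_const, Finset.card_univ, nsmul_eq_mul]
    linarith
  obtain ⟨⟨a, b, d, e⟩, -, ht⟩ := Finset.exists_le_of_sum_le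
    (Finset.univ_nonempty (α := K × K × K × K)) htot
  simp only at ht
  have p1 : 0 ≤ Q a b d e := sq_nonneg _
  have p2 : 0 ≤ Q a d b e := sq_nonneg _
  have p3 : 0 ≤ Q a e b d := sq_nonneg _
  exact ⟨a, b, d, e, by linarith, by linarith, by linarith⟩

open Classical in
/-- The set counted by `rCap`. -/
noncomputable def rSet {K : Type} [Field K] [Fintype K] (c : K → ℂ) (a b d e : K) : Finset K :=
  Finset.univ.filter fun w => CRain c w a b ∧ CRain c w d e

lemma rSet_card (a b d e : K) : ((rSet c a b d e).card : ℝ) = rCap c a b d e := by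
  classical
  unfold rSet rCap rInd
  rw [Finset.card_filter]
  push_cast
  refine Finset.sum_congr rfl fun w _ => ?_
  by_cases h1 : CRain c w a b <;> by_cases h2 : CRain c w d e <;> simp [h1, h2]

lemma mem_rSet {a b d e w : K} :
    w ∈ rSet c a b d e ↔ CRain c w a b ∧ CRain c w d e := by
  classical
  unfold rSet
  simp

lemma final_ineq {k s q : ℝ} (hss : s * s = q) (h0 : 0 < s) (hk : 3 * s + 1 ≤ k)
    (h : 2 * k ^ 3 ≤ 4 * (s * k ^ 2) + 6 * (q * k) + 2 * k) : False := by
  have hkpos : 0 < k := by linarith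
  have h2 : k * k ^ 2 ≤ k * (2 * s * k + 3 * (s * s) + 1) := by
    rw [hss]; linarith
  have h3 := le_of_mul_le_mul_left h2 hkpos
  have h1 : 0 ≤ (k - 3 * s - 1) * (k + s) := mul_nonneg (by linarith) (by linarith)
  nlinarith

set_option maxHeartbeats 800000 in
/-- In a field with at least 6000 elements there is a rainbow Fano plane. -/
lemma exists_rainbow [DecidableEq K] (h : CubChar c) (hq : 6000 ≤ Fintype.card K) :
    ∃ a b d e w u v : K, (CRain c w a b ∧ CRain c w d e) ∧ (CRain c u a d ∧ CRain c u b e) ∧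
      (CRain c v a e ∧ CRain c v b d) ∧ CRain c w u v := by
  have hdeg := h.deg
  set q : ℝ := (Fintype.card K : ℝ) with hqd
  set n : ℝ := rDeg c with hn
  have hq6 : (6000 : ℝ) ≤ q := by rw [hqd]; exact_mod_cast hq
  set s : ℝ := √q with hs
  have hs0 : 0 ≤ s := Real.sqrt_nonneg _
  have hss : s * s = q := Real.mul_self_sqrt (by linarith)
  have hs77 : 77.4 ≤ s := by
    rw [hs]; apply Real.le_sqrt_of_sq_le; norm_num; linarith
  rw [abs_le] at hdeg
  obtain ⟨hd1, hd2⟩ := hdeg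
  have hnlow : 2 * (s - 1) ^ 2 ≤ 9 * n := by nlinarith
  have hnup : 3 * n ≤ q - 1 := by nlinarith
  have hn1 : 1 ≤ n := by nlinarith
  have hq0 : 0 < q := by linarith
  have hspos : 0 < s := by linarith
  -- the variance estimate
  have hV : ∑ a, ∑ b, ∑ d, ∑ e, (rCap c a b d e - n ^ 2 / q) ^ 2 ≤ q ^ 4 * (n ^ 2 / q) := by
    rw [rCap_var h (n ^ 2 / q)]
    rw [← hqd, ← hn]
    have hμ : n ^ 2 / q * q = n ^ 2 := by field_simp
    set μ := n ^ 2 / q with hμd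
    have e1 : μ ^ 2 * q ^ 4 = n ^ 4 * q ^ 2 := by
      have : μ ^ 2 * q ^ 4 = (μ * q) ^ 2 * q ^ 2 := by ring
      rw [this, hμ]; ring
    have e2 : 2 * μ * (q * ((q - 1) * n) ^ 2) = 2 * n ^ 2 * ((q - 1) * n) ^ 2 := by
      have : 2 * μ * (q * ((q - 1) * n) ^ 2) = 2 * (μ * q) * ((q - 1) * n) ^ 2 := by ring
      rw [this, hμ]
    have e3 : q ^ 4 * μ = q ^ 3 * n ^ 2 := by
      have : q ^ 4 * μ = q ^ 3 * (μ * q) := by ring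
      rw [this, hμ]
    rw [e1, e2, e3]
    have k1 : n ^ 2 * (3 * q - 2) + (q ^ 2 - q) * (1 - 2 * n) ≤ 0 := by
      have i1 : n ^ 2 * (3 * q - 2) ≤ n * (q * (q - 1)) := by
        have : n * (3 * q - 2) ≤ q * (q - 1) := by nlinarith
        nlinarith
      have i2 : (q ^ 2 - q) * (1 - 2 * n) ≤ (q ^ 2 - q) * (-n) := by
        apply mul_le_mul_of_nonneg_left <;> nlinarith
      nlinarith
    have k2 : q * (q - 1) ^ 2 * n ^ 2 ≤ q ^ 3 * n ^ 2 := by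
      apply mul_le_mul_of_nonneg_right _ (sq_nonneg n)
      nlinarith
    have k3 := mul_nonpos_of_nonneg_of_nonpos (sq_nonneg n) k1
    linarith
  obtain ⟨a, b, d, e, hw, hu, hv⟩ := exists_quad h (n ^ 2 / q) (n ^ 2 / q) hV
  -- sizes
  set y : ℝ := n / s with hy
  have hμy : n ^ 2 / q = y ^ 2 := by rw [hy, div_pow, sq s, hss]
  have hylow : s ≤ 4.5 * y + 2 := by
    have : s * y = n := by rw [hy]; field_simp
    have h3 : s * s ≤ s * (4.5 * y + 2) := by nlinarith
    exact le_of_mul_le_mul_left h3 hspos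
  have hy16 : 16.75 ≤ y := by linarith
  set k : ℕ := ⌈3 * s⌉₊ + 1 with hk
  have hk1 : 3 * s + 1 ≤ k := by
    rw [hk]; push_cast
    linarith [Nat.le_ceil (3 * s)]
  have hk2 : (k : ℝ) < 3 * s + 2 := by
    rw [hk]; push_cast
    linarith [Nat.ceil_lt_add_one (a := 3 * s) (by linarith)]
  have hbig : ∀ a b d e : K, (rCap c a b d e - n ^ 2 / q) ^ 2 ≤ 3 * (n ^ 2 / q) →
      k ≤ (rSet c a b d e).card := by
    intro a b d e hh
    rw [hμy] at hh
    have h1 : |rCap c a b d e - y ^ 2| ≤ 1.75 * y := by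
      apply abs_le_of_sq_le_sq _ (by linarith)
      nlinarith
    have h2 := (abs_le.1 h1).1
    have h3 : (k : ℝ) ≤ (rSet c a b d e).card := by
      rw [rSet_card]
      nlinarith
    exact_mod_cast h3
  obtain ⟨W, hWs, hWc⟩ := Finset.exists_subset_card_eq (hbig _ _ _ _ hw)
  obtain ⟨X, hXs, hXc⟩ := Finset.exists_subset_card_eq (hbig _ _ _ _ hu)
  obtain ⟨Y, hYs, hYc⟩ := Finset.exists_subset_card_eq (hbig _ _ _ _ hv)
  by_contra hcon
  have hmem : ∀ {a b d e w : K}, w ∈ rSet c a b d e → CRain c w a b ∧ CRain c w d e := by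
    intro a b d e w hh
    exact mem_rSet.1 hh
  have hno : ∀ w ∈ W, ∀ u ∈ X, ∀ v ∈ Y, ¬ CRain c w u v := by
    intro w hw u hu v hv hr
    exact hcon ⟨a, b, d, e, w, u, v, hmem (hWs hw), hmem (hXs hu), hmem (hYs hv), hr⟩
  have hfin := h.no_rain k W X Y hWc hXc hYc hno
  exact final_ineq hss hspos hk1 hfin

end Moments

/-- Existence of a cubic character, together with its relation to power residues. -/
lemma exists_cubChar (K : Type) [Field K] [Fintype K] [DecidableEq K]
    (hq : Fintype.card K % 6 = 1) :
    ∃ c : K → ℂ, CubChar c ∧ ∀ x y : K, x ≠ 0 → y ≠ 0 →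
      x ^ ((Fintype.card K - 1) / 3) = y ^ ((Fintype.card K - 1) / 3) → c x = c y := by
  have hc1 : 1 < Fintype.card K := Fintype.one_lt_card
  obtain ⟨χ, hχ⟩ := MulChar.exists_mulChar_orderOf K (R := ℂ) (n := 3)
    (by omega) (Complex.isPrimitiveRoot_exp 3 (by norm_num))
  have h3 : χ ^ 3 = 1 := by rw [← hχ]; exact pow_orderOf_eq_one χ
  have hne : χ ≠ 1 := by
    intro h; rw [h, orderOf_one] at hχ; norm_num at hχ
  have hne2 : χ ^ 2 ≠ 1 := by
    intro h
    have := orderOf_dvd_of_pow_eq_one h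
    rw [hχ] at this; norm_num at this
  have hcube : ∀ x : K, x ≠ 0 → χ x ^ 3 = 1 := by
    intro x hx
    rw [← MulChar.pow_apply' χ (by norm_num), h3, MulChar.one_apply (IsUnit.mk0 x hx)]
  have hneg1 : χ (-1) = 1 := by
    have e1 := hcube (-1) (neg_ne_zero.2 one_ne_zero)
    have e2 : χ (-1) ^ 2 = 1 := by rw [← map_pow]; simp
    calc χ (-1) = χ (-1) ^ 3 := by rw [pow_succ, e2, one_mul]
      _ = 1 := e1
  refine ⟨fun x => χ x, ⟨MulChar.map_zero χ, fun x y => map_mul χ x y, hcube, ?_, ?_, ?_⟩, ?_⟩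
  · intro x
    have : χ (-x) = χ (-1) * χ x := by rw [← map_mul]; simp
    simp only [this, hneg1, one_mul]
  · exact MulChar.sum_eq_zero_of_ne_one hne
  · rw [← MulChar.sum_eq_zero_of_ne_one hne2]
    exact Finset.sum_congr rfl fun x _ => (MulChar.pow_apply' χ (by norm_num) x).symm
  · intro x y hx hy hxy
    obtain ⟨g, hg⟩ := IsCyclic.exists_generator (α := Kˣ)
    obtain ⟨m, hm⟩ := Subgroup.mem_zpowers_iff.1 (hg (Units.mk0 x hx / Units.mk0 y hy))
    have hord : orderOf g = Fintype.card K - 1 := by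
      rw [orderOf_eq_card_of_forall_mem_zpowers hg, Nat.card_eq_fintype_card, Fintype.card_units]
    set e := (Fintype.card K - 1) / 3 with he
    have he3 : Fintype.card K - 1 = e * 3 := by omega
    have h1 : g ^ (m * e) = 1 := by
      rw [zpow_mul, hm, zpow_natCast, div_pow, div_eq_one]
      ext; simpa using hxy
    have h2 := orderOf_dvd_iff_zpow_eq_one.2 h1
    rw [hord, he3] at h2
    push_cast at h2
    rw [mul_comm (e : ℤ)] at h2
    have h4 : (3 : ℤ) ∣ m := Int.dvd_of_mul_dvd_mul_right (by omega) h2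
    obtain ⟨k, rfl⟩ := h4
    have hxk : x = y * ((g ^ k : Kˣ) : K) ^ 3 := by
      have : Units.mk0 x hx = Units.mk0 y hy * (g ^ k) ^ 3 := by
        rw [← zpow_natCast, ← zpow_mul, mul_comm k]
        push_cast
        rw [hm]; simp
      have := congrArg Units.val this
      simpa using this
    rw [hxk]
    simp only [map_mul, map_pow]
    rw [hcube _ (Units.ne_zero _), mul_one]

lemma CRain.swap {K : Type} [Field K] [Fintype K] {c : K → ℂ} (h : CubChar c) {x y z : K}
    (hr : CRain c x y z) : CRain c x z y := by
  obtain ⟨⟨h1, h2, h3⟩, h4, h5, h6⟩ := hr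
  refine ⟨⟨h3, h2.symm, h1⟩, ?_, ?_, ?_⟩
  · rw [h.sub_comm z y]; exact h5.symm
  · rw [h.sub_comm z y]; exact h4.symm
  · exact h6.symm

lemma FKField.of_large (K : Type) [Field K] [Fintype K] (hq : Fintype.card K % 6 = 1)
    (hl : 6000 ≤ Fintype.card K) : FKField (Fintype.card K) := by
  classical
  obtain ⟨c, hc, hlink⟩ := exists_cubChar K hq
  obtain ⟨a, b, d, e, w, u, v, ⟨h1, h2⟩, ⟨h3, h4⟩, ⟨h5, h6⟩, h7⟩ := exists_rainbow hc hl
  have key : ∀ {x y z : K}, CRain c x y z → FKRain x y z := by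
    rintro x y z ⟨⟨g1, g2, g3⟩, g4, g5, g6⟩
    have n1 := sub_ne_zero.2 g1
    have n2 := sub_ne_zero.2 g2
    have n3 := sub_ne_zero.2 g3
    exact ⟨⟨g1, g2, g3⟩, fun hh => g4 (hlink _ _ n1 n2 hh), fun hh => g5 (hlink _ _ n2 n3 hh),
      fun hh => g6 (hlink _ _ n1 n3 hh)⟩
  -- lines 013, 124, 235, 346, 450, 561, 602
  refine ⟨K, inferInstance, inferInstance, inferInstance, rfl, hq, ![a, b, d, w, v, e, u], ?_⟩
  intro j
  apply key
  fin_cases j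
  · exact (h1.rot hc)
  · exact (h6.rot hc)
  · exact (((h2.swap hc).rot hc).rot hc)
  · exact (h7.swap hc)
  · exact (h5.swap hc)
  · exact ((h4.rot hc).rot hc)
  · exact h3

section FiniteChecks

/-- `|x - y| ^ ((p - 1) / 3)` modulo `p`. -/
def dPow (p x y : ℕ) : ℕ := ((x - y) + (y - x)) ^ ((p - 1) / 3) % p

/-- The three values are nonzero and pairwise different. -/
def tripOK (a b c : ℕ) : Bool :=
  !(a == 0) && !(b == 0) && !(c == 0) && !(a == b) && !(b == c) && !(a == c)

/-- The `j`-th digit in base 64. -/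
def dig (t j : ℕ) : ℕ := t / 64 ^ j % 64

/-- The digits of `t` form a rainbow Fano plane modulo `p`. -/
def codeOK (p t : ℕ) : Bool :=
  (List.range 7).all fun j =>
    tripOK (dPow p (dig t j) (dig t ((j + 1) % 7)))
      (dPow p (dig t ((j + 1) % 7)) (dig t ((j + 3) % 7)))
      (dPow p (dig t j) (dig t ((j + 3) % 7)))

/-- Nonprimality (or exceptionality) test. -/
def skipOK (n : ℕ) : Bool :=
  n == 1 || n == 13 || [5, 7, 11, 13, 17, 19, 23, 29, 31, 37, 41, 43, 47, 53, 59, 61, 67, 71,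
    73].any fun d => n % d == 0 && decide (d < n)

/-- Run through the table, starting at `n` in steps of 6. -/
def tabOK : ℕ → List ℕ → Bool
  | _, [] => true
  | n, t :: l => (if t == 0 then skipOK n else codeOK n t) && tabOK (n + 6) l

lemma tabOK_spec : ∀ (l : List ℕ) (n : ℕ), tabOK n l = true → ∀ i < l.length,
    skipOK (n + 6 * i) = true ∨ ∃ t, codeOK (n + 6 * i) t = true := by
  intro l
  induction l with
  | nil => intro n _ i hi; simp at hi
  | cons t l ih =>
    intro n hn i hi
    rw [tabOK, Bool.and_eq_true] at hn
    rcases i with _ | i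
    · by_cases ht : t = 0
      · left; simpa [ht] using hn.1
      · right; exact ⟨t, by simpa [ht] using hn.1⟩
    · have := ih (n + 6) hn.2 i (by simpa using hi)
      rwa [show n + 6 + 6 * i = n + 6 * (i + 1) by ring] at this

lemma skipOK_spec {n : ℕ} (h : skipOK n = true) (hp : n.Prime) : n = 13 := by
  simp only [skipOK, Bool.or_eq_true, beq_iff_eq, List.any_eq_true, Bool.and_eq_true,
    decide_eq_true_eq] at h
  rcases h with (h | h) | ⟨d, hd, h0, hlt⟩
  · exact absurd h hp.one_lt.ne'
  · exact h
  · exfalso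
    rcases (Nat.dvd_prime hp).1 (Nat.dvd_of_mod_eq_zero h0) with h1 | h1
    · subst h1; simp at hd
    · omega

lemma dPow_cast {p : ℕ} [Fact p.Prime] (hp : p % 6 = 1) (x y : ℕ) :
    ((dPow p x y : ℕ) : ZMod p) = ((x : ZMod p) - y) ^ ((p - 1) / 3) := by
  have he : Even ((p - 1) / 3) := by rw [Nat.even_iff]; omega
  unfold dPow
  rw [ZMod.natCast_mod]
  push_cast
  rcases le_total x y with h | h
  · rw [Nat.sub_eq_zero_of_le h, Nat.cast_sub h, Nat.cast_zero, zero_add, ← neg_sub, he.neg_pow]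
  · rw [Nat.sub_eq_zero_of_le h, Nat.cast_sub h, Nat.cast_zero, add_zero]

lemma tripOK_rain {p : ℕ} [Fact p.Prime] (hp : p % 6 = 1) (x y z : ℕ)
    (h : tripOK (dPow p x y) (dPow p y z) (dPow p x z) = true) :
    FKRain (x : ZMod p) y z := by
  simp only [tripOK, Bool.and_eq_true, Bool.not_eq_true', beq_eq_false_iff_ne] at h
  obtain ⟨⟨⟨⟨⟨h1, h2⟩, h3⟩, h4⟩, h5⟩, h6⟩ := h
  have hp1 : 1 < p := (Fact.out : p.Prime).one_lt
  have hlt : ∀ x y, dPow p x y < p := fun x y => Nat.mod_lt _ (by omega)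
  have hne : ∀ m n, m < p → n < p → m ≠ n → (m : ZMod p) ≠ n := by
    intro m n hm hn hmn hh
    rw [ZMod.natCast_eq_natCast_iff'] at hh
    rw [Nat.mod_eq_of_lt hm, Nat.mod_eq_of_lt hn] at hh
    exact hmn hh
  have he : (p - 1) / 3 ≠ 0 := by omega
  have hz : ∀ x y, dPow p x y ≠ 0 → (x : ZMod p) ≠ y := by
    intro x y hh hxy
    have := hne _ 0 (hlt x y) (by omega) hh
    rw [dPow_cast hp, hxy, sub_self, zero_pow he] at this
    simp at this
  refine ⟨⟨hz _ _ h1, hz _ _ h2, hz _ _ h3⟩, ?_, ?_, ?_⟩ <;>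
    rw [ZMod.card, ← dPow_cast hp, ← dPow_cast hp]
  · exact hne _ _ (hlt _ _) (hlt _ _) h4
  · exact hne _ _ (hlt _ _) (hlt _ _) h5
  · exact hne _ _ (hlt _ _) (hlt _ _) h6

lemma codeOK_field {p t : ℕ} (hpp : p.Prime) (hp : p % 6 = 1) (h : codeOK p t = true) :
    FKField p := by
  haveI : Fact p.Prime := ⟨hpp⟩
  refine ⟨ZMod p, inferInstance, inferInstance, inferInstance, ZMod.card p, hp,
    fun j => (dig t j.val : ZMod p), ?_⟩
  intro j
  have h2 := (List.all_eq_true.1 h) j.val (by simp)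
  have := tripOK_rain hp _ _ _ h2
  fin_cases j <;> exact this

/-- Codes of rainbow Fano planes for the primes `p = 6 i + 1` (zero if not applicable). -/
def primeTab : List ℕ := [
  0, 417753473088, 0, 560611729472, 0, 761386774592, 428490891328, 976167395392, 0, 0,
  703537094720, 976234487872, 841009864768, 1599024963648, 0, 0, 567191019584, 970985840704,
  1463680794688, 0, 0, 775630647360, 0, 968586702912, 0, 1317652947008, 1521780801600,
  1041750855744, 0, 0, 693707747392, 0, 1737500667968, 1182543130688, 0, 572490784832, 0,
  1053679444032, 1044031246400, 0, 970847965248, 0, 0, 0, 0, 841046302784, 497246289984,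
  497246548032, 0, 0, 0, 1536713064512, 691595128896, 0, 0, 631646482496, 212672979008, 0,
  430638374976, 0, 0, 1667860013120, 560611729472, 693889679424, 0, 0, 1110486831168, 0,
  491992666176, 0, 492009443392, 0, 1325134266432, 1614390575168, 0, 0, 1329764036672,
  904329977920, 0, 0, 0, 490871468096, 0, 1611893596224, 0, 0, 0, 1112633258048, 0, 0,
  417753473088, 840858869824, 0, 0, 0, 417753473088, 1112633258048, 0, 0, 0, 1802246049856,
  486657499200, 497280106560, 639146672192, 0, 423359946816, 0, 2436628000832, 0, 0, 770162303040,
  0, 631646482496, 0, 0, 494277509184, 0, 0, 564992417856, 0, 0, 2295904104512, 978703634496,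
  2005016285248, 0, 486657499200, 1526966538304, 0, 560678838336, 0, 0, 702331232320, 0, 0, 0,
  1245760204864, 0, 1328303579200, 284747378752, 0, 0, 0, 1330840387648, 764793339968, 0, 0,
  417753473088, 560611729472, 0, 0, 0, 1598081232960, 0, 1534648393792, 0, 0, 417753473088, 0, 0,
  0, 0, 1118022414400, 0, 0, 0, 980528930880, 2729828438080, 0, 639230562368, 0, 2761082822720, 0,
  417753473088, 767042805824, 0, 560681209920, 0, 1387429376064, 971922743360, 0, 0, 693707747392,
  1401371254848, 0, 0, 0, 1590655733824, 693707747392, 1318673457216, 0, 0, 0, 560611729472, 0, 0,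
  417753473088, 0, 0, 0, 0, 562994110528, 0, 845288321088, 0, 0, 1530524364864, 969795448896, 0,
  497280106560, 0, 0, 0, 0, 833326161984, 0, 969809875008, 491992666176, 1810569109568, 0, 0,
  1110352867392, 1601371119680, 0, 0, 0, 0, 0, 0, 0, 0, 834533339200, 0, 0, 3065118773312, 0, 0,
  0, 1338321956928, 489983860800, 0, 0, 763719598144, 417753473088, 1314705928256, 0,
  1320839303232, 0, 1106024345664, 1670995021888, 0, 0, 0, 0, 0, 0, 1940474044480, 0,
  1057875607616, 783304126528, 0, 0, 1114629488704, 0, 1258645106752, 0, 0, 3340049346624, 0,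
  976234487872, 0, 705751687232, 1334234071104, 0, 0, 0, 0, 1599145304128, 560611729472,
  1245762826304, 0, 0, 0, 417753473088, 2288405209152, 0, 0, 0, 1672205049920, 0, 0, 417753473088,
  430839701568, 2284559294528, 982693716032, 0, 0, 1110353129536, 765898006592, 1735319371840, 0,
  770008686656, 0, 0, 0, 0, 2033924988992, 0, 0, 0, 0, 1459537072192, 1534581317696, 508156989504,
  1245762826304, 0, 0, 0, 0, 0, 0, 0, 0, 1619981250624, 0, 0, 563802546240, 0, 0, 0, 0, 0,
  1459556995136, 1122364047424, 1960990748736, 0, 632505774144, 1317652672576, 0, 1461665931328,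
  0, 0, 0, 555396640832, 0, 0, 0, 0, 567191019584, 766888390720, 0, 0, 0, 834517082176, 0, 0,
  770162303040, 560678838336, 770075795520, 0, 0, 906540900416, 0, 0, 1808421642304, 0, 0, 0,
  1757488103488, 0, 0, 1172830953536, 0, 0, 212671930432, 0, 1943694770240, 0, 0, 703537094720, 0,
  909747183680, 2928586588224, 1185615192128, 0, 0, 417753473088, 0, 0, 0, 0, 2291569270848,
  1386589724736, 0, 0, 0, 417753473088, 290113466432, 2765280272448, 1172830953536, 0, 0, 0, 0, 0,
  0, 0, 833326161984, 0, 0, 0, 0, 1589229404224, 417753473088, 0, 0, 0, 0, 1250110230592, 0, 0,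
  835724521536, 0, 0, 417753473088, 0, 560765349952, 563802546240, 0, 0, 0, 0, 0, 1391774408768,
  0, 0, 0, 1050545008704, 0, 0, 0, 0, 1313408819264, 0, 774257254464, 0, 1763930554432,
  764725973056, 490974498880, 700316401728, 0, 0, 492026220608, 702331232320, 975179894848, 0,
  1322064044096, 0, 0, 1250428997696, 0, 0, 781840572480, 0, 0, 0, 1939498344512, 833326161984,
  2232730529856, 0, 0, 0, 0, 1660362178624, 0, 0, 1534581284928, 417753473088, 0, 0, 0, 0,
  560611729472, 0, 0, 0, 0, 976167395392, 0, 0, 0, 0, 0, 2690063552576, 0, 0, 791626141760, 0, 0,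
  0, 0, 1188002558016, 0, 0, 1523847036992, 0, 0, 904329977920, 0, 493050417216, 0, 771084787776,
  1597947297856, 0, 1525991350336, 0, 0, 0, 0, 763736629312, 0, 701255393344, 0, 0, 0, 0, 0, 0,
  1388535357504, 417753473088, 0, 1450813440064, 1120216297536, 0, 0, 0, 0, 493050417216, 0,
  489999319104, 0, 0, 0, 838862413888, 1110353129536, 0, 983733903424, 0, 0, 0, 0, 560611729472,
  701255393344, 570361126976, 831365324864, 0, 489845960768, 0, 709025624128, 0, 0, 693889679424,
  0, 1411423703104, 0, 0, 770008686656, 0, 0, 0, 0, 0, 0, 417753473088, 0, 0, 0, 1472342802496,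
  1004270030912, 700164612160, 0, 0, 0, 0, 1544179961920, 0, 417753473088, 980498014272, 0,
  776420728896, 0, 711078719552, 417753473088, 0, 417753473088, 0, 417753473088, 0, 555396640832,
  0, 0, 0, 1519549947968, 1450796924992, 0, 0, 1757491806272, 693707747392, 968651186240, 0, 0, 0,
  0, 1185615192128, 0, 0, 919430504512, 1451985227840, 0, 1390681268288, 0, 0, 693889679424,
  1332083441728, 355530448960, 0, 0, 0, 0, 350362812480, 0, 0, 0, 570241851456, 0, 0, 0, 0,
  2136079872064, 0, 0, 0, 902249594944, 979728105536, 0, 0, 0, 693707747392, 0, 1534648393792, 0,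
  0, 1590534086720, 0, 492026220608, 0, 906540900416, 0, 572409786432, 0, 0, 0, 1172830953536, 0,
  0, 0, 0, 0, 417753473088, 0, 0, 492009443392, 916174970944, 0, 0, 0, 1392834256960,
  833596706880, 0, 0, 0, 0, 0, 1189841739840, 902249594944, 0, 417753473088, 0, 0, 1388535357504,
  0, 0, 0, 1392964542528, 563951198272, 0, 0, 1888983208000, 0, 0, 0, 212671668288, 0, 0,
  213980815424, 0, 832306425920, 0, 1447675043904, 0, 0, 491992666176, 0, 1114884038720, 0, 0, 0,
  1106024345664, 0, 0, 0, 0, 1819290398784, 0, 1459403374656, 0, 0, 492026220608, 417753473088, 0,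
  0, 0, 0, 0, 0, 0, 0, 0, 497246548032, 0, 0, 417753473088, 1598936866880, 0, 0, 0, 0, 0,
  1258561220672, 0, 0, 0, 492009443392, 1693602050112, 1320838512704, 0, 0, 0, 0, 1243849441344,
  0, 970847965248, 497246289984, 0, 0, 0, 1389557207104, 1317652947008, 417753473088, 0, 0,
  560611729472, 0, 0, 1519748395072, 0, 766888390720, 1341566001216, 494277509184, 0, 0, 0, 0, 0,
  0, 0, 0, 0, 1328355504192, 3551424708672, 0, 0, 0, 0, 1399276707904, 0, 0, 0, 2022127231040,
  840006119488, 0, 428595757120, 0, 904360112192, 0, 0, 764725973056, 0, 0, 0, 0, 486607167552, 0,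
  0, 0, 0, 0, 0, 1450796662848, 1523978616896, 0, 0, 0, 643543879744, 0, 0, 705550360640,
  493050417216, 0, 493050417216, 0, 0, 417753473088, 1120216297536, 486607167552, 0,
  1110451957824, 0, 492026220608, 0, 0, 0, 0, 0, 1549031190592, 0, 0, 1534581284928, 0, 0, 0,
  1961603936320, 417753473088, 2797673951296, 430638374976, 0, 0, 0, 0, 0, 0, 0, 1388535357504, 0,
  1255392165952, 0, 0, 1008853332032, 0, 1110486831168, 0, 0, 1869627801664, 919821119552, 0, 0,
  0, 0, 0, 0, 0, 581314830400, 0, 0, 0, 0, 0, 0, 780045144128, 0, 0, 0, 700420743232, 0, 0, 0, 0,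
  0, 0, 0, 0, 0, 290113466432, 639248126016, 1390682841152, 0, 417753473088, 770008686656,
  1389560614976, 770075795520, 0, 0, 0, 0, 486607167552, 0, 0, 0, 560681209920, 0, 0,
  902249594944, 643543879744, 0, 0, 0, 0, 904360112192, 417753473088, 1702227628096, 0,
  1110353129536, 0, 0, 0, 0, 0, 0, 764810117184, 0, 0, 280386089024, 1598081232960, 1527149510720,
  1038499721280, 0, 0, 0, 492026220608, 486657499200, 0, 1601206263872, 0, 0, 0, 0, 0,
  1604378472512, 212671668288, 417753473088, 0, 0, 0, 0, 1328404242496, 0, 497280106560, 0, 0, 0,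
  0, 1335167062080, 423359946816, 0, 779925602368, 0, 1245762826304, 970847965248, 0,
  763770187840, 0, 417753473088, 0, 0, 0, 0, 0, 0, 417753473088, 0, 0, 0, 0, 500719960128, 0, 0,
  0, 0, 0, 0, 0]

set_option maxRecDepth 100000 in
lemma primeTab_ok : tabOK 1 primeTab = true := by decide +kernel

set_option maxRecDepth 100000 in
lemma primeTab_len : primeTab.length = 1000 := by decide +kernel

lemma FKField.prime {p : ℕ} (hp : p.Prime) (h6 : p % 6 = 1) (h13 : p ≠ 13) : FKField p := by
  by_cases hl : 6000 ≤ p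
  · haveI : Fact p.Prime := ⟨hp⟩
    have := FKField.of_large (ZMod p) (by rw [ZMod.card]; exact h6) (by rw [ZMod.card]; exact hl)
    rwa [ZMod.card] at this
  · have hi : p / 6 < primeTab.length := by rw [primeTab_len]; omega
    have h1 : 1 + 6 * (p / 6) = p := by omega
    have := tabOK_spec _ _ primeTab_ok (p / 6) hi
    rw [h1] at this
    rcases this with h | ⟨t, h⟩
    · exact absurd (skipOK_spec h hp) h13
    · exact codeOK_field hp h6 h

end FiniteChecks

section Extensions

/-- Fast exponentiation with fuel. -/
def fPow {α : Type} (mul : α → α → α) : ℕ → ℕ → α → α → α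
  | 0, _, _, acc => acc
  | f + 1, e, x, acc =>
    fPow mul f (e / 2) (mul x x) (if e % 2 = 1 then mul acc x else acc)

lemma fPow_eval {K α : Type} [Field K] (mul : α → α → α) (ev : α → K)
    (hmul : ∀ x y, ev (mul x y) = ev x * ev y) :
    ∀ (f e : ℕ) (x acc : α), e < 2 ^ f → ev (fPow mul f e x acc) = ev acc * ev x ^ e := by
  intro f
  induction f with
  | zero =>
    intro e x acc he
    obtain rfl : e = 0 := by simpa using he
    simp [fPow]
  | succ f ih =>
    intro e x acc he
    rw [fPow, ih _ _ _ (by rw [pow_succ] at he; omega), hmul, ← sq, ← pow_mul]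
    split_ifs with h
    · rw [hmul, mul_assoc, ← pow_succ']
      congr 2; omega
    · congr 2; omega

/-- Evaluation data for a concrete model of a finite field. -/
lemma FKField.of_model {K α : Type} [Field K] [Fintype K] [DecidableEq α]
    (mul sub : α → α → α) (one : α) (ev : α → K)
    (hmul : ∀ x y, ev (mul x y) = ev x * ev y) (hsub : ∀ x y, ev (sub x y) = ev x - ev y)
    (hone : ev one = 1) (b : Fin 7 → α) (u : Fin 3 → α)
    (hu : Function.Injective fun i => ev (u i)) (hu0 : ∀ i, ev (u i) ≠ 0)
    {q : ℕ} (hq : Fintype.card K = q) (hq6 : q % 6 = 1) (hq13 : q < 2 ^ 13)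
    (s : Fin 7 → Equiv.Perm (Fin 3))
    (h : ∀ j : Fin 7,
      fPow mul 13 ((q - 1) / 3) (sub (b j) (b (j + 1))) one = u (s j 0) ∧
      fPow mul 13 ((q - 1) / 3) (sub (b (j + 1)) (b (j + 3))) one = u (s j 1) ∧
      fPow mul 13 ((q - 1) / 3) (sub (b j) (b (j + 3))) one = u (s j 2)) :
    FKField q := by
  classical
  have hq1 : 1 < q := by rw [← hq]; exact Fintype.one_lt_card
  have hP : ∀ x y, ev (fPow mul 13 ((q - 1) / 3) (sub x y) one) =
      (ev x - ev y) ^ ((q - 1) / 3) := by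
    intro x y
    rw [fPow_eval mul ev hmul _ _ _ _ (by omega), hone, one_mul, hsub]
  have hz : ∀ x y i, fPow mul 13 ((q - 1) / 3) (sub x y) one = u i → ev x ≠ ev y := by
    intro x y i hh hxy
    have h1 := hP x y
    rw [hh, hxy, sub_self, zero_pow (by omega)] at h1
    exact hu0 i h1
  have hne : ∀ x y x' y' i i', fPow mul 13 ((q - 1) / 3) (sub x y) one = u i →
      fPow mul 13 ((q - 1) / 3) (sub x' y') one = u i' → i ≠ i' →
      (ev x - ev y) ^ ((q - 1) / 3) ≠ (ev x' - ev y') ^ ((q - 1) / 3) := by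
    intro x y x' y' i i' h1 h2 hii hh
    rw [← hP, ← hP, h1, h2] at hh
    exact hii (hu hh)
  refine ⟨K, inferInstance, inferInstance, inferInstance, hq, hq6, fun j => ev (b j), ?_⟩
  intro j
  obtain ⟨h1, h2, h3⟩ := h j
  unfold FKRain
  rw [hq]
  refine ⟨⟨hz _ _ _ h1, hz _ _ _ h2, hz _ _ _ h3⟩, hne _ _ _ _ _ _ h1 h2 ?_,
    hne _ _ _ _ _ _ h2 h3 ?_, hne _ _ _ _ _ _ h1 h3 ?_⟩ <;>
  · rw [(s j).injective.ne_iff]; decide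

/-- A boolean version of the hypothesis of `FKField.of_model`. -/
def modelOK {α : Type} [DecidableEq α] (mul sub : α → α → α) (one : α) (b : Fin 7 → α)
    (u : Fin 3 → α) (q : ℕ) : Bool :=
  (List.finRange 7).all fun j =>
    [(0, 1, 2), (0, 2, 1), (1, 0, 2), (1, 2, 0), (2, 0, 1), (2, 1, 0)].any
      fun s : Fin 3 × Fin 3 × Fin 3 =>
      decide (fPow mul 13 ((q - 1) / 3) (sub (b j) (b (j + 1))) one = u s.1) &&
      decide (fPow mul 13 ((q - 1) / 3) (sub (b (j + 1)) (b (j + 3))) one = u s.2.1) &&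
      decide (fPow mul 13 ((q - 1) / 3) (sub (b j) (b (j + 3))) one = u s.2.2)

lemma perm_of_triple : ∀ s ∈ ([(0, 1, 2), (0, 2, 1), (1, 0, 2), (1, 2, 0), (2, 0, 1),
    (2, 1, 0)] : List (Fin 3 × Fin 3 × Fin 3)),
    ∃ t : Equiv.Perm (Fin 3), t 0 = s.1 ∧ t 1 = s.2.1 ∧ t 2 = s.2.2 := by
  decide

lemma FKField.of_modelOK {K α : Type} [Field K] [Fintype K] [DecidableEq α]
    (mul sub : α → α → α) (one : α) (ev : α → K)
    (hmul : ∀ x y, ev (mul x y) = ev x * ev y) (hsub : ∀ x y, ev (sub x y) = ev x - ev y)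
    (hone : ev one = 1) (b : Fin 7 → α) (u : Fin 3 → α)
    (hu : Function.Injective fun i => ev (u i)) (hu0 : ∀ i, ev (u i) ≠ 0)
    {q : ℕ} (hq : Fintype.card K = q) (hq6 : q % 6 = 1) (hq13 : q < 2 ^ 13)
    (h : modelOK mul sub one b u q = true) : FKField q := by
  have h' : ∀ j : Fin 7, ∃ t : Equiv.Perm (Fin 3),
      fPow mul 13 ((q - 1) / 3) (sub (b j) (b (j + 1))) one = u (t 0) ∧
      fPow mul 13 ((q - 1) / 3) (sub (b (j + 1)) (b (j + 3))) one = u (t 1) ∧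
      fPow mul 13 ((q - 1) / 3) (sub (b j) (b (j + 3))) one = u (t 2) := by
    intro j
    have h1 := (List.all_eq_true.1 h) j (List.mem_finRange j)
    obtain ⟨s, hs, h2⟩ := List.any_eq_true.1 h1
    rw [Bool.and_eq_true, Bool.and_eq_true, decide_eq_true_eq, decide_eq_true_eq,
      decide_eq_true_eq] at h2
    obtain ⟨t, t0, t1, t2⟩ := perm_of_triple s hs
    exact ⟨t, by rw [t0, t1, t2]; exact ⟨h2.1.1, h2.1.2, h2.2⟩⟩
  choose s hs using h'
  exact FKField.of_model mul sub one ev hmul hsub hone b u hu hu0 hq hq6 hq13 s hs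

lemma cast_mod_zero {K : Type} [Field K] {p : ℕ} (hp : (p : K) = 0) (n : ℕ) :
    ((n % p : ℕ) : K) = n := by
  conv_rhs => rw [← Nat.mod_add_div n p]
  push_cast
  rw [hp]; ring

/-- Multiplication of `a + b θ` where `θ ^ 2 = r + s θ`, modulo `p`. -/
def mul2 (p r s : ℕ) (x y : ℕ × ℕ) : ℕ × ℕ :=
  ((x.1 * y.1 + r * (x.2 * y.2)) % p, (x.1 * y.2 + x.2 * y.1 + s * (x.2 * y.2)) % p)

/-- Subtraction modulo `p`. -/
def sub2 (p : ℕ) (x y : ℕ × ℕ) : ℕ × ℕ :=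
  ((x.1 + (p - 1) * y.1) % p, (x.2 + (p - 1) * y.2) % p)

/-- Evaluation of a pair. -/
def ev2 {K : Type} [Field K] (θ : K) (x : ℕ × ℕ) : K := x.1 + x.2 * θ

lemma ev2_mul {K : Type} [Field K] {θ : K} {p r s : ℕ} (hp : (p : K) = 0)
    (hθ : θ ^ 2 = r + s * θ) (x y : ℕ × ℕ) : ev2 θ (mul2 p r s x y) = ev2 θ x * ev2 θ y := by
  unfold ev2 mul2
  simp only [cast_mod_zero hp]
  push_cast
  linear_combination (-(x.2 : K) * y.2) * hθ

lemma ev2_sub {K : Type} [Field K] {θ : K} {p : ℕ} (hp : (p : K) = 0) (hp1 : 1 ≤ p)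
    (x y : ℕ × ℕ) : ev2 θ (sub2 p x y) = ev2 θ x - ev2 θ y := by
  unfold ev2 sub2
  simp only [cast_mod_zero hp]
  push_cast [Nat.cast_sub hp1]
  rw [hp]; ring

/-- Multiplication of `a + b θ + c θ ^ 2` where `θ ^ 3 = r`, modulo `p`. -/
def mul3 (p r : ℕ) (x y : ℕ × ℕ × ℕ) : ℕ × ℕ × ℕ :=
  ((x.1 * y.1 + r * (x.2.1 * y.2.2 + x.2.2 * y.2.1)) % p,
    (x.1 * y.2.1 + x.2.1 * y.1 + r * (x.2.2 * y.2.2)) % p,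
    (x.1 * y.2.2 + x.2.1 * y.2.1 + x.2.2 * y.1) % p)

/-- Subtraction modulo `p`. -/
def sub3 (p : ℕ) (x y : ℕ × ℕ × ℕ) : ℕ × ℕ × ℕ :=
  ((x.1 + (p - 1) * y.1) % p, (x.2.1 + (p - 1) * y.2.1) % p, (x.2.2 + (p - 1) * y.2.2) % p)

/-- Evaluation of a triple. -/
def ev3 {K : Type} [Field K] (θ : K) (x : ℕ × ℕ × ℕ) : K := x.1 + x.2.1 * θ + x.2.2 * θ ^ 2

lemma ev3_mul {K : Type} [Field K] {θ : K} {p r : ℕ} (hp : (p : K) = 0)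
    (hθ : θ ^ 3 = r) (x y : ℕ × ℕ × ℕ) : ev3 θ (mul3 p r x y) = ev3 θ x * ev3 θ y := by
  unfold ev3 mul3
  simp only [cast_mod_zero hp]
  push_cast
  linear_combination (-(x.2.1 : K) * y.2.2 - x.2.2 * y.2.1 - x.2.2 * y.2.2 * θ) * hθ

lemma ev3_sub {K : Type} [Field K] {θ : K} {p : ℕ} (hp : (p : K) = 0) (hp1 : 1 ≤ p)
    (x y : ℕ × ℕ × ℕ) : ev3 θ (sub3 p x y) = ev3 θ x - ev3 θ y := by
  unfold ev3 sub3
  simp only [cast_mod_zero hp]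
  push_cast [Nat.cast_sub hp1]
  rw [hp]; ring

lemma exists_root {K : Type} [Field K] [Fintype K] {n e : ℕ} (hn : 0 < n) (he : 0 < e)
    (hc : Fintype.card K - 1 = n * e) {x : K} (hx : x ≠ 0) (h : x ^ e = 1) :
    ∃ y : K, y ^ n = x := by
  classical
  obtain ⟨g, hg⟩ := IsCyclic.exists_generator (α := Kˣ)
  obtain ⟨m, hm⟩ := Subgroup.mem_zpowers_iff.1 (hg (Units.mk0 x hx))
  have hord : orderOf g = Fintype.card K - 1 := by
    rw [orderOf_eq_card_of_forall_mem_zpowers hg, Nat.card_eq_fintype_card, Fintype.card_units]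
  have h1 : g ^ (m * e) = 1 := by
    rw [zpow_mul, hm, zpow_natCast]
    ext; simpa using h
  have h2 := orderOf_dvd_iff_zpow_eq_one.2 h1
  rw [hord, hc] at h2
  push_cast at h2
  have h4 : (n : ℤ) ∣ m := Int.dvd_of_mul_dvd_mul_right (by omega) h2
  obtain ⟨k, rfl⟩ := h4
  refine ⟨((g ^ k : Kˣ) : K), ?_⟩
  rw [← Units.val_pow_eq_pow_val, ← zpow_natCast, ← zpow_mul, mul_comm k, hm, Units.val_mk0]

lemma injective_three {K : Type} {f : Fin 3 → K} (h01 : f 0 ≠ f 1) (h12 : f 1 ≠ f 2)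
    (h02 : f 0 ≠ f 2) : Function.Injective f := by
  have h10 := h01.symm
  have h21 := h12.symm
  have h20 := h02.symm
  intro i j hij
  fin_cases i <;> fin_cases j <;> first | rfl | exact absurd hij (by assumption)

lemma exists_cube_root_one {K : Type} [Field K] [Fintype K] (h : Fintype.card K % 6 = 1) :
    ∃ w : K, w ≠ 1 ∧ w ^ 2 + w + 1 = 0 := by
  classical
  have h3 : 3 ∣ Nat.card Kˣ := by
    rw [Nat.card_eq_fintype_card, Fintype.card_units]; omega
  haveI : Fact (Nat.Prime 3) := ⟨Nat.prime_three⟩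
  obtain ⟨g, hg⟩ := exists_prime_orderOf_dvd_card' 3 h3
  have hg3 : (g : K) ^ 3 = 1 := by
    rw [← Units.val_pow_eq_pow_val, ← hg, pow_orderOf_eq_one]; rfl
  have hg1 : (g : K) ≠ 1 := by
    intro hh
    rw [Units.val_eq_one] at hh
    rw [hh, orderOf_one] at hg; norm_num at hg
  refine ⟨g, hg1, ?_⟩
  apply mul_left_cancel₀ (sub_ne_zero.2 hg1)
  linear_combination hg3

lemma exists_field (p n : ℕ) (hp : p.Prime) (hn : n ≠ 0) :
    ∃ (K : Type) (_ : Field K) (_ : Fintype K), Fintype.card K = p ^ n ∧ (p : K) = 0 := by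
  haveI : Fact p.Prime := ⟨hp⟩
  refine ⟨GaloisField p n, inferInstance, Fintype.ofFinite _, ?_, ?_⟩
  · rw [Fintype.card_eq_nat_card, GaloisField.card p n hn]
  · exact CharP.cast_eq_zero _ p

lemma FKField.sq_of_model {p : ℕ} (hp : p.Prime) (h6 : p ^ 2 % 6 = 1) (hlt : p ^ 2 < 2 ^ 13)
    (b : Fin 7 → ℕ × ℕ)
    (h : modelOK (mul2 p (p - 1) (p - 1)) (sub2 p) (1, 0) b ![(1, 0), (0, 1), (p - 1, p - 1)]
      (p ^ 2) = true) : FKField (p ^ 2) := by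
  obtain ⟨K, _, _, hK, hpK⟩ := exists_field p 2 hp (by norm_num)
  obtain ⟨w, hw1, hw⟩ := exists_cube_root_one (K := K) (by rw [hK]; exact h6)
  have hp1 : 1 ≤ p := hp.one_lt.le
  have hm1 : ((p - 1 : ℕ) : K) = -1 := by push_cast [Nat.cast_sub hp1]; rw [hpK]; ring
  have hw3 : w ^ 3 = 1 := by linear_combination (w - 1) * hw
  have hw0 : w ≠ 0 := by rintro rfl; norm_num at hw
  have hcu : ev2 w ((p - 1, p - 1) : ℕ × ℕ) = w ^ 2 := by
    unfold ev2
    simp only [hm1]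
    linear_combination -hw
  have h0 : ev2 w ((1, 0) : ℕ × ℕ) = 1 := by simp [ev2]
  have h1 : ev2 w ((0, 1) : ℕ × ℕ) = w := by simp [ev2]
  refine FKField.of_modelOK _ _ _ (ev2 w) (ev2_mul hpK ?_) (ev2_sub hpK hp1) h0 b _ ?_ ?_
    hK h6 hlt h
  · rw [hm1]; linear_combination hw
  · apply injective_three
    · change ev2 w ((1, 0) : ℕ × ℕ) ≠ ev2 w ((0, 1) : ℕ × ℕ)
      rw [h0, h1]; exact hw1.symm
    · change ev2 w ((0, 1) : ℕ × ℕ) ≠ ev2 w ((p - 1, p - 1) : ℕ × ℕ)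
      rw [h1, hcu]
      intro hh
      apply hw1
      apply mul_left_cancel₀ hw0
      rw [← sq, ← hh, mul_one]
    · change ev2 w ((1, 0) : ℕ × ℕ) ≠ ev2 w ((p - 1, p - 1) : ℕ × ℕ)
      rw [h0, hcu]
      intro hh
      apply hw1
      calc w = w ^ 2 * w := by rw [← hh, one_mul]
        _ = 1 := by rw [← pow_succ, hw3]
  · intro i
    fin_cases i
    · change ev2 w ((1, 0) : ℕ × ℕ) ≠ 0
      rw [h0]; exact one_ne_zero
    · change ev2 w ((0, 1) : ℕ × ℕ) ≠ 0
      rw [h1]; exact hw0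
    · change ev2 w ((p - 1, p - 1) : ℕ × ℕ) ≠ 0
      rw [hcu]; exact pow_ne_zero 2 hw0

lemma char13 {K : Type} [Field K] (h13 : (13 : K) = 0) :
    (1 : K) ≠ 3 ∧ (3 : K) ≠ 9 ∧ (1 : K) ≠ 9 ∧ (3 : K) ≠ 0 ∧ (9 : K) ≠ 0 ∧ (2 : K) ≠ 0 := by
  refine ⟨?_, ?_, ?_, ?_, ?_, ?_⟩ <;> intro hh <;> apply one_ne_zero (α := K)
  · linear_combination h13 + 6 * hh
  · linear_combination h13 + 2 * hh
  · linear_combination 5 * h13 + 8 * hh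
  · linear_combination h13 - 4 * hh
  · linear_combination (-2) * h13 + 3 * hh
  · linear_combination h13 - 6 * hh

lemma two_pow {K : Type} [Field K] (h13 : (13 : K) = 0) : (2 : K) ^ 12 = 1 := by
  linear_combination 315 * h13

lemma FKField.f169 : FKField (13 ^ 2) := by
  obtain ⟨K, _, _, hK, hpK⟩ := exists_field 13 2 (by norm_num) (by norm_num)
  have h13 : (13 : K) = 0 := by exact_mod_cast hpK
  obtain ⟨c1, c2, c3, c4, c5, c6⟩ := char13 h13
  obtain ⟨θ, hθ⟩ := exists_root (K := K) (n := 2) (e := 84) (by norm_num) (by norm_num)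
    (by rw [hK]; norm_num) c6
    (by rw [show 84 = 12 * 7 by norm_num, pow_mul, two_pow h13, one_pow])
  refine FKField.of_modelOK (mul2 13 2 0) (sub2 13) (1, 0) (ev2 θ) (ev2_mul hpK ?_)
    (ev2_sub hpK (by norm_num)) (by simp [ev2])
    ![(0, 0), (1, 0), (0, 1), (3, 1), (0, 2), (1, 5), (6, 10)]
    ![(1, 0), (3, 0), (9, 0)] ?_ ?_ hK (by norm_num) (by norm_num) (by decide +kernel)
  · rw [hθ]; norm_num
  · apply injective_three <;> simp [ev2] <;> assumption
  · intro i
    fin_cases i <;> simp [ev2] <;> assumption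

lemma FKField.f2197 : FKField (13 ^ 3) := by
  obtain ⟨K, _, _, hK, hpK⟩ := exists_field 13 3 (by norm_num) (by norm_num)
  have h13 : (13 : K) = 0 := by exact_mod_cast hpK
  obtain ⟨c1, c2, c3, c4, c5, c6⟩ := char13 h13
  obtain ⟨θ, hθ⟩ := exists_root (K := K) (n := 3) (e := 732) (by norm_num) (by norm_num)
    (by rw [hK]; norm_num) c6
    (by rw [show 732 = 12 * 61 by norm_num, pow_mul, two_pow h13, one_pow])
  refine FKField.of_modelOK (mul3 13 2) (sub3 13) (1, 0, 0) (ev3 θ) (ev3_mul hpK ?_)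
    (ev3_sub hpK (by norm_num)) (by simp [ev3])
    ![(0, 0, 0), (1, 0, 0), (0, 0, 1), (0, 1, 1), (1, 0, 1), (3, 3, 4), (1, 2, 3)]
    ![(1, 0, 0), (3, 0, 0), (9, 0, 0)] ?_ ?_ hK (by norm_num) (by norm_num) (by decide +kernel)
  · rw [hθ]; norm_num
  · apply injective_three <;> simp [ev3] <;> assumption
  · intro i
    fin_cases i <;> simp [ev3] <;> assumption

lemma FKField.sq {p : ℕ} (hp : p.Prime) (h5 : p % 6 = 5) : FKField (p ^ 2) := by
  have h6 : p ^ 2 % 6 = 1 := by rw [Nat.pow_mod, h5]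
  by_cases hl : 6000 ≤ p ^ 2
  · obtain ⟨K, _, _, hK, -⟩ := exists_field p 2 hp (by norm_num)
    have := FKField.of_large K (by rw [hK]; exact h6) (by rw [hK]; exact hl)
    rwa [hK] at this
  · have hp77 : p < 78 := by nlinarith
    have hlt : p ^ 2 < 2 ^ 13 := by omega
    have hcases : p = 5 ∨ p = 11 ∨ p = 17 ∨ p = 23 ∨ p = 29 ∨ p = 41 ∨ p = 47 ∨ p = 53 ∨
        p = 59 ∨ p = 71 := by
      clear hl hlt h6
      interval_cases p <;> first | omega | (exfalso; revert hp; norm_num)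
    rcases hcases with rfl | rfl | rfl | rfl | rfl | rfl | rfl | rfl | rfl | rfl
    · exact FKField.sq_of_model hp h6 hlt
        ![(0, 0), (1, 0), (0, 1), (1, 1), (2, 2), (0, 2), (3, 2)] (by decide +kernel)
    · exact FKField.sq_of_model hp h6 hlt
        ![(0, 0), (1, 0), (0, 1), (1, 1), (2, 2), (0, 2), (3, 2)] (by decide +kernel)
    · exact FKField.sq_of_model hp h6 hlt
        ![(0, 0), (1, 0), (0, 1), (2, 3), (3, 3), (1, 6), (8, 2)] (by decide +kernel)
    · exact FKField.sq_of_model hp h6 hlt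
        ![(0, 0), (1, 0), (0, 1), (1, 1), (2, 2), (0, 2), (3, 2)] (by decide +kernel)
    · exact FKField.sq_of_model hp h6 hlt
        ![(0, 0), (1, 0), (0, 1), (1, 1), (2, 2), (0, 2), (1, 2)] (by decide +kernel)
    · exact FKField.sq_of_model hp h6 hlt
        ![(0, 0), (1, 0), (0, 1), (1, 1), (2, 2), (0, 2), (1, 2)] (by decide +kernel)
    · exact FKField.sq_of_model hp h6 hlt
        ![(0, 0), (1, 0), (0, 1), (1, 1), (0, 2), (2, 0), (3, 1)] (by decide +kernel)
    · exact FKField.sq_of_model hp h6 hlt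
        ![(0, 0), (1, 0), (0, 1), (2, 3), (3, 3), (4, 6), (11, 2)] (by decide +kernel)
    · exact FKField.sq_of_model hp h6 hlt
        ![(0, 0), (1, 0), (0, 1), (1, 1), (0, 2), (2, 0), (6, 5)] (by decide +kernel)
    · exact FKField.sq_of_model hp h6 hlt
        ![(0, 0), (1, 0), (0, 1), (3, 5), (4, 4), (7, 3), (15, 18)] (by decide +kernel)

end Extensions

section Assembly

lemma FKGood.mul_pow {v q : ℕ} (hv : FKGood v) (hq : FKField q) (n : ℕ) :
    FKGood (v * q ^ n) := by
  induction n with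
  | zero => simpa using hv
  | succ n ih => rw [pow_succ, ← mul_assoc]; exact ih.mul_field hq

lemma FKGood.mul_prime_pow {v p a : ℕ} (hv : FKGood v) (hp : p.Prime) (ha : 1 ≤ a)
    (h6 : p ^ a % 6 = 1) (h13 : p ^ a ≠ 13) : FKGood (v * p ^ a) := by
  by_cases h1 : p % 6 = 1
  · by_cases hp13 : p = 13
    · subst hp13
      have ha2 : a ≠ 1 := by rintro rfl; simp at h13
      rcases Nat.even_or_odd a with ⟨k, hk⟩ | ⟨k, hk⟩
      · rw [hk, ← two_mul, pow_mul]
        exact hv.mul_pow FKField.f169 k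
      · obtain ⟨m, rfl⟩ : ∃ m, k = m + 1 := ⟨k - 1, by omega⟩
        have e : v * 13 ^ a = v * (13 ^ 2) ^ m * 13 ^ 3 := by
          rw [hk, ← pow_mul, mul_assoc, ← pow_add]; congr 2
        rw [e]
        exact (hv.mul_pow FKField.f169 m).mul_field FKField.f2197
    · exact hv.mul_pow (FKField.prime hp h1 hp13) a
  · have h5 : p % 6 = 5 := by
      obtain ⟨b, rfl⟩ : ∃ b, a = b + 1 := ⟨a - 1, by omega⟩
      have h2 : ¬ 2 ∣ p := fun hd => by
        have := hd.trans (dvd_pow_self p (b.add_one_ne_zero)); omega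
      have h3 : ¬ 3 ∣ p := fun hd => by
        have := hd.trans (dvd_pow_self p (b.add_one_ne_zero)); omega
      omega
    rcases Nat.even_or_odd a with ⟨k, hk⟩ | ⟨k, hk⟩
    · rw [hk, ← two_mul, pow_mul]
      exact hv.mul_pow (FKField.sq hp h5) k
    · exfalso
      rw [hk, pow_succ, pow_mul, Nat.mul_mod, Nat.pow_mod, Nat.pow_mod p 2, h5] at h6
      norm_num at h6

lemma FKGood.main : ∀ v : ℕ, 0 < v →
    (∀ p a : ℕ, p.Prime → 1 ≤ a → p ^ a ∣ v → ¬ p ^ (a + 1) ∣ v →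
      p ^ a % 6 = 1 ∧ p ^ a ≠ 13) → FKGood v := by
  intro v
  induction v using Nat.strong_induction_on with
  | _ v ih =>
    intro hv h
    by_cases hv1 : v = 1
    · rw [hv1]; exact FKGood.one
    set p := v.minFac with hpd
    have hp : p.Prime := Nat.minFac_prime hv1
    obtain ⟨a, u, hpu, hvu⟩ := Nat.exists_eq_pow_mul_and_not_dvd hv.ne' p hp.ne_one
    have hu : 0 < u := Nat.pos_of_ne_zero (by rintro rfl; simp at hpu)
    have ha : 1 ≤ a := by
      rcases Nat.eq_zero_or_pos a with h0 | h0
      · exfalso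
        rw [h0, pow_zero, one_mul] at hvu
        rw [← hvu] at hpu
        exact hpu (Nat.minFac_dvd v)
      · exact h0
    obtain ⟨h6, h13⟩ := h p a hp ha ⟨u, hvu⟩ (by
      rw [hvu, pow_succ]
      intro hd
      exact hpu (Nat.dvd_of_mul_dvd_mul_left (pow_pos hp.pos a) hd))
    have hpa : 1 < p ^ a := Nat.one_lt_pow (by omega) hp.one_lt
    have hlt : u < v := by rw [hvu]; nlinarith
    have hgu : FKGood u := by
      refine ih u hlt hu ?_
      intro r b hr hb hd hnd
      have hrp : r ≠ p := by
        rintro rfl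
        exact hpu ((dvd_pow_self _ (by omega)).trans hd)
      refine h r b hr hb (by rw [hvu]; exact hd.mul_left _) ?_
      intro hd2
      rw [hvu] at hd2
      have hcop : Nat.Coprime (r ^ (b + 1)) (p ^ a) :=
        Nat.Coprime.pow _ _ ((Nat.coprime_primes hr hp).2 hrp)
      exact hnd (hcop.dvd_of_dvd_mul_left hd2)
    rw [hvu, mul_comm]
    exact hgu.mul_prime_pow hp ha h6 h13

end Assembly

/-- If every maximal prime-power factor of `v` is `≡ 1 (mod 6)` and `≠ 13`,
then there is a finite additive group `G` of order `v` and a `G`-regular `FK(v)`. -/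
theorem exists_regular_FK_of_maximal_prime_power_factors
    (v : ℕ) (hv : 0 < v)
    (h : ∀ p a : ℕ, p.Prime → 1 ≤ a → p ^ a ∣ v → ¬ p ^ (a + 1) ∣ v →
      p ^ a % 6 = 1 ∧ p ^ a ≠ 13) :
    ∃ (G : Type) (_ : AddCommGroup G) (_ : Fintype G) (_ : DecidableEq G),
      Fintype.card G = v ∧ ∃ K : Multiset (Fin 7 → Finset G), IsRegularFK G K := by
  obtain ⟨G, i1, i2, i3, ι, _, B, hG, hB⟩ := FKGood.main v hv h
  exact ⟨G, i1, i2, i3, hG, hB.regular⟩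
end

section
/- For every positive integer t there exists a constant Q(t) such that for every prime power q ≡ 1 (mod 6) with q > Q(t), every t-subset C = {c_1,…,c_t} of F_q, and every t-tuple (γ_1,…,γ_t) ∈ (Z/3Z)^t, the set X = { x ∈ F_q : x − c_i ∈ C_{γ_i}^3 for all i = 1,…,t } is nonempty. -/
open Polynomial

lemma stp_hasse_pow {F : Type} [Field F] (f : F[X]) (N : ℕ) : ∀ s : ℕ, s ≤ N →
    f ^ (N - s) ∣ hasseDeriv s (f ^ N) := by
  induction N with
  | zero => intro s hs; simp at hs; subst hs; simp
  | succ N ih =>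
    intro s hs
    rw [pow_succ, hasseDeriv_mul]
    refine Finset.dvd_sum fun x hx => ?_
    rw [Finset.HasAntidiagonal.mem_antidiagonal] at hx
    rcases Nat.eq_zero_or_pos x.2 with h | h
    · rw [h, hasseDeriv_zero]
      rcases Nat.lt_or_ge N s with h1 | h1
      · have : N + 1 - s = 0 := by omega
        rw [this]; simp
      · have h2 : N + 1 - s = (N - s) + 1 := by omega
        have h3 : x.1 = s := by omega
        rw [h2, pow_succ, h3]
        exact mul_dvd_mul (ih s h1) (by simp)
    · exact ((pow_dvd_pow f (by omega)).trans (ih x.1 (by omega))).mul_right _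

lemma stp_quot {F : Type} [Field F] (f : F[X]) (N s : ℕ) (hs : s ≤ N) :
    ∃ Q : F[X] →ₗ[F] F[X], ∀ k, hasseDeriv s (f ^ N * k) = f ^ (N - s) * Q k := by
  have h : ∀ a : ℕ, ∃ h : F[X], a ≤ N → hasseDeriv a (f ^ N) = f ^ (N - a) * h := by
    intro a
    by_cases ha : a ≤ N
    · obtain ⟨h, hh⟩ := stp_hasse_pow f N a ha
      exact ⟨h, fun _ => hh⟩
    · exact ⟨0, fun h => absurd h ha⟩
  choose h hh using h
  refine ⟨∑ x ∈ Finset.HasAntidiagonal.antidiagonal s,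
    (LinearMap.mulLeft F (h x.1 * f ^ (s - x.1))).comp (hasseDeriv x.2), fun k => ?_⟩
  rw [hasseDeriv_mul, LinearMap.sum_apply, Finset.mul_sum]
  refine Finset.sum_congr rfl fun x hx => ?_
  rw [Finset.HasAntidiagonal.mem_antidiagonal] at hx
  rw [hh x.1 (by omega)]
  have : N - x.1 = (N - s) + (s - x.1) := by omega
  rw [this, pow_add]
  simp only [LinearMap.comp_apply, LinearMap.mulLeft_apply]
  ring

lemma stp_hasse_Xq {F : Type} [Field F] [Fintype F] (P : F[X]) (j s : ℕ)
    (hs : s < Fintype.card F) :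
    hasseDeriv s (P * X ^ (Fintype.card F * j)) = hasseDeriv s P * X ^ (Fintype.card F * j) := by
  induction j with
  | zero => simp
  | succ j ih =>
    rw [Nat.mul_succ, pow_add, ← mul_assoc, hasseDeriv_mul,
      Finset.sum_eq_single (s, 0)]
    · simp [ih, mul_assoc]
    · rintro ⟨a, b⟩ hab hne
      rw [Finset.HasAntidiagonal.mem_antidiagonal] at hab
      simp only at hab
      have hb : b ≠ 0 := by rintro rfl; apply hne; simp at hab; simp [hab]
      obtain ⟨p, hc, n, hp⟩ := FiniteField.card' F
      have hd : p ∣ (Fintype.card F).choose b := by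
        rw [hp.2]
        exact hp.1.dvd_choose_pow hb (by rw [← hp.2]; omega)
      have h0 : (((Fintype.card F).choose b : ℕ) : F) = 0 := (CharP.cast_eq_zero_iff F p _).2 hd
      rw [X_pow_eq_monomial (n := Fintype.card F), hasseDeriv_monomial, h0]
      simp
    · simp

lemma stp_nonzero {F : Type} [Field F] {ι : Type} [Fintype ι] (P : ι → F[X])
    (hne : ∃ i, P i ≠ 0)
    (hd : ∀ i j, P i ≠ 0 → P j ≠ 0 → (P i).natTrailingDegree = (P j).natTrailingDegree → i = j) :
    ∑ i, P i ≠ 0 := by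
  classical
  obtain ⟨i0, hi0⟩ := hne
  obtain ⟨i, hi, hmin⟩ := Finset.exists_min_image (Finset.univ.filter fun i => P i ≠ 0)
    (fun i => (P i).natTrailingDegree) ⟨i0, by simpa using hi0⟩
  simp only [Finset.mem_filter, Finset.mem_univ, true_and] at hi hmin
  intro h0
  have h1 := congrArg (fun p => p.coeff (P i).natTrailingDegree) h0
  simp only [finsetSum_coeff, coeff_zero] at h1
  rw [Finset.sum_eq_single i] at h1
  · exact hi (trailingCoeff_eq_zero.1 h1)
  · intro j _ hj
    by_cases hj0 : P j = 0
    · simp [hj0]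
    · refine coeff_eq_zero_of_lt_natTrailingDegree (lt_of_le_of_ne (hmin j hj0) ?_)
      intro he; exact hj (hd _ _ hj0 hi he.symm)
  · simp

lemma stp_mult {F : Type} [Field F] (R : F[X]) (hR : R ≠ 0) (S : Finset F) (l : ℕ)
    (h : ∀ x ∈ S, ∀ s < l, (hasseDeriv s R).eval x = 0) : l * S.card ≤ R.natDegree := by
  have h1 : ∀ x ∈ S, (X - C x) ^ l ∣ R := by
    intro x hx
    have : X ^ l ∣ taylor x R := by
      rw [X_pow_dvd_iff]
      intro d hd
      rw [taylor_coeff]; exact h x hx d hd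
    obtain ⟨k, hk⟩ := this
    refine ⟨taylor (-x) k, ?_⟩
    have h2 := congrArg (taylor (-x)) hk
    rw [taylor_taylor] at h2
    simp [taylor_mul, taylor_pow] at h2
    rw [h2]; ring
  have h2 : (∏ x ∈ S, (X - C x) ^ l) ∣ R := by
    refine Finset.prod_dvd_of_coprime ?_ h1
    intro x _ y _ hxy
    exact (pairwise_coprime_X_sub_C Function.injective_id hxy).pow
  have h3 := natDegree_le_of_dvd h2 hR
  rw [natDegree_prod_of_monic _ _ (fun x _ => (monic_X_sub_C x).pow l)] at h3
  simpa [mul_comm] using h3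

lemma stp_trailing_pow {F : Type} [Field F] (f : F[X]) (hf : f ≠ 0) (N : ℕ) :
    (f ^ N).natTrailingDegree = N * f.natTrailingDegree := by
  induction N with
  | zero => simp
  | succ N ih => rw [pow_succ, natTrailingDegree_mul (pow_ne_zero _ hf) hf, ih]; ring

lemma stp_linear {F : Type} [Field F] {ι : Type} [Fintype ι] (l D K : ℕ) (hK : 0 < K)
    (T : Fin l → ι → F[X] →ₗ[F] F[X])
    (hT : ∀ s i (k : F[X]), k.natDegree < K → (T s i k).natDegree < D)
    (hD : l * D < Fintype.card ι * K) :
    ∃ v : ι → F[X], (∃ i, v i ≠ 0) ∧ (∀ i, (v i).natDegree < K) ∧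
      ∀ s, ∑ i, T s i (v i) = 0 := by
  let U : Fin l → (ι → degreeLT F K) →ₗ[F] F[X] := fun s =>
    ∑ i, (T s i).comp ((degreeLT F K).subtype.comp (LinearMap.proj i))
  have hU : ∀ s v, U s v = ∑ i, T s i (v i : F[X]) := by
    intro s v; simp only [U, LinearMap.sum_apply]; rfl
  have hvdeg : ∀ p : degreeLT F K, (p : F[X]).natDegree < K := by
    intro p
    by_cases hp : (p : F[X]) = 0
    · rw [hp]; simpa using hK
    · exact (natDegree_lt_iff_degree_lt hp).2 (mem_degreeLT.1 p.2)
  let Φ : (ι → degreeLT F K) →ₗ[F] (Fin l × Fin D → F) :=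
    LinearMap.pi fun sd => (lcoeff F sd.2).comp (U sd.1)
  have : FiniteDimensional F (degreeLT F K) := (degreeLTEquiv F K).symm.finiteDimensional
  have hfr : Module.finrank F (Fin l × Fin D → F) <
      Module.finrank F (ι → degreeLT F K) := by
    have h1 : Module.finrank F (degreeLT F K) = K := by
      rw [(degreeLTEquiv F K).finrank_eq]; simp
    have h2 : Module.finrank F (ι → degreeLT F K) = Fintype.card ι * K := by
      rw [Module.finrank_pi_fintype]; simp [h1]
    rw [h2, Module.finrank_fintype_fun_eq_card]
    simpa only [Fintype.card_prod, Fintype.card_fin] using hD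
  have hker := LinearMap.ker_ne_bot_of_finrank_lt (f := Φ) hfr
  obtain ⟨v, hvk, hv0⟩ := (Submodule.ne_bot_iff _).1 hker
  refine ⟨fun i => v i, ?_, fun i => hvdeg _, ?_⟩
  · by_contra hcon
    push Not at hcon
    exact hv0 (funext fun i => Subtype.ext (hcon i))
  · intro s
    rw [← hU]
    ext d
    by_cases hd : d < D
    · exact congrFun (LinearMap.mem_ker.1 hvk) (s, ⟨d, hd⟩)
    · rw [hU, finsetSum_coeff, coeff_zero]
      refine Finset.sum_eq_zero fun i _ => ?_
      exact coeff_eq_zero_of_natDegree_lt (lt_of_lt_of_le (hT s i _ (hvdeg _)) (not_lt.1 hd))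

set_option maxHeartbeats 1000000 in
lemma stp_core {F : Type} [Field F] [Fintype F] [DecidableEq F] (n L m a : ℕ)
    (hq : Fintype.card F = 3 * n + 1)
    (ha : a = 1 ∨ a = 2) (g f : F[X]) (hg : g.coeff 0 ≠ 0) (hf : f = X ^ a * g)
    (hm : f.natDegree ≤ m) (hL : 0 < L)
    (hn : (L + 1) ^ 2 + 3 * L ^ 2 * m + 3 * L < n) (θ : F) :
    3 * L * (Finset.univ.filter fun x => (f.eval x) ^ n = θ).card ≤ (L + m + 1) * (3 * n + 1) := by
  have hLn : L + 1 < n := by nlinarith [Nat.zero_le (3 * L ^ 2 * m)]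
  have hf0 : f ≠ 0 := by
    rw [hf]; refine mul_ne_zero (pow_ne_zero _ X_ne_zero) ?_
    rintro rfl; simp at hg
  set K := n - (L + 1) with hK
  set l := 3 * L with hl
  set D := K + (L + 1) + l * m with hD
  have hQ : ∀ (s : Fin l) (i : Fin 3), ∃ Q : F[X] →ₗ[F] F[X], ∀ k,
      hasseDeriv s (f ^ (l + i * n) * k) = f ^ (l + i * n - s) * Q k := by
    intro s i
    exact stp_quot f _ _ (by have := s.2; omega)
  choose Q hQ using hQ
  have hQdeg : ∀ s i (k : F[X]), k.natDegree < K → (Q s i k).natDegree < K + l * m := by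
    intro s i k hk
    have hs := s.2
    by_cases hz : Q s i k = 0
    · rw [hz]; simp; left; omega
    · have h1 := congrArg natDegree (hQ s i k)
      rw [natDegree_mul (pow_ne_zero _ hf0) hz, natDegree_pow] at h1
      have h2 := natDegree_hasseDeriv_le (f ^ (l + i * n) * k) s
      have h3 := (natDegree_mul_le (p := f ^ (l + i * n)) (q := k))
      rw [natDegree_pow] at h3
      have h4 : (l + i * n) * f.natDegree
          = (l + i * n - s) * f.natDegree + s * f.natDegree := by
        rw [← add_mul]; congr 1; omega
      have h5 : (s : ℕ) * f.natDegree ≤ l * m := Nat.mul_le_mul hs.le hm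
      omega
  have hKpos : 0 < K := by omega
  obtain ⟨v, hvne, hvdeg, hT0⟩ := stp_linear (ι := Fin 3 × Fin (L + 1)) l D K hKpos
    (fun s ij => (LinearMap.mulLeft F (C (θ ^ (ij.1 : ℕ)) * X ^ (ij.2 : ℕ))).comp (Q s ij.1))
    (by
      intro s ij k hk
      have h1 := hQdeg s ij.1 _ hk
      have h2 : (C (θ ^ (ij.1 : ℕ)) * X ^ (ij.2 : ℕ) : F[X]).natDegree ≤ ij.2 :=
        natDegree_C_mul_X_pow_le _ _
      have h3 := natDegree_mul_le (p := (C (θ ^ (ij.1 : ℕ)) * X ^ (ij.2 : ℕ) : F[X]))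
        (q := Q s ij.1 k)
      have h4 := ij.2.2
      rw [LinearMap.comp_apply, LinearMap.mulLeft_apply]
      omega)
    (by
      simp only [Fintype.card_prod, Fintype.card_fin]
      have h3 : n = K + (L + 1) := by omega
      rw [hD, hl]
      have h4 : (L + 1) ^ 2 + 3 * L ^ 2 * m + 3 * L < K + (L + 1) := h3 ▸ hn
      nlinarith)
  simp only [LinearMap.comp_apply, LinearMap.mulLeft_apply] at hT0
  let P : Fin 3 × Fin (L + 1) → F[X] := fun ij =>
    f ^ (l + ij.1 * n) * (v ij) * X ^ (Fintype.card F * ij.2)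
  have hR : ∑ ij, P ij ≠ 0 := by
    have hPne : ∀ ij, P ij ≠ 0 → (v ij) ≠ 0 := by
      intro ij h h'; apply h; simp [P, h']
    apply stp_nonzero
    · obtain ⟨ij, hij⟩ := hvne
      exact ⟨ij, mul_ne_zero (mul_ne_zero (pow_ne_zero _ hf0) hij) (pow_ne_zero _ X_ne_zero)⟩
    · have htd : ∀ ij, P ij ≠ 0 → (P ij).natTrailingDegree =
          (l + ij.1 * n) * a + (v ij).natTrailingDegree + (3 * n + 1) * ij.2 := by
        intro ij h
        have hv := hPne ij h
        have hg0 : g ≠ 0 := by rintro rfl; simp at hg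
        have hgt : g.natTrailingDegree = 0 := natTrailingDegree_eq_zero.2 (Or.inr hg)
        simp only [P]
        rw [natTrailingDegree_mul (mul_ne_zero (pow_ne_zero _ hf0) hv) (pow_ne_zero _ X_ne_zero),
          natTrailingDegree_mul (pow_ne_zero _ hf0) hv, stp_trailing_pow _ hf0, hf,
          natTrailingDegree_mul (pow_ne_zero _ X_ne_zero) hg0, hgt, hq]
        simp
      intro x y hx hy hxy
      rw [htd x hx, htd y hy] at hxy
      have bx := (natTrailingDegree_le_natDegree (v x)).trans_lt (hvdeg x)
      have bY := (natTrailingDegree_le_natDegree (v y)).trans_lt (hvdeg y)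
      obtain ⟨⟨x1, hx1⟩, ⟨x2, hx2⟩⟩ := x
      obtain ⟨⟨y1, hy1⟩, ⟨y2, hy2⟩⟩ := y
      simp only at hxy bx bY
      generalize (v (⟨x1, hx1⟩, ⟨x2, hx2⟩)).natTrailingDegree = A at *
      generalize (v (⟨y1, hy1⟩, ⟨y2, hy2⟩)).natTrailingDegree = B at *
      have e1 : n * (x1 * a + 3 * x2) + (A + x2) = n * (y1 * a + 3 * y2) + (B + y2) := by
        nlinarith
      have e2 : x1 * a + 3 * x2 = y1 * a + 3 * y2 := by
        have h1 : (n * (x1 * a + 3 * x2) + (A + x2)) / n = x1 * a + 3 * x2 := by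
          rw [Nat.mul_add_div (by omega), Nat.div_eq_of_lt (by omega), add_zero]
        have h2 : (n * (y1 * a + 3 * y2) + (B + y2)) / n = y1 * a + 3 * y2 := by
          rw [Nat.mul_add_div (by omega), Nat.div_eq_of_lt (by omega), add_zero]
        rw [← h1, ← h2, e1]
      simp only [Prod.mk.injEq, Fin.mk.injEq]
      rcases ha with rfl | rfl <;> omega
  have key := stp_mult (∑ ij, P ij) hR (Finset.univ.filter fun x => (f.eval x) ^ n = θ) l (by
    intro x hx s hs
    simp only [Finset.mem_filter, Finset.mem_univ, true_and] at hx
    have h1 : hasseDeriv s (∑ ij, P ij) = ∑ ij : Fin 3 × Fin (L + 1),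
        f ^ (l + ij.1 * n - s) * Q ⟨s, hs⟩ ij.1 (v ij) * X ^ (Fintype.card F * ij.2) := by
      rw [map_sum]
      refine Finset.sum_congr rfl fun ij _ => ?_
      simp only [P]
      rw [stp_hasse_Xq _ _ _ (by omega)]
      exact congrArg (· * _) (hQ ⟨s, hs⟩ ij.1 (v ij))
    have h2 := congrArg (fun p => (f.eval x) ^ (l - s) * eval x p) (hT0 ⟨s, hs⟩)
    simp only [eval_zero, mul_zero, eval_finsetSum, Finset.mul_sum] at h2
    rw [h1, eval_finsetSum, ← h2]
    refine Finset.sum_congr rfl fun ij _ => ?_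
    have h3 : l + (ij.1 : ℕ) * n - s = (l - s) + n * ij.1 := by rw [mul_comm n]; omega
    simp only [eval_mul, eval_pow, eval_X, eval_C]
    rw [h3, pow_add, pow_mul, hx, pow_mul, FiniteField.pow_card]
    ring)
  have hdeg : (∑ ij, P ij).natDegree ≤ (L + m + 1) * (3 * n + 1) := by
    apply natDegree_sum_le_of_forall_le
    intro ij _
    have d1 : (P ij).natDegree ≤ _ := natDegree_mul_le (p := f ^ (l + ij.1 * n) * (v ij))
      (q := X ^ (Fintype.card F * ij.2))
    have d2 := natDegree_mul_le (p := f ^ (l + ij.1 * n)) (q := (v ij))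
    have d3 := hvdeg ij
    rw [natDegree_pow] at d2
    rw [natDegree_X_pow, hq] at d1
    have d4 : (l + ij.1 * n) * f.natDegree ≤ (l + 2 * n) * m := by
      refine Nat.mul_le_mul ?_ hm
      have h2 : (ij.1 : ℕ) ≤ 2 := by omega
      have := Nat.mul_le_mul_right n h2
      omega
    have d5 : (3 * n + 1) * (ij.2 : ℕ) ≤ (3 * n + 1) * L := Nat.mul_le_mul le_rfl (by omega)
    have d6 : (l + 2 * n) * m ≤ (3 * n) * m := Nat.mul_le_mul (by omega) le_rfl
    have d7 : (L + m + 1) * (3 * n + 1) = (3 * n + 1) * L + 3 * n * m + m + 3 * n + 1 := by ring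
    rw [d7]
    omega
  exact key.trans hdeg

lemma stp_count {F : Type} [Field F] [Fintype F] [DecidableEq F] (n L t : ℕ)
    (hq : Fintype.card F = 3 * n + 1) (hL : 0 < L)
    (hn : (L + 1) ^ 2 + 3 * L ^ 2 * (2 * t) + 3 * L < n) (c : Fin t → F)
    (hc : Function.Injective c) (a : Fin t → ZMod 3) (ha : a ≠ 0) (θ : F) :
    3 * L * (Finset.univ.filter fun x => (∏ i, (x - c i) ^ (a i).val) ^ n = θ).card
      ≤ (L + 2 * t + 1) * (3 * n + 1) := by
  obtain ⟨i0, hi0⟩ := Function.ne_iff.1 ha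
  have hval : ∀ z : ZMod 3, z ≠ 0 → z.val = 1 ∨ z.val = 2 := by decide
  have hval2 : ∀ z : ZMod 3, z.val ≤ 2 := by decide
  let f : F[X] := ∏ i, (X - C (c i - c i0)) ^ (a i).val
  let g : F[X] := ∏ i ∈ Finset.univ.erase i0, (X - C (c i - c i0)) ^ (a i).val
  have hf : f = X ^ (a i0).val * g := by
    simp only [f, g]
    rw [← Finset.mul_prod_erase _ _ (Finset.mem_univ i0)]
    simp
  have hg : g.coeff 0 ≠ 0 := by
    rw [coeff_zero_eq_eval_zero, eval_prod, Finset.prod_ne_zero_iff]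
    intro i hi
    have : c i ≠ c i0 := fun h => (Finset.mem_erase.1 hi).1 (hc h)
    simp only [eval_pow, eval_sub, eval_X, eval_C]
    refine pow_ne_zero _ ?_
    rw [zero_sub, neg_ne_zero]
    exact sub_ne_zero.2 this
  have hm : f.natDegree ≤ 2 * t := by
    refine (natDegree_prod_le _ _).trans ?_
    refine (Finset.sum_le_card_nsmul _ _ 2 ?_).trans (by simp [mul_comm])
    intro i _
    rw [natDegree_pow, natDegree_X_sub_C, mul_one]
    exact hval2 _
  have h := stp_core n L (2 * t) _ hq (hval _ hi0) g f hg hf hm hL hn θ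
  convert h using 2
  refine Finset.card_equiv (Equiv.subRight (c i0)) fun x => ?_
  simp [f, eval_prod]

lemma stp_cube {F : Type} [Field F] [Fintype F] (n : ℕ) (hn : 0 < n)
    (hq : Fintype.card F = 3 * n + 1) (y : F) (hy : y ≠ 0) (h : y ^ n = 1) :
    ∃ e : F, e ≠ 0 ∧ y = e ^ 3 := by
  classical
  obtain ⟨g, hg⟩ := IsCyclic.exists_generator (α := Fˣ)
  have ho : orderOf g = 3 * n := by
    rw [orderOf_eq_card_of_forall_mem_zpowers hg, Nat.card_eq_fintype_card, Fintype.card_units, hq]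
    rfl
  obtain ⟨k, hk⟩ := (mem_powers_iff_mem_zpowers.2 (hg (Units.mk0 y hy)))
  simp only at hk
  have h1 : g ^ (k * n) = 1 := by
    rw [pow_mul, hk]; ext; simpa using h
  have h2 := orderOf_dvd_of_pow_eq_one h1
  rw [ho] at h2
  obtain ⟨r, rfl⟩ := Nat.dvd_of_mul_dvd_mul_right hn h2
  refine ⟨((g ^ r : Fˣ) : F), Units.ne_zero _, ?_⟩
  have := congrArg (fun z : Fˣ => (z : F)) hk
  simp only [Units.val_mk0] at this
  rw [← this, mul_comm, pow_mul]; simp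

lemma stp_dual (t : ℕ) (v : Fin t → ZMod 3) (hv : v ≠ 0) :
    3 * (Finset.univ.filter fun a : Fin t → ZMod 3 => ∑ i, a i * v i ≠ 0).card = 2 * 3 ^ t := by
  classical
  obtain ⟨i0, hi0⟩ := Function.ne_iff.1 hv
  have shift : ∀ s : ZMod 3, (Finset.univ.filter fun a : Fin t → ZMod 3 => ∑ i, a i * v i = s).card
      = (Finset.univ.filter fun a : Fin t → ZMod 3 => ∑ i, a i * v i = s + v i0).card := by
    intro s
    refine Finset.card_equiv (Equiv.addRight (Pi.single i0 1)) fun a => ?_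
    simp [add_mul, Finset.sum_add_distrib, Pi.single_apply]
  have h1 := shift 0
  have h2 := shift (0 + v i0)
  have tot := Finset.card_eq_sum_card_fiberwise (s := (Finset.univ : Finset (Fin t → ZMod 3)))
    (t := (Finset.univ : Finset (ZMod 3))) (f := fun a => ∑ i, a i * v i) (by simp)
  have hsum : ∀ (N : ZMod 3 → ℕ) (z : ZMod 3), z ≠ 0 →
      ∑ b, N b = N 0 + N (0 + z) + N (0 + z + z) := by
    intro N z hz
    have hz' : z = 1 ∨ z = 2 := by revert z; decide
    have e : ∑ b, N b = N 0 + N 1 + N 2 := Fin.sum_univ_three N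
    rcases hz' with rfl | rfl
    · rw [e]; rfl
    · rw [e]
      have e1 : (0 + 2 : ZMod 3) = 2 := by decide
      have e2 : (0 + 2 + 2 : ZMod 3) = 1 := by decide
      rw [e2, e1]; ring
  rw [hsum _ (v i0) hi0] at tot
  have hcomp := Finset.card_filter_add_card_filter_not (s := (Finset.univ : Finset (Fin t → ZMod 3)))
    (fun a => ∑ i, a i * v i = 0)
  simp only [Finset.card_univ, Fintype.card_fun, ZMod.card, Fintype.card_fin] at tot hcomp
  simp only [ne_eq]
  omega

theorem exists_bound_for_cyclotomic_conditions (t : ℕ) (ht : 0 < t) :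
    ∃ Q : ℕ, ∀ q : ℕ, IsPrimePow q → q % 6 = 1 → q > Q →
      ∀ (F : Type) [Field F] [Fintype F], Fintype.card F = q →
        ∀ c : Fin t → F, Function.Injective c →
          ∀ u : F, u ≠ 0 → (¬ ∃ d : F, u = d ^ 3) →
            ∀ γ : Fin t → ZMod 3,
              ∃ x : F, ∀ i : Fin t, ∃ e : F, e ≠ 0 ∧ x - c i = u ^ (γ i).val * e ^ 3 := by
  classical
  obtain ⟨L, hLdef⟩ : ∃ L, L = 2 * 3 ^ t * (2 * t + 1) := ⟨_, rfl⟩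
  have hL : 0 < L := by rw [hLdef]; positivity
  refine ⟨3 * ((L + 1) ^ 2 + 3 * L ^ 2 * (2 * t) + 3 * L) + 3 + 2 * 3 ^ t * t, ?_⟩
  intro q _ hq6 hqQ F _ _ hcard c hc u hu hcube γ
  obtain ⟨n, hn⟩ : ∃ n, q = 3 * n + 1 := ⟨q / 3, by omega⟩
  have hqn : Fintype.card F = 3 * n + 1 := hcard.trans hn
  have hnbig : (L + 1) ^ 2 + 3 * L ^ 2 * (2 * t) + 3 * L < n := by omega
  have hn0 : 0 < n := by omega
  have hqt : 2 * 3 ^ t * t < q := by omega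
  have hpow : ∀ y : F, y ≠ 0 → (y ^ n) ^ 3 = 1 := by
    intro y hy
    rw [← pow_mul, mul_comm]
    have := FiniteField.pow_card_sub_one_eq_one y hy
    rwa [hqn, Nat.add_sub_cancel] at this
  obtain ⟨w, hw⟩ : ∃ w, w = u ^ n := ⟨_, rfl⟩
  have hw3 : w ^ 3 = 1 := by rw [hw]; exact hpow u hu
  have hw1 : w ≠ 1 := by
    intro h
    obtain ⟨e, _, he⟩ := stp_cube n hn0 hqn u hu (hw ▸ h)
    exact hcube ⟨e, he⟩
  have hprim : IsPrimitiveRoot w 3 := by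
    have := orderOf_eq_prime hw3 hw1
    exact this ▸ IsPrimitiveRoot.orderOf w
  have hlog : ∀ y : F, ∃ s : ZMod 3, y ≠ 0 → y ^ n = w ^ s.val := by
    intro y
    by_cases hy : y = 0
    · exact ⟨0, fun h => absurd hy h⟩
    · obtain ⟨i, hi, h⟩ := hprim.eq_pow_of_pow_eq_one (hpow y hy)
      refine ⟨(i : ZMod 3), fun _ => ?_⟩
      rw [ZMod.val_natCast, Nat.mod_eq_of_lt hi, h]
  choose lg hlg using hlog
  have hwval : ∀ k : ℕ, w ^ k = w ^ ((k : ZMod 3)).val := by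
    intro k
    rw [ZMod.val_natCast]
    exact pow_eq_pow_mod k hw3
  by_contra hcon
  push Not at hcon
  -- the points under consideration
  let S : Finset F := Finset.univ.filter fun x => ∀ i, x - c i ≠ 0
  have hS : q ≤ S.card + t := by
    have h1 : (Finset.univ : Finset F) ⊆ S ∪ Finset.univ.image c := by
      intro x _
      by_cases h : ∀ i, x - c i ≠ 0
      · exact Finset.mem_union_left _ (by simpa [S] using h)
      · push Not at h
        obtain ⟨i, hi⟩ := h
        exact Finset.mem_union_right _
          (Finset.mem_image.2 ⟨i, Finset.mem_univ _, (sub_eq_zero.1 hi).symm⟩)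
    have h2 := (Finset.card_le_card h1).trans (Finset.card_union_le _ _)
    have h3 : (Finset.univ.image c).card ≤ t := by
      simpa using Finset.card_image_le (s := Finset.univ) (f := c)
    rw [Finset.card_univ, hcard] at h2
    omega
  have hSne : ∀ x ∈ S, (fun i => lg (x - c i) - γ i) ≠ 0 := by
    intro x hx h0
    obtain ⟨i, hi⟩ := hcon x
    have hxi : x - c i ≠ 0 := (Finset.mem_filter.1 hx).2 i
    have h1 : lg (x - c i) = γ i := sub_eq_zero.1 (congrFun h0 i)
    have h2 := hlg _ hxi
    have hug : u ^ (γ i).val ≠ 0 := pow_ne_zero _ hu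
    obtain ⟨e, he, h⟩ := stp_cube n hn0 hqn ((x - c i) / u ^ (γ i).val) (div_ne_zero hxi hug) (by
      rw [div_pow, h2, h1, hw, ← pow_mul, ← pow_mul, mul_comm]
      exact div_self (pow_ne_zero _ hu))
    refine hi e he ?_
    rw [← h, mul_div_cancel₀ _ hug]
  -- double counting
  let r : (Fin t → ZMod 3) → F → Prop := fun a x => ∑ i, a i * (lg (x - c i) - γ i) ≠ 0
  have hdc := Finset.sum_card_bipartiteAbove_eq_sum_card_bipartiteBelow
    (s := (Finset.univ : Finset (Fin t → ZMod 3))) (t := S) r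
  have hright : 3 * ∑ x ∈ S, (Finset.univ.bipartiteBelow r x).card = S.card * (2 * 3 ^ t) := by
    have h1 : ∀ x ∈ S, 3 * (Finset.univ.bipartiteBelow r x).card = 2 * 3 ^ t := by
      intro x hx
      rw [← stp_dual t _ (hSne x hx)]
      simp only [Finset.bipartiteBelow, r]
    rw [Finset.mul_sum, Finset.sum_congr rfl h1]
    simp
  have hleft : ∀ a : Fin t → ZMod 3, a ≠ 0 →
      3 * L * (S.bipartiteAbove r a).card ≤ 2 * ((L + 2 * t + 1) * (3 * n + 1)) := by
    intro a ha
    let N : ZMod 3 → Finset F := fun s =>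
      Finset.univ.filter fun x => (∏ i, (x - c i) ^ (a i).val) ^ n = w ^ s.val
    obtain ⟨d, hd⟩ : ∃ d, d = ∑ i, a i * γ i := ⟨_, rfl⟩
    have hsub : S.bipartiteAbove r a ⊆ N (d + 1) ∪ N (d + 2) := by
      intro x hx
      obtain ⟨hxS, hxr⟩ := Finset.mem_filter.1 hx
      have hval : (∏ i, (x - c i) ^ (a i).val) ^ n = w ^ (∑ i, a i * lg (x - c i)).val := by
        rw [← Finset.prod_pow]
        have : ∀ i ∈ (Finset.univ : Finset (Fin t)), ((x - c i) ^ (a i).val) ^ n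
            = w ^ ((a i).val * (lg (x - c i)).val) := by
          intro i _
          rw [← pow_mul, mul_comm, pow_mul, hlg _ ((Finset.mem_filter.1 hxS).2 i), ← pow_mul,
            mul_comm]
        rw [Finset.prod_congr rfl this, Finset.prod_pow_eq_pow_sum, hwval]
        congr 2
        push_cast
        simp
      have hne : ∑ i, a i * lg (x - c i) ≠ d := by
        intro h
        apply hxr
        simp only [mul_sub, Finset.sum_sub_distrib, h, ← hd, sub_self]
      have htri : ∀ z d : ZMod 3, z ≠ d → z = d + 1 ∨ z = d + 2 := by decide
      rw [Finset.mem_union]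
      rcases htri _ _ hne with h | h
      · left; simp only [N, Finset.mem_filter, Finset.mem_univ, true_and]; rw [hval, h]
      · right; simp only [N, Finset.mem_filter, Finset.mem_univ, true_and]; rw [hval, h]
    have h1 := (Finset.card_le_card hsub).trans (Finset.card_union_le _ _)
    have h2 := stp_count n L t hqn hL hnbig c hc a ha (w ^ (d + 1).val)
    have h3 := stp_count n L t hqn hL hnbig c hc a ha (w ^ (d + 2).val)
    have h4 := Nat.mul_le_mul_left (3 * L) h1
    rw [mul_add] at h4
    simp only [N] at h4
    omega
  have hzero : (S.bipartiteAbove r 0).card = 0 := by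
    rw [Finset.card_eq_zero]
    ext x
    simp [Finset.bipartiteAbove, r]
  have hsum : 3 * L * ∑ a, (S.bipartiteAbove r a).card
      ≤ (3 ^ t - 1) * (2 * ((L + 2 * t + 1) * q)) := by
    rw [← Finset.add_sum_erase _ _ (Finset.mem_univ 0), hzero, zero_add, Finset.mul_sum]
    refine (Finset.sum_le_card_nsmul _ _ (2 * ((L + 2 * t + 1) * q)) ?_).trans ?_
    · intro a ha
      rw [hn]
      exact hleft a (Finset.mem_erase.1 ha).1
    · rw [Finset.card_erase_of_mem (Finset.mem_univ _)]
      simp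
  rw [hdc] at hsum
  have hfin : L * (S.card * (2 * 3 ^ t)) ≤ (3 ^ t - 1) * (2 * ((L + 2 * t + 1) * q)) := by
    rw [← hright]
    calc _ = _ := by ring
      _ ≤ _ := hsum
  obtain ⟨T, hT⟩ : ∃ T, 3 ^ t = T + 1 := ⟨3 ^ t - 1, by have : 0 < 3 ^ t := by positivity
                                                        omega⟩
  rw [hT] at hfin hLdef hqt
  rw [Nat.add_sub_cancel] at hfin
  -- L (T+1) s ≤ T (L+M) q with q ≤ s + t and L = 2 (T+1) M
  have e1 : L * (T + 1) * q ≤ L * (T + 1) * (S.card + t) := Nat.mul_le_mul_left _ hS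
  have e2 : L * (T + 1) * S.card ≤ T * (L + 2 * t + 1) * q := by nlinarith
  have e3 : L * q ≤ L * (T + 1) * t + T * (2 * t + 1) * q := by nlinarith
  have e4 : 2 * (T * (2 * t + 1) * q) ≤ L * q := by rw [hLdef]; nlinarith [Nat.zero_le ((2 * t + 1) * q)]
  have e5 : L * q ≤ L * (2 * (T + 1) * t) := by nlinarith
  have e6 := Nat.le_of_mul_le_mul_left e5 hL
  omega
end

section
/- Let m be a positive integer all of whose maximal prime-power factors are at least 43, and let t be an integer with 0 ≤ t ≤ m. If there exist a Fano Kaleidoscope FK(m) and a Fano Kaleidoscope FK(m+6t), then there exists a Fano Kaleidoscope FK(43m+6t). -/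
namespace FKProof

open Finset

/-- `K` is a multiset of colored Fano planes whose color-`i` lines cover exactly once the pairs
`x ≠ y` with `C i x y`, and do not cover the other pairs. -/
def IsPiece {V : Type*} [DecidableEq V] (K : Multiset (Fin 7 → Finset V))
    (C : Fin 7 → V → V → Prop) : Prop :=
  (∀ L ∈ K, IsColoredFano L) ∧ ∀ x y : V, x ≠ y → ∀ i : Fin 7,
    (C i x y → Multiset.countP (fun L => x ∈ L i ∧ y ∈ L i) K = 1) ∧
    (¬ C i x y → Multiset.countP (fun L => x ∈ L i ∧ y ∈ L i) K = 0)

lemma IsPiece.toFK {V : Type*} [DecidableEq V] {K : Multiset (Fin 7 → Finset V)}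
    {C : Fin 7 → V → V → Prop} (h : IsPiece K C) (hC : ∀ i x y, x ≠ y → C i x y) :
    IsFanoKaleidoscope K :=
  ⟨h.1, fun x y hxy i => (h.2 x y hxy i).1 (hC i x y hxy)⟩

lemma IsPiece.ofFK {V : Type*} [DecidableEq V] {K : Multiset (Fin 7 → Finset V)}
    (h : IsFanoKaleidoscope K) : IsPiece K (fun _ _ _ => True) :=
  ⟨h.1, fun x y hxy i => ⟨fun _ => h.2 x y hxy i, fun h => (h trivial).elim⟩⟩

lemma IsPiece.congr {V : Type*} [DecidableEq V] {K : Multiset (Fin 7 → Finset V)}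
    {C C' : Fin 7 → V → V → Prop} (h : IsPiece K C)
    (hC : ∀ i x y, x ≠ y → (C' i x y ↔ C i x y)) : IsPiece K C' :=
  ⟨h.1, fun x y hxy i => by rw [hC i x y hxy]; exact h.2 x y hxy i⟩

lemma coloredFano_image {V W : Type*} [DecidableEq V] [DecidableEq W] (f : W → V)
    (hf : Function.Injective f) (L : Fin 7 → Finset W) (h : IsColoredFano L) :
    IsColoredFano (fun i => (L i).image f) := by
  have hl : linesPts (fun i => (L i).image f) = (linesPts L).image f := by
    ext x
    simp only [linesPts, mem_biUnion, mem_univ, true_and, mem_image]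
    constructor
    · rintro ⟨i, a, ha, rfl⟩
      exact ⟨a, ⟨i, ha⟩, rfl⟩
    · rintro ⟨a, ⟨i, ha⟩, rfl⟩
      exact ⟨i, a, ha, rfl⟩
  refine ⟨?_, ?_, ?_⟩
  · rw [hl, card_image_of_injective _ hf, h.1]
  · intro i
    rw [card_image_of_injective _ hf, h.2.1]
  · intro x y hx hy hxy
    rw [hl, mem_image] at hx hy
    obtain ⟨a, ha, rfl⟩ := hx
    obtain ⟨b, hb, rfl⟩ := hy
    simpa only [hf.mem_finset_image] using h.2.2 a b ha hb (fun e => hxy (by rw [e]))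

lemma IsPiece.transport {V W : Type*} [DecidableEq V] [DecidableEq W] {f : W → V}
    (hf : Function.Injective f) {K : Multiset (Fin 7 → Finset W)}
    {C : Fin 7 → W → W → Prop} (h : IsPiece K C) :
    IsPiece (K.map fun L i => (L i).image f)
      (fun i x y => ∃ a b, f a = x ∧ f b = y ∧ C i a b) := by
  refine ⟨?_, ?_⟩
  · intro L hL
    obtain ⟨L', hL', rfl⟩ := Multiset.mem_map.1 hL
    exact coloredFano_image f hf L' (h.1 L' hL')
  · intro x y hxy i
    rw [Multiset.countP_map, ← Multiset.countP_eq_card_filter]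
    refine ⟨?_, ?_⟩
    · rintro ⟨a, b, rfl, rfl, hc⟩
      simp only [hf.mem_finset_image]
      exact (h.2 a b (fun e => hxy (by rw [e])) i).1 hc
    · intro hn
      by_cases hx : ∃ a b, f a = x ∧ f b = y
      · obtain ⟨a, b, rfl, rfl⟩ := hx
        simp only [hf.mem_finset_image]
        exact (h.2 a b (fun e => hxy (by rw [e])) i).2 (fun hc => hn ⟨a, b, rfl, rfl, hc⟩)
      · rw [Multiset.countP_eq_zero]
        rintro L - ⟨h1, h2⟩
        obtain ⟨a, -, ha⟩ := mem_image.1 h1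
        obtain ⟨b, -, hb⟩ := mem_image.1 h2
        exact hx ⟨a, b, ha, hb⟩

lemma IsPiece.combine {V ι : Type*} [DecidableEq V] [Fintype ι]
    {K : ι → Multiset (Fin 7 → Finset V)} {C : ι → Fin 7 → V → V → Prop}
    (h : ∀ j, IsPiece (K j) (C j)) (D : Fin 7 → V → V → Prop)
    (h1 : ∀ i x y, x ≠ y → D i x y → ∃! j, C j i x y)
    (h0 : ∀ i x y, x ≠ y → ¬ D i x y → ∀ j, ¬ C j i x y) :
    IsPiece (∑ j, K j) D := by
  classical
  refine ⟨?_, ?_⟩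
  · intro L hL
    obtain ⟨j, -, hj⟩ := Multiset.mem_sum.1 hL
    exact (h j).1 L hj
  · intro x y hxy i
    have hs : Multiset.countP (fun L : Fin 7 → Finset V => x ∈ L i ∧ y ∈ L i) (∑ j, K j)
        = ∑ j, Multiset.countP (fun L : Fin 7 → Finset V => x ∈ L i ∧ y ∈ L i) (K j) :=
      map_sum (Multiset.countPAddMonoidHom (fun L : Fin 7 → Finset V => x ∈ L i ∧ y ∈ L i)) _ _
    rw [hs]
    refine ⟨fun hd => ?_, fun hd => ?_⟩
    · obtain ⟨j, hj, hu⟩ := h1 i x y hxy hd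
      rw [Finset.sum_eq_single j]
      · exact ((h j).2 x y hxy i).1 hj
      · intro k _ hk
        exact ((h k).2 x y hxy i).2 (fun hc => hk (hu k hc))
      · intro hc
        exact (hc (mem_univ _)).elim
    · exact Finset.sum_eq_zero fun j _ => ((h j).2 x y hxy i).2 (h0 i x y hxy hd j)

lemma fanoLine_std : IsColoredFano (fanoLine (id : Fin 7 → Fin 7)) := by
  unfold IsColoredFano linesPts fanoLine ExistsUnique
  decide +kernel

lemma coloredFano_fanoLine {V : Type*} [DecidableEq V] (B : Fin 7 → V)
    (hB : Function.Injective B) : IsColoredFano (fanoLine B) := by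
  have := coloredFano_image B hB _ fanoLine_std
  convert this using 1
  funext i
  simp [fanoLine, image_insert]

lemma piece_singleton {V : Type*} [DecidableEq V] (B : Fin 7 → V)
    (hB : Function.Injective B) :
    IsPiece {fanoLine B} (fun i x y => x ∈ fanoLine B i ∧ y ∈ fanoLine B i) := by
  refine ⟨?_, ?_⟩
  · intro L hL
    rw [Multiset.mem_singleton] at hL
    rw [hL]
    exact coloredFano_fanoLine B hB
  · intro x y _ i
    rw [← Multiset.cons_zero, Multiset.countP_cons]
    constructor
    · intro h; simp [h]
    · intro h; simp [h]

/-- Offsets of the points of a line. -/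
def off : Fin 3 → Fin 7 := ![0, 1, 3]

lemma mem_fanoLine {V : Type*} [DecidableEq V] (B : Fin 7 → V) (i : Fin 7) (x : V) :
    x ∈ fanoLine B i ↔ ∃ p, x = B (i + off p) := by
  simp [fanoLine, off, Fin.exists_fin_succ]

/-- Developing a Fano kaleidoscopic difference family. -/
lemma develop {G S : Type*} [AddCommGroup G] [DecidableEq G] [Fintype G] [Fintype S]
    (B : S → Fin 7 → G) (hB : ∀ s, Function.Injective (B s))
    (hd : ∀ i : Fin 7, ∀ d : G, d ≠ 0 → ∃! s : S × Fin 3 × Fin 3,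
      B s.1 (i + off s.2.1) - B s.1 (i + off s.2.2) = d) :
    ∃ K : Multiset (Fin 7 → Finset G), IsFanoKaleidoscope K := by
  refine ⟨_, (IsPiece.combine (ι := G × S)
    (fun j => piece_singleton (fun k => j.1 + B j.2 k)
      (fun a b hab => hB j.2 (add_left_cancel hab))) (fun _ _ _ => True) ?_
        (fun _ _ _ _ h => (h trivial).elim)).toFK (fun _ _ _ _ => trivial)⟩
  intro i x y hxy _
  obtain ⟨⟨s, p, q⟩, h, hu⟩ := hd i (x - y) (sub_ne_zero.2 hxy)
  simp only at h hu
  refine ⟨(x - B s (i + off p), s), ?_, ?_⟩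
  · simp only [mem_fanoLine]
    refine ⟨⟨p, by abel⟩, ⟨q, ?_⟩⟩
    have : y = x - (B s (i + off p) - B s (i + off q)) := by rw [h]; abel
    rw [this]; abel
  · rintro ⟨g, s'⟩ h'
    simp only [mem_fanoLine] at h'
    obtain ⟨⟨p', hp⟩, ⟨q', hq⟩⟩ := h'
    have := hu (s', p', q') (by simp only; rw [hp, hq]; abel)
    simp only [Prod.mk.injEq] at this
    obtain ⟨rfl, rfl, rfl⟩ := this
    rw [Prod.mk.injEq]
    exact ⟨by rw [hp]; abel, rfl⟩

lemma fk7 : ∃ K : Multiset (Fin 7 → Finset (ZMod 7)), IsFanoKaleidoscope K := by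
  refine develop (S := Fin 1) (fun _ (k : Fin 7) => (k : ZMod 7)) ?_ ?_
  · intro s a b h
    exact h
  · unfold ExistsUnique
    change ∀ i : Fin 7, ∀ d : Fin 7, d ≠ 0 → ∃ s : Fin 1 × Fin 3 × Fin 3,
      (((i + off s.2.1) - (i + off s.2.2) : Fin 7) = d) ∧ ∀ y : Fin 1 × Fin 3 × Fin 3,
      (((i + off y.2.1) - (i + off y.2.2) : Fin 7) = d) → y = s
    decide +kernel

/-- Base block over the integers mod 43. -/
def b43 : Fin 7 → Fin 43 := ![0, 1, 2, 7, 8, 37, 38]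

/-- The multipliers (the subgroup of order 7) mod 43. -/
def c43 : Fin 7 → Fin 43 := ![1, 41, 4, 35, 16, 11, 21]

lemma b43_inj : ∀ s a b : Fin 7, c43 s * b43 a = c43 s * b43 b → a = b := by
  decide +kernel

lemma b43_diff : ∀ i : Fin 7, ∀ d : Fin 43, d ≠ 0 → ∃ s : Fin 7 × Fin 3 × Fin 3,
      ((c43 s.1 * b43 (i + off s.2.1)) - (c43 s.1 * b43 (i + off s.2.2)) = d) ∧
      ∀ y : Fin 7 × Fin 3 × Fin 3,
      ((c43 y.1 * b43 (i + off y.2.1)) - (c43 y.1 * b43 (i + off y.2.2)) = d) → y = s := by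
  decide +kernel

lemma fk43 : ∃ K : Multiset (Fin 7 → Finset (ZMod 43)), IsFanoKaleidoscope K :=
  develop (G := ZMod 43) (S := Fin 7)
    (fun s k => (c43 s * b43 k : Fin 43)) (fun s a b h => b43_inj s a b h) b43_diff

lemma fk_equiv {V W : Type*} [DecidableEq V] [DecidableEq W] (e : W ≃ V)
    (h : ∃ K : Multiset (Fin 7 → Finset W), IsFanoKaleidoscope K) :
    ∃ K : Multiset (Fin 7 → Finset V), IsFanoKaleidoscope K := by
  obtain ⟨K, hK⟩ := h
  exact ⟨_, ((IsPiece.ofFK hK).transport e.injective).toFK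
    (fun i x y _ => ⟨e.symm x, e.symm y, by simp⟩)⟩

/-- The affine plane of order 7 minus a line. -/
lemma piece49 : ∃ K : Multiset (Fin 7 → Finset (ZMod 7 × ZMod 7)),
    IsPiece K (fun _ x y => ¬ (x.1 = 0 ∧ y.1 = 0)) := by
  have : Fact (Nat.Prime 7) := ⟨by norm_num⟩
  obtain ⟨K, hK⟩ := fk7
  have hp := IsPiece.ofFK hK
  let f : (ZMod 7 × ZMod 7) ⊕ {c : ZMod 7 // c ≠ 0} → ZMod 7 → ZMod 7 × ZMod 7 :=
    Sum.elim (fun p u => (u, p.1 * u + p.2)) (fun c u => (c.1, u))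
  have hf : ∀ j, Function.Injective (f j) := by
    rintro (j | j) a b h
    · exact (Prod.mk.inj h).1
    · exact (Prod.mk.inj h).2
  refine ⟨_, IsPiece.combine (fun j => hp.transport (hf j)) _ ?_ ?_⟩
  · rintro i ⟨x1, x2⟩ ⟨y1, y2⟩ hxy hn
    by_cases h : x1 = y1
    · subst h
      have hx : x1 ≠ 0 := fun h => hn ⟨h, h⟩
      refine ⟨Sum.inr ⟨x1, hx⟩, ⟨x2, y2, rfl, rfl, trivial⟩, ?_⟩
      rintro (⟨s, c⟩ | c) ⟨a, b, ha, hb, -⟩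
      · simp only [f, Sum.elim_inl, Prod.mk.injEq] at ha hb
        exfalso
        apply hxy
        rw [← ha.2, ← hb.2, ha.1, hb.1]
      · simp only [f, Sum.elim_inr, Prod.mk.injEq] at ha hb
        congr 1
        exact Subtype.ext ha.1
    · have h' : x1 - y1 ≠ 0 := sub_ne_zero.2 h
      refine ⟨Sum.inl ((x2 - y2) / (x1 - y1), x2 - (x2 - y2) / (x1 - y1) * x1), ?_, ?_⟩
      · refine ⟨x1, y1, ?_, ?_, trivial⟩
        · simp only [f, Sum.elim_inl, Prod.mk.injEq, true_and]
          ring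
        · simp only [f, Sum.elim_inl, Prod.mk.injEq, true_and]
          field_simp
          ring
      · rintro (⟨s, c⟩ | c) ⟨a, b, ha, hb, -⟩
        · simp only [f, Sum.elim_inl, Prod.mk.injEq] at ha hb
          obtain ⟨rfl, rfl⟩ := ha
          obtain ⟨rfl, rfl⟩ := hb
          have : (s * a + c - (s * b + c)) / (a - b) = s := by
            field_simp
            ring
          rw [this]
          congr 2
          ring
        · simp only [f, Sum.elim_inr, Prod.mk.injEq] at ha hb
          exact (h (ha.1.symm.trans hb.1)).elim
  · rintro i ⟨x1, x2⟩ ⟨y1, y2⟩ hxy hn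
    rw [not_not] at hn
    obtain ⟨h1, h2⟩ := hn
    simp only at h1 h2
    subst h1 h2
    rintro (⟨s, c⟩ | c) ⟨a, b, ha, hb, -⟩
    · simp only [f, Sum.elim_inl, Prod.mk.injEq] at ha hb
      apply hxy
      rw [← ha.2, ← hb.2, ha.1, hb.1]
    · simp only [f, Sum.elim_inr, Prod.mk.injEq] at ha hb
      exact c.2 ha.1

/-- Fill a block of the weighted transversal design. -/
lemma piece_block (n : ℕ) (hn : n = 1 ∨ n = 7) :
    ∃ K : Multiset (Fin 7 → Finset (Fin 42 ⊕ Fin n)),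
    IsPiece K (fun _ x y => ¬ (x.isRight ∧ y.isRight)) := by
  rcases hn with rfl | rfl
  · have e : ZMod 43 ≃ Fin 42 ⊕ Fin 1 := Fintype.equivOfCardEq (by simp)
    obtain ⟨K, hK⟩ := fk_equiv e fk43
    refine ⟨K, (IsPiece.ofFK hK).congr ?_⟩
    rintro i (x | x) (y | y) hxy
    · simp
    · simp
    · simp
    · exact (hxy (by rw [Subsingleton.elim x y])).elim
  · obtain ⟨K, hK⟩ := piece49
    have e1 : {p : ZMod 7 × ZMod 7 // ¬ p.1 = 0} ≃ Fin 42 :=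
      Fintype.equivOfCardEq (by decide +kernel)
    have e2 : {p : ZMod 7 × ZMod 7 // p.1 = 0} ≃ Fin 7 :=
      Fintype.equivOfCardEq (by decide +kernel)
    let e : Fin 42 ⊕ Fin 7 ≃ ZMod 7 × ZMod 7 :=
      ((Equiv.sumCongr e1.symm e2.symm).trans (Equiv.sumComm _ _)).trans
        (Equiv.sumCompl (fun p : ZMod 7 × ZMod 7 => p.1 = 0))
    have he : ∀ x, (e x).1 = 0 ↔ x.isRight := by
      rintro (x | x)
      · simpa [e] using (e1.symm x).2
      · simp [e, (e2.symm x).2]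
    refine ⟨_, (hK.transport e.symm.injective).congr ?_⟩
    intro i x y hxy
    constructor
    · intro h
      exact ⟨e x, e y, by simp, by simp, by rw [he, he]; exact h⟩
    · rintro ⟨a, b, rfl, rfl, h⟩
      rw [← he, ← he]
      simpa using h

/-- A commutative ring of order `m` with 43 elements whose differences are units. -/
lemma exists_ring (m : ℕ) (hm : 0 < m)
    (hfac : ∀ p a : ℕ, p.Prime → 1 ≤ a → p ^ a ∣ m → ¬ p ^ (a + 1) ∣ m → 43 ≤ p ^ a) :
    ∃ (R : Type) (_ : CommRing R) (_ : Fintype R) (r : Fin 43 → R),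
      Fintype.card R = m ∧ ∀ i j, i ≠ j → IsUnit (r i - r j) := by
  classical
  have hP : ∀ p : m.primeFactors, Fact (p : ℕ).Prime :=
    fun p => ⟨Nat.prime_of_mem_primeFactors p.2⟩
  have hpos : ∀ p : m.primeFactors, m.factorization p ≠ 0 := fun p =>
    Finsupp.mem_support_iff.1 (by simpa using p.2)
  let F : m.primeFactors → Type := fun p => GaloisField (p : ℕ) (m.factorization p)
  have hcard : ∀ p, Nat.card (F p) = (p : ℕ) ^ m.factorization p :=
    fun p => GaloisField.card _ _ (hpos p)
  have : ∀ p, Finite (F p) := fun p => Nat.finite_of_card_ne_zero (by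
    rw [hcard]; exact pow_ne_zero _ (hP p).out.ne_zero)
  have : ∀ p, Fintype (F p) := fun p => Fintype.ofFinite _
  have hemb : ∀ p, Nonempty (Fin 43 ↪ F p) := by
    intro p
    apply Function.Embedding.nonempty_of_card_le
    rw [Fintype.card_fin, ← Nat.card_eq_fintype_card, hcard]
    exact hfac _ _ (hP p).out (Nat.one_le_iff_ne_zero.2 (hpos p)) (Nat.ordProj_dvd m p)
      (Nat.pow_succ_factorization_not_dvd hm.ne' (hP p).out)
  choose r hr using fun p => (⟨(hemb p).some, (hemb p).some.injective⟩ :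
    ∃ r : Fin 43 → F p, Function.Injective r)
  refine ⟨(∀ p, F p), inferInstance, inferInstance, fun i p => r p i, ?_, ?_⟩
  · rw [Fintype.card_pi]
    have : ∀ p, Fintype.card (F p) = (p : ℕ) ^ m.factorization p := fun p => by
      rw [← Nat.card_eq_fintype_card, hcard]
    simp only [this]
    rw [Finset.prod_coe_sort m.primeFactors (fun p => p ^ m.factorization p)]
    exact Nat.prod_factorization_pow_eq_self hm.ne'
  · intro i j hij
    rw [Pi.isUnit_iff]
    intro p
    exact IsUnit.mk0 _ (sub_ne_zero.2 fun h => hij (hr p h))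

/-- Uniqueness of the block through two points in different groups. -/
lemma td_unique {R : Type*} [CommRing R] {u v x y : R} (h : IsUnit (u - v)) :
    ∃! p : R × R, x = p.1 + u * p.2 ∧ y = p.1 + v * p.2 := by
  obtain ⟨w, hw⟩ := h.exists_right_inv
  refine ⟨(x - u * (w * (x - y)), w * (x - y)), ⟨by ring, ?_⟩, ?_⟩
  · linear_combination (x - y) * hw
  · rintro ⟨a, b⟩ ⟨h1, h2⟩
    simp only at h1 h2
    have hb : b = w * (x - y) := by
      rw [h1, h2]
      linear_combination (-b) * hw
    rw [Prod.mk.injEq]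
    refine ⟨?_, hb⟩
    rw [← hb, h1]; ring

end FKProof

/-- if all maximal prime-power factors of `m` are at least 43, `0 ≤ t ≤ m`,
and both FK(m) and FK(m+6t) exist, then FK(43m+6t) exists. -/
theorem exists_FK_43m_plus_6t
    (m t : ℕ) (hm : 0 < m) (ht : t ≤ m)
    (hfac : ∀ p a : ℕ, p.Prime → 1 ≤ a → p ^ a ∣ m → ¬ p ^ (a + 1) ∣ m → 43 ≤ p ^ a)
    (h1 : ExistsFK m) (h2 : ExistsFK (m + 6 * t)) :
    ExistsFK (43 * m + 6 * t) := by
  classical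
  obtain ⟨R, _, _, r, hcard, hr⟩ := FKProof.exists_ring m hm hfac
  obtain ⟨T, -, hT⟩ := Finset.exists_subset_card_eq
    (s := (Finset.univ : Finset R)) (n := t) (by rw [Finset.card_univ, hcard]; exact ht)
  let w : R → ℕ := fun h => if h ∈ T then 7 else 1
  have hw : ∀ h, w h = 1 ∨ w h = 7 := by
    intro h
    by_cases hh : h ∈ T
    · right; simp [w, hh]
    · left; simp [w, hh]
  have hsum : Fintype.card (Σ h : R, Fin (w h)) = m + 6 * t := by
    rw [Fintype.card_sigma]
    have : ∀ h, Fintype.card (Fin (w h)) = 1 + (if h ∈ T then 6 else 0) := by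
      intro h
      by_cases hh : h ∈ T <;> simp [w, hh]
    simp only [this]
    rw [Finset.sum_add_distrib, Finset.sum_ite_mem]
    simp [hcard, hT, mul_comm]
  have hV : Fintype.card ((Fin 42 × R) ⊕ (Σ h : R, Fin (w h))) = 43 * m + 6 * t := by
    rw [Fintype.card_sum, hsum, Fintype.card_prod, hcard, Fintype.card_fin]
    ring
  obtain ⟨K1, hK1⟩ := FKProof.fk_equiv
    (Fintype.equivOfCardEq (by simp [hcard]) : Fin m ≃ R) h1
  obtain ⟨K2, hK2⟩ := FKProof.fk_equiv
    (Fintype.equivOfCardEq (by rw [hsum]; simp) : Fin (m + 6 * t) ≃ (Σ h : R, Fin (w h))) h2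
  choose KB hKB using fun h => FKProof.piece_block (w h) (hw h)
  have e : ((Fin 42 × R) ⊕ (Σ h : R, Fin (w h))) ≃ Fin (43 * m + 6 * t) := Fintype.equivOfCardEq (by rw [hV]; simp)
  apply FKProof.fk_equiv e
  let q : Fin 42 → R := fun i => r i.castSucc
  let l : R := r (Fin.last 42)
  have hq : ∀ i j, i ≠ j → IsUnit (q i - q j) := fun i j hij =>
    hr _ _ (fun h => hij (Fin.castSucc_injective _ h))
  have hl : ∀ i, IsUnit (q i - l) := fun i => hr _ _ (Fin.castSucc_lt_last i).ne
  -- the three kinds of maps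
  let fA : ∀ p : R × R, Fin 42 ⊕ Fin (w (p.1 + l * p.2)) → ((Fin 42 × R) ⊕ (Σ h : R, Fin (w h))) := fun p =>
    Sum.elim (fun i => Sum.inl (i, p.1 + q i * p.2)) (fun k => Sum.inr ⟨p.1 + l * p.2, k⟩)
  have hfA : ∀ p, Function.Injective (fA p) := by
    rintro p (a | a) (b | b) h
    · simp only [fA, Sum.elim_inl, Sum.inl.injEq, Prod.mk.injEq] at h
      rw [h.1]
    · simp [fA] at h
    · simp [fA] at h
    · simp only [fA, Sum.elim_inr, Sum.inr.injEq, Sigma.mk.injEq, heq_eq_eq, true_and] at h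
      rw [h]
  have hfB : ∀ i : Fin 42, Function.Injective (fun x : R => (Sum.inl (i, x) : ((Fin 42 × R) ⊕ (Σ h : R, Fin (w h))))) := by
    intro i x y h
    simpa using h
  have hfC : Function.Injective (fun x => (Sum.inr x : ((Fin 42 × R) ⊕ (Σ h : R, Fin (w h))))) := Sum.inr_injective
  let C : (R × R) ⊕ Option (Fin 42) → Fin 7 → ((Fin 42 × R) ⊕ (Σ h : R, Fin (w h))) → ((Fin 42 × R) ⊕ (Σ h : R, Fin (w h))) → Prop := fun j _ x y =>
    match j, x, y with
    | Sum.inl p, Sum.inl x, Sum.inl y =>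
        x.2 = p.1 + q x.1 * p.2 ∧ y.2 = p.1 + q y.1 * p.2
    | Sum.inl p, Sum.inl x, Sum.inr y => x.2 = p.1 + q x.1 * p.2 ∧ y.1 = p.1 + l * p.2
    | Sum.inl p, Sum.inr x, Sum.inl y => x.1 = p.1 + l * p.2 ∧ y.2 = p.1 + q y.1 * p.2
    | Sum.inr (some i), Sum.inl x, Sum.inl y => x.1 = i ∧ y.1 = i
    | Sum.inr none, Sum.inr _, Sum.inr _ => True
    | _, _, _ => False
  have key : ∀ j, ∃ K, FKProof.IsPiece K (C j) := by
    rintro (p | _ | i)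
    · refine ⟨_, ((hKB (p.1 + l * p.2)).transport (hfA p)).congr ?_⟩
      rintro i (⟨x1, x2⟩ | ⟨x1, x2⟩) (⟨y1, y2⟩ | ⟨y1, y2⟩) hxy
      · constructor
        · rintro ⟨h1, h2⟩
          exact ⟨Sum.inl x1, Sum.inl y1, by simp_all [fA], by simp_all [fA], by simp⟩
        · rintro ⟨a | a, b | b, ha, hb, -⟩ <;> simp [fA] at ha hb
          obtain ⟨rfl, rfl⟩ := ha
          obtain ⟨rfl, rfl⟩ := hb
          exact ⟨rfl, rfl⟩
      · constructor
        · rintro ⟨h1, h2⟩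
          simp only at h1 h2
          subst h1 h2
          exact ⟨Sum.inl x1, Sum.inr y2, rfl, rfl, by simp⟩
        · rintro ⟨a | a, b | b, ha, hb, -⟩ <;> simp [fA] at ha hb
          exact ⟨by rw [← ha.1, ← ha.2], hb.1.symm⟩
      · constructor
        · rintro ⟨h1, h2⟩
          simp only at h1 h2
          subst h1 h2
          exact ⟨Sum.inr x2, Sum.inl y1, rfl, rfl, by simp⟩
        · rintro ⟨a | a, b | b, ha, hb, -⟩ <;> simp [fA] at ha hb
          exact ⟨ha.1.symm, by rw [← hb.1, ← hb.2]⟩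
      · constructor
        · intro h; exact h.elim
        · rintro ⟨a | a, b | b, ha, hb, h⟩ <;> simp [fA] at ha hb h
    · refine ⟨_, ((FKProof.IsPiece.ofFK hK2).transport hfC).congr ?_⟩
      rintro i (x | x) (y | y) hxy <;> simp [C]
    · refine ⟨_, ((FKProof.IsPiece.ofFK hK1).transport (hfB i)).congr ?_⟩
      rintro - (⟨x1, x2⟩ | x) (⟨y1, y2⟩ | y) hxy <;> simp [C, eq_comm]
  choose K hK using key
  refine ⟨_, (FKProof.IsPiece.combine hK (fun _ _ _ => True) ?_
    (fun _ _ _ _ h => (h trivial).elim)).toFK (fun _ _ _ _ => trivial)⟩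
  rintro i (⟨x1, x2⟩ | x) (⟨y1, y2⟩ | y) hxy -
  · by_cases h : x1 = y1
    · subst h
      refine ⟨Sum.inr (some x1), ⟨rfl, rfl⟩, ?_⟩
      rintro (p | _ | k) hp
      · exfalso
        apply hxy
        obtain ⟨ha, hb⟩ := hp
        simp only at ha hb
        rw [ha, hb]
      · exact hp.elim
      · rw [← hp.1]
    · obtain ⟨p, hp, hu⟩ := FKProof.td_unique (x := x2) (y := y2) (hq x1 y1 h)
      refine ⟨Sum.inl p, hp, ?_⟩
      rintro (p' | _ | k) hp'
      · rw [hu p' hp']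
      · exact hp'.elim
      · exact (h (hp'.1.trans hp'.2.symm)).elim
  · obtain ⟨p, hp, hu⟩ := FKProof.td_unique (x := x2) (y := y.1) (hl x1)
    refine ⟨Sum.inl p, hp, ?_⟩
    rintro (p' | _ | k) hp'
    · rw [hu p' hp']
    · exact hp'.elim
    · exact hp'.elim
  · obtain ⟨p, hp, hu⟩ := FKProof.td_unique (x := y2) (y := x.1) (hl y1)
    refine ⟨Sum.inl p, ⟨hp.2, hp.1⟩, ?_⟩
    rintro (p' | _ | k) hp'
    · rw [hu p' ⟨hp'.2, hp'.1⟩]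
    · exact hp'.elim
    · exact hp'.elim
  · refine ⟨Sum.inr none, trivial, ?_⟩
    rintro (p' | _ | k) hp'
    · exact hp'.elim
    · rfl
    · exact hp'.elim
end
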